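/- Let p, q, r be distinct primes, none congruent to 3 modulo 4, with (p/q) = (q/r) = (r/p) = −1. Then the class number of the multiquadratic number field L = ℚ(√p, √q, √r) is even if and only if (pq/r)₄ (qr/p)₄ (rp/q)₄ = −1 (these quartic symbols are defined since (pq/r) = (qr/p) = (rp/q) = 1). -/

import Mathlib

open scoped Classical in
noncomputable def legSym (a : ℤ) (p : ℕ) : ℤ :=
  if p = 2 then (if a % 8 = 1 ∨ a % 8 = 7 then 1 else -1)
  else if ∃ x : ℤ, (p : ℤ) ∣ (x ^ 2 - a) then 1 else -1

open scoped Classical in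
noncomputable def quartSym (a : ℤ) (p : ℕ) : ℤ :=
  if p = 2 then (if a % 16 = 1 ∨ a % 16 = 15 then 1 else -1)
  else if ∃ x : ℤ, (p : ℤ) ∣ (x ^ 4 - a) then 1 else -1

open NumberField
open scoped NumberTheorySymbols

set_option linter.unusedSectionVars false

section Reciprocity

theorem jacobiSym_congr {a b : ℤ} {m : ℕ} (h : (m : ℤ) ∣ a - b) : J(a | m) = J(b | m) :=
  jacobiSym.mod_left' (Int.modEq_iff_dvd.2 h).symm

theorem jacobiSym_eq_one_of_dvd {m : ℕ} {a u w : ℤ} (hd : (m : ℤ) ∣ a * u ^ 2 - w ^ 2)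
    (hw : w.gcd m = 1) : J(a | m) = 1 := by
  have h1 := jacobiSym_congr hd
  rw [jacobiSym.mul_left, jacobiSym.pow_left, jacobiSym.pow_left, jacobiSym.sq_one hw] at h1
  rcases jacobiSym.trichotomy u m with h | h | h <;> rw [h] at h1 <;> linarith

theorem gcd_eq_one_of_not_dvd {ℓ : ℕ} (hℓ : ℓ.Prime) {w : ℤ} (hw : ¬ (ℓ : ℤ) ∣ w) :
    w.gcd ℓ = 1 := by
  rw [← Int.isCoprime_iff_gcd_eq_one]
  exact ((Nat.prime_iff_prime_int.1 hℓ).coprime_iff_not_dvd.2 hw).symm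

theorem jacobiSym_neg_one_of_mod_four {ℓ : ℕ} (h4 : ℓ % 4 = 1) : J(-1 | ℓ) = 1 := by
  rw [jacobiSym.at_neg_one (Nat.odd_iff.2 (by omega)), ZMod.χ₄_nat_one_mod_four h4]

/-- The quartic symbol of a square modulo a prime. -/
theorem quartSym_eq_jacobiSym {ℓ : ℕ} (hℓ : ℓ.Prime) (h4 : ℓ % 4 = 1) {a y w : ℤ}
    (hd : (ℓ : ℤ) ∣ a * y ^ 2 - w ^ 2) (hy : ¬ (ℓ : ℤ) ∣ y) (hw : ¬ (ℓ : ℤ) ∣ w) :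
    quartSym a ℓ = J(w * y | ℓ) := by
  have hp := Nat.prime_iff_prime_int.1 hℓ
  have : Fact ℓ.Prime := ⟨hℓ⟩
  have h2 : ℓ ≠ 2 := by omega
  have hgy := gcd_eq_one_of_not_dvd hℓ hy
  have hgw := gcd_eq_one_of_not_dvd hℓ hw
  rw [quartSym, if_neg h2]
  split_ifs with h
  · obtain ⟨v, hv⟩ := h
    have h3 : (ℓ : ℤ) ∣ (v ^ 2 * y - w) * (v ^ 2 * y + w) := by
      obtain ⟨c, hc⟩ := hd
      obtain ⟨e, he⟩ := hv
      exact ⟨e * y ^ 2 + c, by linear_combination hc + y ^ 2 * he⟩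
    have hvl : ¬ (ℓ : ℤ) ∣ v := by
      intro hvl
      have : (ℓ : ℤ) ∣ w ^ 2 := by
        obtain ⟨c, hc⟩ := hd
        obtain ⟨e, he⟩ := hv
        obtain ⟨f, rfl⟩ := hvl
        exact ⟨f * ((ℓ : ℤ) * f) ^ 3 * y ^ 2 - e * y ^ 2 - c, by
          linear_combination -hc - y ^ 2 * he⟩
      exact hw (hp.dvd_of_dvd_pow this)
    have h4' : J(v ^ 2 | ℓ) = 1 := jacobiSym.sq_one' (gcd_eq_one_of_not_dvd hℓ hvl)
    have h5 : J(w | ℓ) = J(y | ℓ) := by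
      rcases hp.dvd_or_dvd h3 with h | h
      · rw [← jacobiSym_congr h, jacobiSym.mul_left, h4', one_mul]
      · have h' : (ℓ : ℤ) ∣ v ^ 2 * y - (-1) * w := by
          obtain ⟨c, hc⟩ := h
          exact ⟨c, by linear_combination hc⟩
        have := jacobiSym_congr h'
        rw [jacobiSym.mul_left, jacobiSym.mul_left, h4', jacobiSym_neg_one_of_mod_four h4, one_mul,
          one_mul] at this
        exact this.symm
    rw [jacobiSym.mul_left, h5, ← sq, jacobiSym.sq_one hgy]
  · rcases jacobiSym.trichotomy (w * y) ℓ with h0 | h0 | h0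
    · rw [jacobiSym.mul_left] at h0
      rcases mul_eq_zero.1 h0 with h0 | h0
      · exact absurd h0 (jacobiSym.ne_zero hgw)
      · exact absurd h0 (jacobiSym.ne_zero hgy)
    · exfalso
      obtain ⟨v, hv⟩ := ZMod.isSquare_of_jacobiSym_eq_one h0
      apply h
      have hy0 : ((y : ℤ) : ZMod ℓ) ≠ 0 := by
        rw [Ne, ZMod.intCast_zmod_eq_zero_iff_dvd]; exact hy
      refine ⟨((v / (y : ZMod ℓ) : ZMod ℓ).val : ℤ), ?_⟩
      rw [← ZMod.intCast_zmod_eq_zero_iff_dvd] at hd ⊢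
      push_cast at hd hv ⊢
      rw [ZMod.natCast_zmod_val, div_pow, sub_eq_zero, div_eq_iff (pow_ne_zero _ hy0)]
      linear_combination (-v ^ 2 - w * y) * hv - (y : ZMod ℓ) ^ 2 * hd
    · exact h0.symm

/-- The data entering the reciprocity law: a positive solution of a ternary quadratic equation in
pairwise coprime integers and a positive solution of a negative Pell equation. -/
structure ReciprocityData (p q r s t x y z : ℕ) : Prop where
  hp : p.Prime
  hq : q.Prime
  hr : r.Prime
  hpq : p ≠ q
  hqr : q ≠ r
  hrp : r ≠ p
  q4 : q % 4 = 1
  r4 : r % 4 = 1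
  jpq : J(p | q) = -1
  jpr : J(p | r) = -1
  jqr : J(q | r) = -1
  pell : s ^ 2 + 1 = p * q * t ^ 2
  eq : p * x ^ 2 = q * y ^ 2 + r * z ^ 2
  xy : x.Coprime y
  xz : x.Coprime z
  yz : y.Coprime z

namespace ReciprocityData

variable {p q r s t x y z : ℕ}

theorem coprime_xr (h : ReciprocityData p q r s t x y z) : x.Coprime r := by
  rw [Nat.coprime_comm, h.hr.coprime_iff_not_dvd]
  intro hx
  have h1 : r ∣ q * y ^ 2 := by
    rw [← Nat.dvd_add_left (Dvd.intro _ rfl : r ∣ r * z ^ 2), ← h.eq]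
    exact (dvd_pow hx two_ne_zero).mul_left _
  rcases (h.hr.dvd_mul).1 h1 with h2 | h2
  · exact h.hqr ((Nat.prime_dvd_prime_iff_eq h.hr h.hq).1 h2).symm
  · exact Nat.not_coprime_of_dvd_of_dvd h.hr.one_lt hx (h.hr.dvd_of_dvd_pow h2) h.xy

theorem coprime_xq (h : ReciprocityData p q r s t x y z) : x.Coprime q := by
  rw [Nat.coprime_comm, h.hq.coprime_iff_not_dvd]
  intro hx
  have h1 : q ∣ r * z ^ 2 := by
    rw [← Nat.dvd_add_right (Dvd.intro _ rfl : q ∣ q * y ^ 2), ← h.eq]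
    exact (dvd_pow hx two_ne_zero).mul_left _
  rcases (h.hq.dvd_mul).1 h1 with h2 | h2
  · exact h.hqr ((Nat.prime_dvd_prime_iff_eq h.hq h.hr).1 h2)
  · exact Nat.not_coprime_of_dvd_of_dvd h.hq.one_lt hx (h.hq.dvd_of_dvd_pow h2) h.xz

theorem coprime_yr (h : ReciprocityData p q r s t x y z) : y.Coprime r := by
  rw [Nat.coprime_comm, h.hr.coprime_iff_not_dvd]
  intro hy
  have h1 : r ∣ p * x ^ 2 := by
    rw [h.eq]
    exact dvd_add ((dvd_pow hy two_ne_zero).mul_left _) (Dvd.intro _ rfl)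
  rcases (h.hr.dvd_mul).1 h1 with h2 | h2
  · exact h.hrp ((Nat.prime_dvd_prime_iff_eq h.hr h.hp).1 h2)
  · exact Nat.not_coprime_of_dvd_of_dvd h.hr.one_lt (h.hr.dvd_of_dvd_pow h2) hy h.xy

theorem coprime_zq (h : ReciprocityData p q r s t x y z) : z.Coprime q := by
  rw [Nat.coprime_comm, h.hq.coprime_iff_not_dvd]
  intro hz
  have h1 : q ∣ p * x ^ 2 := by
    rw [h.eq]
    exact dvd_add (Dvd.intro _ rfl) ((dvd_pow hz two_ne_zero).mul_left _)
  rcases (h.hq.dvd_mul).1 h1 with h2 | h2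
  · exact h.hpq ((Nat.prime_dvd_prime_iff_eq h.hq h.hp).1 h2).symm
  · exact Nat.not_coprime_of_dvd_of_dvd h.hq.one_lt (h.hq.dvd_of_dvd_pow h2) hz h.xz

theorem coprime_yp (h : ReciprocityData p q r s t x y z) : y.Coprime p := by
  rw [Nat.coprime_comm, h.hp.coprime_iff_not_dvd]
  intro hy
  have h1 : p ∣ r * z ^ 2 := by
    rw [← Nat.dvd_add_right ((dvd_pow hy two_ne_zero).mul_left q), ← h.eq]
    exact Dvd.intro _ rfl
  rcases (h.hp.dvd_mul).1 h1 with h2 | h2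
  · exact h.hrp ((Nat.prime_dvd_prime_iff_eq h.hp h.hr).1 h2).symm
  · exact Nat.not_coprime_of_dvd_of_dvd h.hp.one_lt hy (h.hp.dvd_of_dvd_pow h2) h.yz

theorem coprime_zp (h : ReciprocityData p q r s t x y z) : z.Coprime p := by
  rw [Nat.coprime_comm, h.hp.coprime_iff_not_dvd]
  intro hz
  have h1 : p ∣ q * y ^ 2 := by
    rw [← Nat.dvd_add_left ((dvd_pow hz two_ne_zero).mul_left r), ← h.eq]
    exact Dvd.intro _ rfl
  rcases (h.hp.dvd_mul).1 h1 with h2 | h2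
  · exact h.hpq ((Nat.prime_dvd_prime_iff_eq h.hp h.hq).1 h2)
  · exact Nat.not_coprime_of_dvd_of_dvd h.hp.one_lt (h.hp.dvd_of_dvd_pow h2) hz h.yz

theorem coprime_st (h : ReciprocityData p q r s t x y z) : s.Coprime t := by
  rw [Nat.coprime_iff_gcd_eq_one]
  have h1 : s.gcd t ∣ s ^ 2 + 1 := by
    rw [h.pell]
    exact (dvd_pow (Nat.gcd_dvd_right s t) two_ne_zero).mul_left _
  have h2 : s.gcd t ∣ s ^ 2 := dvd_pow (Nat.gcd_dvd_left s t) two_ne_zero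
  exact Nat.dvd_one.1 ((Nat.dvd_add_right h2).1 h1)

theorem int_eq (h : ReciprocityData p q r s t x y z) :
    (p : ℤ) * x ^ 2 = q * y ^ 2 + r * z ^ 2 := by exact_mod_cast h.eq

theorem int_pell (h : ReciprocityData p q r s t x y z) :
    (s : ℤ) ^ 2 + 1 = p * q * t ^ 2 := by exact_mod_cast h.pell

theorem jacobi_x (h : ReciprocityData p q r s t x y z) : J(-(q * r) | x) = 1 := by
  apply jacobiSym_eq_one_of_dvd (u := y) (w := r * z)
  · exact ⟨-r * p * x, by linear_combination (r : ℤ) * h.int_eq⟩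
  · exact_mod_cast Nat.Coprime.mul_left h.coprime_xr.symm h.xz.symm

theorem jacobi_y (h : ReciprocityData p q r s t x y z) {d : ℕ} (hd : d ∣ y) :
    J(p * r | d) = 1 := by
  obtain ⟨e, rfl⟩ := hd
  apply jacobiSym_eq_one_of_dvd (u := x) (w := r * z)
  · refine ⟨r * q * d * e ^ 2, ?_⟩
    have := h.int_eq
    push_cast at this
    linear_combination (r : ℤ) * this
  · exact_mod_cast Nat.Coprime.coprime_dvd_right (Dvd.intro _ rfl)
      (Nat.Coprime.mul_left h.coprime_yr.symm h.yz.symm)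

theorem jacobi_z (h : ReciprocityData p q r s t x y z) {d : ℕ} (hd : d ∣ z) :
    J(p * q | d) = 1 := by
  obtain ⟨e, rfl⟩ := hd
  apply jacobiSym_eq_one_of_dvd (u := x) (w := q * y)
  · refine ⟨q * r * d * e ^ 2, ?_⟩
    have := h.int_eq
    push_cast at this
    linear_combination (q : ℤ) * this
  · exact_mod_cast Nat.Coprime.coprime_dvd_right (Dvd.intro _ rfl)
      (Nat.Coprime.mul_left h.coprime_zq.symm h.yz)

theorem jacobi_t (h : ReciprocityData p q r s t x y z) {d : ℕ} (hd : d ∣ t) :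
    J(-1 | d) = 1 := by
  have hst := h.coprime_st
  obtain ⟨e, rfl⟩ := hd
  apply jacobiSym_eq_one_of_dvd (u := 1) (w := s)
  · refine ⟨-p * q * d * e ^ 2, ?_⟩
    have := h.int_pell
    push_cast at this
    linear_combination -this
  · exact_mod_cast Nat.Coprime.coprime_dvd_right (Dvd.intro _ rfl) hst

theorem jacobi_A (h : ReciprocityData p q r s t x y z) (hA : s * y + t * p * x ≠ 0) :
    J(-(p * r) | s * y + t * p * x) = 1 := by
  obtain ⟨y', t', hyt, hy, ht⟩ := Nat.exists_coprime y t
  set D := y.gcd t with hD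
  have hAD : s * y + t * p * x = (s * y' + t' * p * x) * D := by rw [hy, ht]; ring
  rw [hAD] at hA ⊢
  rw [jacobiSym.mul_right' _ (left_ne_zero_of_mul hA) (right_ne_zero_of_mul hA)]
  have hDy : D ∣ y := Nat.gcd_dvd_left y t
  have hDt : D ∣ t := Nat.gcd_dvd_right y t
  have h1 : J(-(p * r) | D) = 1 := by
    rw [← neg_one_mul, jacobiSym.mul_left, h.jacobi_t hDt, h.jacobi_y hDy, one_mul]
  rw [h1, mul_one]
  apply jacobiSym_eq_one_of_dvd (u := t' * z) (w := y')
  · refine ⟨s * y' - t' * p * x, ?_⟩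
    have e1 := h.int_eq
    have e2 := h.int_pell
    rw [hy] at e1
    rw [ht] at e2
    push_cast at e1 e2 ⊢
    linear_combination (t' : ℤ) ^ 2 * p * e1 - (y' : ℤ) ^ 2 * e2
  · have hy'y : y' ∣ y := ⟨D, hy⟩
    have c1 : Nat.Coprime y' (t' * p * x) :=
      ((hyt).mul_right (h.coprime_yp.coprime_dvd_left hy'y)).mul_right
        (h.xy.symm.coprime_dvd_left hy'y)
    have c2 : Nat.Coprime y' (s * y' + t' * p * x) := by
      rw [add_comm, Nat.coprime_add_mul_right_right]
      exact c1
    exact_mod_cast c2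

/-- Reduction of the symbol of the Pell unit to that of the auxiliary number `s y + t p x`. -/
theorem jacobi_unit (h : ReciprocityData p q r s t x y z) {n : ℤ}
    (hn : (r : ℤ) ∣ n ^ 2 - p * q) :
    J(s + t * n | r) = J(y | r) * J(s * y + t * p * x | r) := by
  have hpr := Nat.prime_iff_prime_int.1 h.hr
  obtain ⟨c, hc⟩ := hn
  have e1 := h.int_eq
  have e2 := h.int_pell
  have hprod : J(s + t * n | r) * J(s - t * n | r) = 1 := by
    rw [← jacobiSym.mul_left, ← jacobiSym_neg_one_of_mod_four h.r4]
    apply jacobiSym_congr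
    exact ⟨-t ^ 2 * c, by linear_combination e2 - (t : ℤ) ^ 2 * hc⟩
  have hsym : J(s - t * n | r) = J(s + t * n | r) := by
    rcases jacobiSym.trichotomy (s + t * n) r with h1 | h1 | h1 <;> rw [h1] at hprod ⊢ <;> linarith
  have hy : J(y | r) ^ 2 = 1 := jacobiSym.sq_one (by exact_mod_cast h.coprime_yr)
  have hd : (r : ℤ) ∣ (n * y - p * x) * (n * y + p * x) :=
    ⟨c * y ^ 2 - p * z ^ 2, by linear_combination (y : ℤ) ^ 2 * hc - (p : ℤ) * e1⟩
  rcases hpr.dvd_or_dvd hd with ⟨e, he⟩ | ⟨e, he⟩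
  · have : J(s * y + t * p * x | r) = J((s + t * n) * y | r) := by
      apply jacobiSym_congr
      exact ⟨-t * e, by linear_combination -(t : ℤ) * he⟩
    rw [this, jacobiSym.mul_left]
    linear_combination -J(s + t * n | r) * hy
  · have : J(s * y + t * p * x | r) = J((s - t * n) * y | r) := by
      apply jacobiSym_congr
      exact ⟨t * e, by linear_combination (t : ℤ) * he⟩
    rw [this, jacobiSym.mul_left, hsym]
    linear_combination -J(s + t * n | r) * hy

theorem quart_r (h : ReciprocityData p q r s t x y z) :
    quartSym (p * q) r = -(J(x | r) * J(y | r)) := by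
  have hr' := Nat.prime_iff_prime_int.1 h.hr
  rw [quartSym_eq_jacobiSym h.hr h.r4 (y := y) (w := p * x), jacobiSym.mul_left,
    jacobiSym.mul_left, h.jpr]
  · ring
  · exact ⟨-p * z ^ 2, by linear_combination -(p : ℤ) * h.int_eq⟩
  · exact_mod_cast h.hr.coprime_iff_not_dvd.1 h.coprime_yr.symm
  · have h1 := h.hr.coprime_iff_not_dvd.1 h.coprime_xr.symm
    have h2 : ¬ r ∣ p := fun hd => h.hrp ((Nat.prime_dvd_prime_iff_eq h.hr h.hp).1 hd)
    exact_mod_cast fun hd => (h.hr.dvd_mul.1 hd).elim h2 h1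

theorem jrq (h : ReciprocityData p q r s t x y z) : J(r | q) = -1 := by
  rw [jacobiSym.quadratic_reciprocity_one_mod_four h.r4 (Nat.odd_iff.2 (by have := h.q4; omega)),
    h.jqr]

theorem quart_q (h : ReciprocityData p q r s t x y z) :
    quartSym (r * p) q = -(J(x | q) * J(z | q)) := by
  rw [quartSym_eq_jacobiSym h.hq h.q4 (y := x) (w := r * z), jacobiSym.mul_left,
    jacobiSym.mul_left, h.jrq]
  · ring
  · exact ⟨r * y ^ 2, by linear_combination (r : ℤ) * h.int_eq⟩
  · exact_mod_cast h.hq.coprime_iff_not_dvd.1 h.coprime_xq.symm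
  · have h1 := h.hq.coprime_iff_not_dvd.1 h.coprime_zq.symm
    have h2 : ¬ q ∣ r := fun hd => h.hqr ((Nat.prime_dvd_prime_iff_eq h.hq h.hr).1 hd)
    exact_mod_cast fun hd => (h.hq.dvd_mul.1 hd).elim h2 h1

section OddPrime

theorem not_dvd_s (h : ReciprocityData p q r s t x y z) : ¬ p ∣ s := by
  intro hd
  have h1 : p ∣ s ^ 2 + 1 := by
    rw [h.pell, mul_assoc]
    exact Dvd.intro _ rfl
  have h2 : p ∣ s ^ 2 := dvd_pow hd two_ne_zero
  exact h.hp.one_lt.ne' (Nat.dvd_one.1 ((Nat.dvd_add_right h2).1 h1))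

theorem jacobi_s (h : ReciprocityData p q r s t x y z) (p4 : p % 4 = 1) :
    J(s | p) = J(2 | p) := by
  have h1 : J((1 + s) ^ 2 | p) = J(2 * s | p) := by
    apply jacobiSym_congr
    exact ⟨q * t ^ 2, by linear_combination h.int_pell⟩
  have h2 : J(2 | p) = 1 ∨ J(2 | p) = -1 := jacobiSym.eq_one_or_neg_one (by
    apply gcd_eq_one_of_not_dvd h.hp
    intro hd
    have := (Nat.prime_dvd_prime_iff_eq h.hp Nat.prime_two).1 (by exact_mod_cast hd)
    omega)
  have h3 : J(s | p) = 1 ∨ J(s | p) = -1 := jacobiSym.eq_one_or_neg_one (by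
    apply gcd_eq_one_of_not_dvd h.hp
    exact_mod_cast h.not_dvd_s)
  rw [jacobiSym.pow_left, jacobiSym.mul_left] at h1
  have := sq_nonneg J(1 + s | p)
  rcases h2 with h2 | h2 <;> rcases h3 with h3 | h3 <;> rw [h2, h3] at h1 ⊢ <;> linarith

theorem jrp (h : ReciprocityData p q r s t x y z) (p4 : p % 4 = 1) : J(r | p) = -1 := by
  rw [jacobiSym.quadratic_reciprocity_one_mod_four h.r4 (Nat.odd_iff.2 (by omega)), h.jpr]

theorem quart_p (h : ReciprocityData p q r s t x y z) (p4 : p % 4 = 1) :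
    quartSym (q * r) p = -(J(2 | p) * J(y | p) * J(z | p)) := by
  rw [quartSym_eq_jacobiSym h.hp p4 (y := y) (w := s * r * z), jacobiSym.mul_left,
    jacobiSym.mul_left, jacobiSym.mul_left, h.jrp p4, h.jacobi_s p4]
  · ring
  · exact ⟨r * x ^ 2 - q * t ^ 2 * r ^ 2 * z ^ 2, by
      linear_combination -(r : ℤ) * h.int_eq - (r : ℤ) ^ 2 * z ^ 2 * h.int_pell⟩
  · exact_mod_cast h.hp.coprime_iff_not_dvd.1 h.coprime_yp.symm
  · have h1 := h.hp.coprime_iff_not_dvd.1 h.coprime_zp.symm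
    have h2 : ¬ p ∣ r := fun hd => h.hrp ((Nat.prime_dvd_prime_iff_eq h.hp h.hr).1 hd).symm
    exact_mod_cast fun hd => (h.hp.dvd_mul.1 hd).elim
      (fun h3 => (h.hp.dvd_mul.1 h3).elim h.not_dvd_s h2) h1

end OddPrime

end ReciprocityData

theorem Nat.sq_mod_eight (n : ℕ) :
    n ^ 2 % 8 = if n % 2 = 1 then 1 else if n % 4 = 2 then 4 else 0 := by
  have h : n % 8 < 8 := Nat.mod_lt _ (by norm_num)
  rw [Nat.pow_mod]
  have h2 : n % 2 = n % 8 % 2 := by omega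
  have h4 : n % 4 = n % 8 % 4 := by omega
  rw [h2, h4]
  generalize n % 8 = k at h
  interval_cases k <;> rfl

theorem jacobiSym_neg_one_eq_ite {m : ℕ} (hm : m % 2 = 1) :
    J(-1 | m) = if m % 4 = 1 then 1 else -1 := by
  rw [jacobiSym.at_neg_one (Nat.odd_iff.2 hm), ZMod.χ₄_nat_eq_if_mod_four]
  simp [hm]

theorem jacobiSym_two_eq_ite {m : ℕ} (hm : m % 2 = 1) :
    J(2 | m) = if m % 8 = 1 ∨ m % 8 = 7 then 1 else -1 := by
  rw [jacobiSym.at_two (Nat.odd_iff.2 hm), ZMod.χ₈_nat_eq_if_mod_eight]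
  simp [hm]

theorem jacobiSym_neg_two_eq_ite {m : ℕ} (hm : m % 2 = 1) :
    J(-2 | m) = if m % 8 = 1 ∨ m % 8 = 3 then 1 else -1 := by
  rw [jacobiSym.at_neg_two (Nat.odd_iff.2 hm), ZMod.χ₈'_nat_eq_if_mod_eight]
  simp [hm]

theorem jacobiSym_eq_one_of_odd {m y : ℕ} (hm : m % 4 = 1) (hy : y % 2 = 1)
    (h : J(m | y) = 1) : J(y | m) = 1 := by
  rw [← jacobiSym.quadratic_reciprocity_one_mod_four hm (Nat.odd_iff.2 hy), h]

theorem jacobiSym_eq_jacobiSym_two {m y : ℕ} (hm : m % 4 = 1) (hy0 : y ≠ 0) (hy : y % 2 = 0)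
    (h : ∀ d, d ∣ y → J(m | d) = 1) (h8 : y % 4 = 0 → m % 8 = 1) : J(y | m) = J(2 | m) := by
  obtain ⟨b, y', hy', rfl⟩ := Nat.exists_eq_two_pow_mul_odd hy0
  have h1 : J(y' | m) = 1 := jacobiSym_eq_one_of_odd hm (Nat.odd_iff.1 hy') (h _ (Dvd.intro_left _ rfl))
  push_cast
  rw [jacobiSym.mul_left, jacobiSym.pow_left, h1, mul_one]
  match b with
  | 0 => rw [pow_zero, one_mul] at hy; rw [Nat.odd_iff] at hy'; omega
  | 1 => rw [pow_one]
  | b + 2 =>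
    have : m % 8 = 1 := h8 (by rw [pow_add, mul_right_comm]; omega)
    rw [jacobiSym_two_eq_ite (by omega), if_pos (Or.inl this), one_pow]

namespace ReciprocityData

variable {p q r s t x y z : ℕ}

theorem x_pos (h : ReciprocityData p q r s t x y z) : x ≠ 0 := by
  rintro rfl
  have := h.coprime_xr
  rw [Nat.coprime_zero_left] at this
  exact h.hr.one_lt.ne' this

theorem y_pos (h : ReciprocityData p q r s t x y z) : y ≠ 0 := by
  rintro rfl
  have := h.coprime_yr
  rw [Nat.coprime_zero_left] at this
  exact h.hr.one_lt.ne' this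

theorem z_pos (h : ReciprocityData p q r s t x y z) : z ≠ 0 := by
  rintro rfl
  have := h.coprime_zq
  rw [Nat.coprime_zero_left] at this
  exact h.hq.one_lt.ne' this

theorem t_pos (h : ReciprocityData p q r s t x y z) : t ≠ 0 := by
  rintro rfl
  have := h.pell
  simp at this

theorem A_pos (h : ReciprocityData p q r s t x y z) : s * y + t * p * x ≠ 0 := by
  have := mul_ne_zero (mul_ne_zero h.t_pos h.hp.ne_zero) h.x_pos
  omega

theorem not_even (h : ReciprocityData p q r s t x y z) : ¬ (x % 2 = 0 ∧ y % 2 = 0) ∧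
    ¬ (x % 2 = 0 ∧ z % 2 = 0) ∧ ¬ (y % 2 = 0 ∧ z % 2 = 0) := by
  refine ⟨fun ⟨h1, h2⟩ => ?_, fun ⟨h1, h2⟩ => ?_, fun ⟨h1, h2⟩ => ?_⟩
  · exact Nat.not_coprime_of_dvd_of_dvd one_lt_two (Nat.dvd_of_mod_eq_zero h1)
      (Nat.dvd_of_mod_eq_zero h2) h.xy
  · exact Nat.not_coprime_of_dvd_of_dvd one_lt_two (Nat.dvd_of_mod_eq_zero h1)
      (Nat.dvd_of_mod_eq_zero h2) h.xz
  · exact Nat.not_coprime_of_dvd_of_dvd one_lt_two (Nat.dvd_of_mod_eq_zero h1)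
      (Nat.dvd_of_mod_eq_zero h2) h.yz

theorem jacobi_x_mul (h : ReciprocityData p q r s t x y z) (hx : x % 2 = 1) :
    J(x | q) * J(x | r) = J(-1 | x) := by
  have h1 := h.jacobi_x
  have hqr4 : (q * r) % 4 = 1 := by rw [Nat.mul_mod, h.q4, h.r4]
  have h2 := jacobiSym.quadratic_reciprocity_one_mod_four hqr4 (Nat.odd_iff.2 hx)
  rw [jacobiSym.mul_right' _ h.hq.ne_zero h.hr.ne_zero] at h2
  rw [← neg_one_mul, jacobiSym.mul_left] at h1
  push_cast at h2
  rw [h2] at h1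
  have h3 : J(-1 | x) * J(-1 | x) = 1 := by
    rw [jacobiSym_neg_one_eq_ite hx]; split_ifs <;> norm_num
  calc J(x | q) * J(x | r) = (J(-1 | x) * J(-1 | x)) * (J(x | q) * J(x | r)) := by rw [h3, one_mul]
    _ = J(-1 | x) := by rw [mul_assoc, h1, mul_one]

set_option maxHeartbeats 1000000 in
theorem reciprocity_odd (h : ReciprocityData p q r s t x y z) (p4 : p % 4 = 1) {n : ℤ}
    (hn : (r : ℤ) ∣ n ^ 2 - p * q) :
    J(s + t * n | r) = -(quartSym (p * q) r * quartSym (q * r) p * quartSym (r * p) q) := by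
  have q4 := h.q4
  have r4 := h.r4
  have e1 := congrArg (· % 8) h.eq
  have e2 := congrArg (· % 8) h.pell
  simp only [Nat.add_mod (q * y ^ 2), Nat.add_mod (s ^ 2), Nat.mul_mod _ (_ ^ 2), Nat.mul_mod p q,
    Nat.sq_mod_eight] at e1 e2
  obtain ⟨n1, n2, n3⟩ := h.not_even
  have hp8 : p % 8 = 1 ∨ p % 8 = 5 := by omega
  have hq8 : q % 8 = 1 ∨ q % 8 = 5 := by omega
  have hr8 : r % 8 = 1 ∨ r % 8 = 5 := by omega
  have hpq8 : p * q % 8 = p % 8 * (q % 8) % 8 := Nat.mul_mod _ _ _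
  have hpr8 : p * r % 8 = p % 8 * (r % 8) % 8 := Nat.mul_mod _ _ _
  have hpq4 : p * q % 4 = 1 := by rw [Nat.mul_mod, p4, q4]
  have hpr4 : p * r % 4 = 1 := by rw [Nat.mul_mod, p4, r4]
  have hx : x % 2 = 1 := by
    rcases hp8 with h1 | h1 <;> rcases hq8 with h2 | h2 <;> rcases hr8 with h3 | h3 <;>
      rw [h1, h2, h3] at e1 <;> split_ifs at e1 <;> omega
  have ht : t % 2 = 1 := by
    rcases hp8 with h1 | h1 <;> rcases hq8 with h2 | h2 <;>
      rw [h1, h2] at e2 <;> split_ifs at e2 <;> omega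
  have hs : s % 2 = 0 := by
    rcases hp8 with h1 | h1 <;> rcases hq8 with h2 | h2 <;>
      rw [h1, h2] at e2 <;> split_ifs at e2 <;> omega
  rw [if_pos hx] at e1
  rw [if_pos ht, if_neg (by omega)] at e2
  have ht4 : t % 4 = 1 := by
    have := h.jacobi_t (dvd_refl t)
    rw [jacobiSym_neg_one_eq_ite ht] at this
    split_ifs at this with h4
    exact h4
  have hA4 : (s * y + t * p * x) % 4 = (s * y + x) % 4 := by
    rw [Nat.add_mod, Nat.add_mod (s * y) x, Nat.mul_mod (t * p), Nat.mul_mod t, ht4, p4]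
    simp
  have hsy : s * y % 4 = if s % 4 = 0 ∨ y % 2 = 0 then 0 else 2 := by
    obtain ⟨s', rfl⟩ := Nat.dvd_of_mod_eq_zero hs
    rw [mul_assoc]
    have h1 : s' * y % 2 = (s' % 2) * (y % 2) % 2 := Nat.mul_mod _ _ _
    rcases Nat.mod_two_eq_zero_or_one s' with h2 | h2 <;>
      rcases Nat.mod_two_eq_zero_or_one y with h3 | h3 <;> rw [h2, h3] at h1 <;> split_ifs <;> omega
  have hAodd : (s * y + t * p * x) % 2 = 1 := by split_ifs at hsy <;> omega
  have hApr : J(s * y + t * p * x | p) * J(s * y + t * p * x | r) =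
      J(-1 | s * y + t * p * x) := by
    have h1 := h.jacobi_A h.A_pos
    have h2 := jacobiSym.quadratic_reciprocity_one_mod_four hpr4 (Nat.odd_iff.2 hAodd)
    rw [jacobiSym.mul_right' _ h.hp.ne_zero h.hr.ne_zero] at h2
    rw [← neg_one_mul, jacobiSym.mul_left] at h1
    push_cast at h2
    rw [h2] at h1
    have h3 : J(-1 | s * y + t * p * x) * J(-1 | s * y + t * p * x) = 1 := by
      rw [jacobiSym_neg_one_eq_ite hAodd]; split_ifs <;> norm_num
    linear_combination J(-1 | s * y + t * p * x) * h1 -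
      J(s * y + t * p * x | p) * J(s * y + t * p * x | r) * h3
  have hAp : J(s * y + t * p * x | p) = J(2 | p) * J(y | p) := by
    rw [← h.jacobi_s p4, ← jacobiSym.mul_left]
    exact jacobiSym_congr ⟨t * x, by ring⟩
  rw [h.jacobi_unit hn, h.quart_r, h.quart_p p4, h.quart_q]
  have hxx := h.jacobi_x_mul hx
  have hyy := fun d hd => h.jacobi_y (d := d) hd
  have hzz := fun d hd => h.jacobi_z (d := d) hd
  have hyp : J(y | p * r) = J(y | p) * J(y | r) :=
    jacobiSym.mul_right' _ h.hp.ne_zero h.hr.ne_zero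
  have hzp : J(z | p * q) = J(z | p) * J(z | q) :=
    jacobiSym.mul_right' _ h.hp.ne_zero h.hq.ne_zero
  have p2 : J(2 | p) ^ 2 = 1 := by
    rw [jacobiSym_two_eq_ite (by omega)]; split_ifs <;> norm_num
  have yp2 : J(y | p) ^ 2 = 1 := jacobiSym.sq_one (by exact_mod_cast h.coprime_yp)
  rcases Nat.mod_two_eq_zero_or_one y with hy | hy
  · have hz : z % 2 = 1 := by omega
    have hyv : J(y | p * r) = J(2 | p * r) := by
      refine jacobiSym_eq_jacobiSym_two hpr4 h.y_pos hy (by exact_mod_cast hyy) fun h4 => ?_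
      rw [if_neg (by omega), if_neg (by omega), if_pos hz] at e1
      rw [hpr8]
      rcases hp8 with h1 | h1 <;> rcases hr8 with h3 | h3 <;> rw [h1, h3] at e1 ⊢ <;> omega
    have hzv : J(z | p * q) = 1 := jacobiSym_eq_one_of_odd hpq4 hz (by exact_mod_cast hzz z dvd_rfl)
    have hA : J(-1 | s * y + t * p * x) = J(-1 | x) := by
      rw [jacobiSym_neg_one_eq_ite hAodd, jacobiSym_neg_one_eq_ite hx]
      rw [if_pos (Or.inr hy)] at hsy
      have : (s * y + t * p * x) % 4 = x % 4 := by omega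
      rw [this]
    rw [hA, ← hxx, hAp] at hApr
    rw [hzp] at hzv
    have h5 : J(s * y + t * p * x | r) = J(2 | p) * J(y | p) * (J(x | q) * J(x | r)) := by
      linear_combination J(2 | p) * J(y | p) * hApr - J(s * y + t * p * x | r) * p2 -
        J(s * y + t * p * x | r) * J(2 | p) ^ 2 * yp2
    rw [h5]
    linear_combination (-J(2 | p) * J(y | p) * J(y | r) * J(x | q) * J(x | r)) * hzv
  · have hz : z % 2 = 0 := by
      rcases hp8 with h1 | h1 <;> rcases hq8 with h2 | h2 <;> rcases hr8 with h3 | h3 <;>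
        rw [h1, h2, h3] at e1 <;> split_ifs at e1 <;> omega
    have hzv : J(z | p * q) = J(2 | p * q) := by
      refine jacobiSym_eq_jacobiSym_two hpq4 h.z_pos hz (by exact_mod_cast hzz) fun h4 => ?_
      rw [if_pos hy, if_neg (by omega), if_neg (by omega)] at e1
      rw [hpq8]
      rcases hp8 with h1 | h1 <;> rcases hq8 with h3 | h3 <;> rw [h1, h3] at e1 ⊢ <;> omega
    have hyv : J(y | p * r) = 1 := jacobiSym_eq_one_of_odd hpr4 hy (by exact_mod_cast hyy y dvd_rfl)
    have hA : J(-1 | s * y + t * p * x) = J(-1 | x) * J(2 | p * q) := by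
      rw [jacobiSym_neg_one_eq_ite hAodd, jacobiSym_neg_one_eq_ite hx,
        jacobiSym_two_eq_ite (by omega)]
      have hpq : p * q % 8 = if s % 4 = 0 then 1 else 5 := by
        rw [hpq8]
        split_ifs at e2 ⊢ <;> omega
      split_ifs at hsy hpq with hs4 hs4 <;> rw [hpq, hA4]
      · rw [Nat.add_mod, hsy]
        simp
      · omega
      · omega
      · split_ifs <;> omega
    have hpq1 : J(2 | p * q) ^ 2 = 1 := by
      rw [jacobiSym_two_eq_ite (by omega)]; split_ifs <;> norm_num
    rw [hA, ← hxx, hAp, ← hzv, hzp] at hApr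
    have h5 : J(s * y + t * p * x | r) = J(2 | p) * J(y | p) * (J(x | q) * J(x | r) *
        (J(z | p) * J(z | q))) := by
      linear_combination J(2 | p) * J(y | p) * hApr - J(s * y + t * p * x | r) * p2 -
        J(s * y + t * p * x | r) * J(2 | p) ^ 2 * yp2
    rw [h5]
    ring

set_option maxHeartbeats 1000000 in
theorem reciprocity_two (h : ReciprocityData 2 q r s t x y z) {n : ℤ}
    (hn : (r : ℤ) ∣ n ^ 2 - 2 * q) :
    J(s + t * n | r) = -(quartSym (2 * q) r * quartSym (q * r) 2 * quartSym (r * 2) q) := by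
  have q4 := h.q4
  have r4 := h.r4
  have hq8 : q % 8 = 5 := by
    have := h.jpq
    push_cast at this
    rw [jacobiSym_two_eq_ite (by omega)] at this
    split_ifs at this with h8
    omega
  have hr8 : r % 8 = 5 := by
    have := h.jpr
    push_cast at this
    rw [jacobiSym_two_eq_ite (by omega)] at this
    split_ifs at this with h8
    omega
  have e1 := congrArg (· % 8) h.eq
  have e2 := congrArg (· % 8) h.pell
  simp only [Nat.add_mod (q * y ^ 2), Nat.add_mod (s ^ 2), Nat.mul_mod _ (_ ^ 2), Nat.mul_mod 2 q,
    Nat.sq_mod_eight, hq8, hr8] at e1 e2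
  obtain ⟨n1, n2, n3⟩ := h.not_even
  have hxyz : x % 2 = 1 ∧ y % 2 = 1 ∧ z % 2 = 1 := by
    split_ifs at e1 <;> omega
  obtain ⟨hx, hy, hz⟩ := hxyz
  have hst : s % 2 = 1 ∧ t % 2 = 1 := by
    split_ifs at e2 <;> omega
  obtain ⟨hs, ht⟩ := hst
  have ht4 : t % 4 = 1 := by
    have := h.jacobi_t (dvd_refl t)
    rw [jacobiSym_neg_one_eq_ite ht] at this
    split_ifs at this with h4
    exact h4
  have hs8 : s % 8 = 3 ∨ s % 8 = 5 := by
    have h1 := congrArg (· % 16) h.pell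
    have h2 : t ^ 2 % 8 = 1 := by rw [Nat.sq_mod_eight, if_pos ht]
    have h3 : q * t ^ 2 % 8 = 5 := by rw [Nat.mul_mod, hq8, h2]
    have h4 : s ^ 2 % 16 = 9 := by rw [mul_assoc] at h1; omega
    have h5 : s % 16 < 16 := Nat.mod_lt _ (by norm_num)
    have h6 : s % 8 = s % 16 % 8 := by omega
    rw [Nat.pow_mod] at h4
    rw [h6]
    generalize s % 16 = k at h4 h5
    interval_cases k <;> simp at h4 ⊢
  have hAodd : (s * y + t * 2 * x) % 2 = 1 := by
    have : s * y % 2 = 1 := by rw [Nat.mul_mod, hs, hy]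
    rw [mul_right_comm]
    omega
  have hA8 : (s * y + t * 2 * x) % 8 = ((s % 8) * (y % 8) + 2 * (x % 8)) % 8 := by
    have h1 : t * x % 4 = x % 4 := by rw [Nat.mul_mod, ht4, one_mul, Nat.mod_mod]
    have h2 : s * y % 8 = (s % 8) * (y % 8) % 8 := Nat.mul_mod _ _ _
    rw [mul_right_comm]
    omega
  have hyr : J(y | r) = J(2 | y) := by
    have h1 := h.jacobi_y (dvd_refl y)
    rw [jacobiSym.mul_left, jacobiSym.quadratic_reciprocity_one_mod_four r4 (Nat.odd_iff.2 hy)] at h1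
    push_cast at h1
    rw [jacobiSym_two_eq_ite hy] at h1 ⊢
    split_ifs at h1 ⊢ <;> linarith
  have hzq : J(z | q) = J(2 | z) := by
    have h1 := h.jacobi_z (dvd_refl z)
    rw [jacobiSym.mul_left, jacobiSym.quadratic_reciprocity_one_mod_four q4 (Nat.odd_iff.2 hz)] at h1
    push_cast at h1
    rw [jacobiSym_two_eq_ite hz] at h1 ⊢
    split_ifs at h1 ⊢ <;> linarith
  have hAr : J(s * y + t * 2 * x | r) = J(-2 | s * y + t * 2 * x) := by
    have h1 := h.jacobi_A h.A_pos
    have h2 := jacobiSym.quadratic_reciprocity_one_mod_four r4 (Nat.odd_iff.2 hAodd)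
    rw [← neg_mul, jacobiSym.mul_left, h2] at h1
    push_cast at h1
    rw [jacobiSym_neg_two_eq_ite hAodd] at h1 ⊢
    split_ifs at h1 ⊢ <;> linarith
  have hquart : quartSym (q * r) 2 = J(2 | y) * J(2 | z) := by
    rw [quartSym, if_pos rfl, jacobiSym_two_eq_ite hy, jacobiSym_two_eq_ite hz]
    have e3 := congrArg (· % 16) h.eq
    have sq16 : ∀ m : ℕ, m % 2 = 1 → m ^ 2 % 16 = if m % 8 = 1 ∨ m % 8 = 7 then 1 else 9 := by
      intro m hm
      have h5 : m % 16 < 16 := Nat.mod_lt _ (by norm_num)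
      have h6 : m % 8 = m % 16 % 8 := by omega
      have h7 : m % 2 = m % 16 % 2 := by omega
      rw [h7] at hm
      rw [Nat.pow_mod, h6]
      generalize m % 16 = k at h5 hm
      interval_cases k <;> simp at hm ⊢
    simp only [Nat.add_mod (q * y ^ 2), Nat.mul_mod _ (_ ^ 2), sq16 x hx, sq16 y hy, sq16 z hz]
      at e3
    have hq16 : q % 16 = 5 ∨ q % 16 = 13 := by omega
    have hr16 : r % 16 = 5 ∨ r % 16 = 13 := by omega
    have hqr : ((q : ℤ) * r) % 16 = ((q % 16 * (r % 16) % 16 : ℕ) : ℤ) := by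
      rw [← Nat.mul_mod]; push_cast; rfl
    rw [hqr]
    rcases hq16 with h1 | h1 <;> rcases hr16 with h2 | h2 <;> rw [h1, h2] at e3 ⊢ <;>
      split_ifs at e3 ⊢ <;> simp_all
  have q1 := h.quart_r
  have q2 := h.quart_q
  have q3 := h.jacobi_unit (n := n) (by exact_mod_cast hn)
  push_cast at q1 q2 q3
  have hxx := h.jacobi_x_mul hx
  have hA : J(-2 | s * y + t * 2 * x) = -(J(-1 | x) * J(2 | y)) := by
    rw [jacobiSym_neg_two_eq_ite hAodd, jacobiSym_neg_one_eq_ite hx, jacobiSym_two_eq_ite hy, hA8]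
    have hx8 : x % 8 < 8 := Nat.mod_lt _ (by norm_num)
    have hy8 : y % 8 < 8 := Nat.mod_lt _ (by norm_num)
    have hx2 : x % 2 = x % 8 % 2 := by omega
    have hx4 : x % 4 = x % 8 % 4 := by omega
    have hy2 : y % 2 = y % 8 % 2 := by omega
    rw [hx2] at hx
    rw [hy2] at hy
    rw [hx4]
    generalize x % 8 = k at hx8 hx
    generalize y % 8 = l at hy8 hy
    rcases hs8 with h1 | h1 <;> rw [h1] <;> interval_cases k <;> simp at hx <;>
      interval_cases l <;> simp at hy ⊢
  have hy2 : J(2 | y) ^ 2 = 1 := by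
    rw [jacobiSym_two_eq_ite hy]; split_ifs <;> norm_num
  have hz2 : J(2 | z) ^ 2 = 1 := by
    rw [jacobiSym_two_eq_ite hz]; split_ifs <;> norm_num
  rw [q1, q2, q3, hquart, hAr, hA, ← hxx, hyr, hzq]
  linear_combination (J(x | q) * J(x | r) * J(2 | y) ^ 2) * hz2

end ReciprocityData

theorem Nat.Prime.dvd_of_sq_dvd_mul_sq {ℓ r c : ℕ} (hℓ : ℓ.Prime) (hr : r.Prime)
    (h : ℓ ^ 2 ∣ r * c ^ 2) : ℓ ∣ c := by
  by_contra hc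
  have h1 : Nat.Coprime (ℓ ^ 2) (c ^ 2) := ((hℓ.coprime_iff_not_dvd).2 hc).pow 2 2
  have h2 : ℓ * ℓ ∣ r := by rw [← sq]; exact h1.dvd_of_dvd_mul_right h
  exact hℓ.one_lt.ne' (Nat.isUnit_iff.1 (hr.prime.squarefree ℓ h2))

theorem exists_pairwise_coprime_solution {p q r a b c : ℕ} (hp : p.Prime) (hq : q.Prime)
    (hr : r.Prime) (h : p * a ^ 2 = q * b ^ 2 + r * c ^ 2) (hc : c ≠ 0) :
    ∃ x y z : ℕ, p * x ^ 2 = q * y ^ 2 + r * z ^ 2 ∧ x.Coprime y ∧ x.Coprime z ∧ y.Coprime z := by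
  obtain ⟨x, hx⟩ := (Nat.gcd_dvd_left a (b.gcd c))
  obtain ⟨y, hy⟩ := (Nat.gcd_dvd_right a (b.gcd c)).trans (Nat.gcd_dvd_left b c)
  obtain ⟨z, hz⟩ := (Nat.gcd_dvd_right a (b.gcd c)).trans (Nat.gcd_dvd_right b c)
  set g := a.gcd (b.gcd c) with hg
  have hg0 : g ≠ 0 := by
    intro h0
    rw [h0, zero_mul] at hz
    exact hc hz
  have hcop : ∀ ℓ : ℕ, ℓ.Prime → ℓ ∣ x → ℓ ∣ y → ℓ ∣ z → False := by
    intro ℓ hℓ h1 h2 h3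
    have h4 : g * ℓ ∣ g := by
      conv_rhs => rw [hg]
      refine Nat.dvd_gcd ?_ (Nat.dvd_gcd ?_ ?_)
      · rw [hx]; exact mul_dvd_mul_left _ h1
      · rw [hy]; exact mul_dvd_mul_left _ h2
      · rw [hz]; exact mul_dvd_mul_left _ h3
    have h5 := Nat.le_of_dvd (Nat.pos_of_ne_zero hg0) h4
    have := hℓ.two_le
    have := Nat.mul_le_mul_left g this
    omega
  have e : p * x ^ 2 = q * y ^ 2 + r * z ^ 2 := by
    have h0 : 0 < g ^ 2 := by positivity
    apply Nat.eq_of_mul_eq_mul_left h0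
    rw [hx, hy, hz] at h
    linear_combination h
  refine ⟨x, y, z, e, ?_, ?_, ?_⟩
  · apply Nat.coprime_of_dvd
    intro ℓ hℓ h1 h2
    refine hcop ℓ hℓ h1 h2 (hℓ.dvd_of_sq_dvd_mul_sq hr ?_)
    rw [← Nat.dvd_add_right ((pow_dvd_pow_of_dvd h2 2).mul_left q), ← e]
    exact (pow_dvd_pow_of_dvd h1 2).mul_left p
  · apply Nat.coprime_of_dvd
    intro ℓ hℓ h1 h3
    refine hcop ℓ hℓ h1 (hℓ.dvd_of_sq_dvd_mul_sq hq ?_) h3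
    rw [← Nat.dvd_add_left ((pow_dvd_pow_of_dvd h3 2).mul_left r), ← e]
    exact (pow_dvd_pow_of_dvd h1 2).mul_left p
  · apply Nat.coprime_of_dvd
    intro ℓ hℓ h2 h3
    refine hcop ℓ hℓ (hℓ.dvd_of_sq_dvd_mul_sq hp ?_) h2 h3
    rw [e]
    exact dvd_add ((pow_dvd_pow_of_dvd h2 2).mul_left q) ((pow_dvd_pow_of_dvd h3 2).mul_left r)

theorem exists_pell_of_pell_four {d : ℤ} (hd : d % 4 ≠ 0) {S T : ℤ} (h : S ^ 2 - d * T ^ 2 = -4)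
    {r : ℕ} (hr : r.Prime) (hr2 : r ≠ 2) {n : ℤ} (hn : (r : ℤ) ∣ n ^ 2 - d) :
    ∃ s t : ℤ, s ^ 2 + 1 = d * t ^ 2 ∧ J(2 * (S + T * n) | r) = J(s + t * n | r) := by
  have h2 : J(2 | r) ^ 2 = 1 := jacobiSym.sq_one (by
    apply gcd_eq_one_of_not_dvd hr
    intro hd
    exact hr2 ((Nat.prime_dvd_prime_iff_eq hr Nat.prime_two).1 (by exact_mod_cast hd)))
  have hmod : ∀ a : ℤ, a ^ 2 % 4 = a % 2 := by
    intro a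
    rcases Int.emod_two_eq_zero_or_one a with h1 | h1
    · obtain ⟨b, rfl⟩ := Int.dvd_of_emod_eq_zero h1
      rw [h1, mul_pow]; omega
    · have : a = 2 * (a / 2) + 1 := by omega
      rw [this, add_sq, mul_pow]; ring_nf; omega
  rcases Int.emod_two_eq_zero_or_one T with hT | hT
  · obtain ⟨t, rfl⟩ := Int.dvd_of_emod_eq_zero hT
    have hS : S % 2 = 0 := by
      rw [← hmod]
      have : S ^ 2 = 4 * (d * t ^ 2 - 1) := by linear_combination h
      omega
    obtain ⟨s, rfl⟩ := Int.dvd_of_emod_eq_zero hS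
    refine ⟨s, t, by linarith, ?_⟩
    have : 2 * (2 * s + 2 * t * n) = 2 ^ 2 * (s + t * n) := by ring
    rw [this, jacobiSym.mul_left, jacobiSym.pow_left, h2, one_mul]
  · have hT4 : T ^ 2 % 4 = 1 := by rw [hmod, hT]
    have hdT : d * T ^ 2 % 4 = d % 4 := by rw [Int.mul_emod, hT4, mul_one, Int.emod_emod]
    have hS4 : S ^ 2 % 4 = d % 4 := by rw [← hdT]; omega
    have hd1 : d % 4 = 1 := by rw [hmod] at hS4; omega
    obtain ⟨k, hk⟩ : ∃ k, d * T ^ 2 = 2 * k + 1 := ⟨d * T ^ 2 / 2, by omega⟩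
    refine ⟨S * k, T * (k - 1), ?_, ?_⟩
    · have hS2 : S ^ 2 = 2 * k - 3 := by linear_combination h + hk
      linear_combination k ^ 2 * hS2 - (k - 1) ^ 2 * hk
    · have hcong : J((S + T * n) ^ 3 | r) = J(2 ^ 3 * (S * k + T * (k - 1) * n) | r) := by
        apply jacobiSym_congr
        obtain ⟨c, hc⟩ := hn
        have hS2 : S ^ 2 = 2 * k - 3 := by linear_combination h + hk
        refine ⟨c * (3 * S * T ^ 2 + T ^ 3 * n), ?_⟩
        linear_combination (3 * S * T ^ 2 + T ^ 3 * n) * hc + (S + 3 * T * n) * hS2 +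
          (3 * S + T * n) * hk
      rw [jacobiSym.pow_left, jacobiSym.mul_left, jacobiSym.pow_left] at hcong
      rw [jacobiSym.mul_left]
      have h3 : J(S + T * n | r) ^ 3 = J(S + T * n | r) := by
        rcases jacobiSym.trichotomy (S + T * n) r with h | h | h <;> rw [h] <;> norm_num
      linear_combination J(2 | r) * hcong - J(2 | r) * h3 +
        (J(2 | r) ^ 2 + 1) * J(S * k + T * (k - 1) * n | r) * h2

theorem jacobiSym_natAbs_add_mul {d s t n : ℤ} {r : ℕ} (hr4 : r % 4 = 1)
    (h : s ^ 2 + 1 = d * t ^ 2) (hn : (r : ℤ) ∣ n ^ 2 - d) :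
    J(s + t * n | r) = J(s.natAbs + t.natAbs * n | r) := by
  have h1 := jacobiSym_neg_one_of_mod_four hr4
  have hsym : ∀ t : ℤ, s ^ 2 + 1 = d * t ^ 2 → J(s - t * n | r) = J(s + t * n | r) := by
    intro t h
    obtain ⟨c, hc⟩ := hn
    have hprod : J(s + t * n | r) * J(s - t * n | r) = 1 := by
      rw [← jacobiSym.mul_left, ← h1]
      apply jacobiSym_congr
      exact ⟨-t ^ 2 * c, by linear_combination h - (t : ℤ) ^ 2 * hc⟩
    rcases jacobiSym.trichotomy (s + t * n) r with h1 | h1 | h1 <;> rw [h1] at hprod ⊢ <;> linarith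
  have hneg : ∀ a : ℤ, J(-a | r) = J(a | r) := by
    intro a
    rw [← neg_one_mul, jacobiSym.mul_left, h1, one_mul]
  rcases Int.natAbs_eq s with hs | hs <;> rcases Int.natAbs_eq t with ht | ht
  · rw [← hs, ← ht]
  · rw [← hs, ← neg_eq_iff_eq_neg.2 ht, neg_mul, ← sub_eq_add_neg, hsym t h]
  · rw [← ht, ← neg_eq_iff_eq_neg.2 hs, ← hsym t h, ← hneg]
    congr 1; ring
  · rw [← neg_eq_iff_eq_neg.2 ht, ← neg_eq_iff_eq_neg.2 hs, ← hneg]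
    congr 1; ring

/-- The reciprocity law for units of norm `-1` in `ℚ(√pq)`. -/
theorem reciprocity {p q r : ℕ} (hp : p.Prime) (hq : q.Prime) (hr : r.Prime) (hpq : p ≠ q)
    (hqr : q ≠ r) (hrp : r ≠ p) (p4 : p = 2 ∨ p % 4 = 1) (q4 : q % 4 = 1) (r4 : r % 4 = 1)
    (jpq : J(p | q) = -1) (jpr : J(p | r) = -1) (jqr : J(q | r) = -1) {S T n x y z : ℤ}
    (hST : S ^ 2 - p * q * T ^ 2 = -4) (hn : (r : ℤ) ∣ n ^ 2 - p * q)
    (hxyz : p * x ^ 2 - q * y ^ 2 = r * z ^ 2) (hz : z ≠ 0) :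
    J(2 * (S + T * n) | r) =
      -(quartSym (p * q) r * quartSym (q * r) p * quartSym (r * p) q) := by
  obtain ⟨x', y', z', e, hxy, hxz, hyz⟩ := exists_pairwise_coprime_solution (a := x.natAbs)
    (b := y.natAbs) (c := z.natAbs) hp hq hr (by zify; simp only [sq_abs]; linarith)
    (by simpa using hz)
  have hd : ((p : ℤ) * q) % 4 ≠ 0 := by
    have q4' : (q : ℤ) % 4 = 1 := by omega
    rw [Int.mul_emod, q4']
    rcases p4 with rfl | p4 <;> omega
  obtain ⟨s, t, hst, hJ⟩ := exists_pell_of_pell_four hd hST hr (by omega) hn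
  have D : ReciprocityData p q r s.natAbs t.natAbs x' y' z' :=
    ⟨hp, hq, hr, hpq, hqr, hrp, q4, r4, jpq, jpr, jqr, by zify; simp only [sq_abs]; exact hst,
      e, hxy, hxz, hyz⟩
  rw [hJ, jacobiSym_natAbs_add_mul r4 hst hn]
  rcases p4 with rfl | p4
  · exact_mod_cast D.reciprocity_two (by exact_mod_cast hn)
  · exact D.reciprocity_odd p4 hn

end Reciprocity

/-- `L = K(s)` where `s² = a` and `a` is not a square in `K`. -/
structure IsSqrtExt (K L : Type*) [Field K] [Field L] [Algebra K L] (a : K) (s : L) : Prop where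
  sq : s ^ 2 = algebraMap K L a
  gen : ∀ x : L, ∃ u v : K, x = algebraMap K L u + algebraMap K L v * s
  not_isSquare : ¬ IsSquare a

namespace IsSqrtExt

variable {K L : Type*} [Field K] [Field L] [Algebra K L] {a : K} {s : L}

theorem notMem (h : IsSqrtExt K L a s) (u : K) : s ≠ algebraMap K L u := by
  rintro rfl
  exact h.not_isSquare ⟨u, by
    have := h.sq
    rw [← map_pow] at this
    have h2 : u ^ 2 = a := (algebraMap K L).injective this
    rw [← h2, pow_two]⟩

theorem ext_coord (h : IsSqrtExt K L a s) {u v u' v' : K}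
    (e : algebraMap K L u + algebraMap K L v * s = algebraMap K L u' + algebraMap K L v' * s) :
    u = u' ∧ v = v' := by
  have hv : v = v' := by
    by_contra hne
    have hne' : algebraMap K L v - algebraMap K L v' ≠ 0 := by
      rw [← map_sub]
      exact (map_ne_zero _).2 (sub_ne_zero.2 hne)
    refine h.notMem ((u' - u) / (v - v')) ?_
    rw [map_div₀, map_sub, map_sub, eq_div_iff hne']
    linear_combination e
  subst hv
  exact ⟨(algebraMap K L).injective (add_right_cancel e), rfl⟩

/-- The coordinates of an element with respect to `1, s`. -/
noncomputable def re (h : IsSqrtExt K L a s) (x : L) : K := (h.gen x).choose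

/-- The coordinate of an element along `s`. -/
noncomputable def im (h : IsSqrtExt K L a s) (x : L) : K := (h.gen x).choose_spec.choose

theorem eq_re_im (h : IsSqrtExt K L a s) (x : L) :
    x = algebraMap K L (h.re x) + algebraMap K L (h.im x) * s :=
  (h.gen x).choose_spec.choose_spec

theorem re_im_mk (h : IsSqrtExt K L a s) (u v : K) :
    h.re (algebraMap K L u + algebraMap K L v * s) = u ∧
      h.im (algebraMap K L u + algebraMap K L v * s) = v :=
  h.ext_coord (h.eq_re_im _).symm

/-- The extension of an endomorphism `σ` of `K` fixing `a` to `L`, sending `s` to `e * s` where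
`e = ±1`. -/
noncomputable def liftHom (h : IsSqrtExt K L a s) (σ : K →+* K) (hσ : σ a = a) (e : ℤ)
    (he : e * e = 1) : L →+* L where
  toFun x := algebraMap K L (σ (h.re x)) + algebraMap K L (e * σ (h.im x)) * s
  map_one' := by
    obtain ⟨h1, h2⟩ := h.re_im_mk 1 0
    simp only [map_one, map_zero, zero_mul, add_zero] at h1 h2
    simp [h1, h2]
  map_zero' := by
    obtain ⟨h1, h2⟩ := h.re_im_mk 0 0
    simp only [map_zero, zero_mul, add_zero] at h1 h2
    simp [h1, h2]
  map_add' x y := by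
    obtain ⟨h1, h2⟩ := h.re_im_mk (h.re x + h.re y) (h.im x + h.im y)
    have : algebraMap K L (h.re x + h.re y) + algebraMap K L (h.im x + h.im y) * s = x + y := by
      conv_rhs => rw [h.eq_re_im x, h.eq_re_im y]
      simp only [map_add]
      ring
    rw [this] at h1 h2
    rw [h1, h2]
    simp only [map_add, map_mul, map_intCast]
    ring
  map_mul' x y := by
    obtain ⟨h1, h2⟩ := h.re_im_mk (h.re x * h.re y + h.im x * h.im y * a)
      (h.re x * h.im y + h.im x * h.re y)
    have : algebraMap K L (h.re x * h.re y + h.im x * h.im y * a) +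
        algebraMap K L (h.re x * h.im y + h.im x * h.re y) * s = x * y := by
      conv_rhs => rw [h.eq_re_im x, h.eq_re_im y]
      simp only [map_add, map_mul, ← h.sq]
      ring
    rw [this] at h1 h2
    rw [h1, h2]
    have he' : (e : L) * e = 1 := by exact_mod_cast congrArg (Int.cast (R := L)) he
    simp only [map_add, map_mul, map_intCast, hσ, ← h.sq]
    linear_combination (-(algebraMap K L (σ (h.im x)) * algebraMap K L (σ (h.im y)) * s ^ 2)) * he'

theorem liftHom_apply (h : IsSqrtExt K L a s) (σ : K →+* K) (hσ : σ a = a) (e : ℤ)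
    (he : e * e = 1) (u v : K) :
    h.liftHom σ hσ e he (algebraMap K L u + algebraMap K L v * s) =
      algebraMap K L (σ u) + algebraMap K L (e * σ v) * s := by
  obtain ⟨h1, h2⟩ := h.re_im_mk u v
  simp only [liftHom, RingHom.coe_mk, MonoidHom.coe_mk, OneHom.coe_mk, h1, h2]

theorem liftHom_algebraMap (h : IsSqrtExt K L a s) (σ : K →+* K) (hσ : σ a = a) (e : ℤ)
    (he : e * e = 1) (u : K) :
    h.liftHom σ hσ e he (algebraMap K L u) = algebraMap K L (σ u) := by
  simpa using h.liftHom_apply σ hσ e he u 0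

theorem liftHom_self (h : IsSqrtExt K L a s) (σ : K →+* K) (hσ : σ a = a) (e : ℤ)
    (he : e * e = 1) : h.liftHom σ hσ e he s = e * s := by
  simpa using h.liftHom_apply σ hσ e he 0 1

theorem liftHom_comp_liftHom (h : IsSqrtExt K L a s) (σ : K →+* K) (hσ : σ a = a)
    (hinv : ∀ x, σ (σ x) = x) (e : ℤ) (he : e * e = 1) :
    (h.liftHom σ hσ e he).comp (h.liftHom σ hσ e he) = RingHom.id L := by
  have he' : (e : L) * e = 1 := by exact_mod_cast congrArg (Int.cast (R := L)) he
  ext x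
  obtain ⟨u, v, rfl⟩ := h.gen x
  rw [RingHom.comp_apply, liftHom_apply, liftHom_apply]
  simp only [RingHom.id_apply, hinv, map_mul, map_intCast]
  linear_combination (algebraMap K L v * s) * he'

/-- The extension of an involution of `K` fixing `a`. -/
noncomputable def lift (h : IsSqrtExt K L a s) (σ : K ≃+* K) (hσ : σ a = a)
    (hinv : ∀ x, σ (σ x) = x) (e : ℤ) (he : e * e = 1) : L ≃+* L :=
  RingEquiv.ofRingHom (h.liftHom (σ : K →+* K) hσ e he) (h.liftHom (σ : K →+* K) hσ e he)
    (h.liftHom_comp_liftHom (σ : K →+* K) hσ hinv e he)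
    (h.liftHom_comp_liftHom (σ : K →+* K) hσ hinv e he)

theorem lift_algebraMap (h : IsSqrtExt K L a s) (σ : K ≃+* K) (hσ : σ a = a)
    (hinv : ∀ x, σ (σ x) = x) (e : ℤ) (he : e * e = 1) (u : K) :
    h.lift σ hσ hinv e he (algebraMap K L u) = algebraMap K L (σ u) :=
  h.liftHom_algebraMap (σ : K →+* K) hσ e he u

theorem lift_self (h : IsSqrtExt K L a s) (σ : K ≃+* K) (hσ : σ a = a)
    (hinv : ∀ x, σ (σ x) = x) (e : ℤ) (he : e * e = 1) :
    h.lift σ hσ hinv e he s = e * s :=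
  h.liftHom_self (σ : K →+* K) hσ e he

theorem lift_lift (h : IsSqrtExt K L a s) (σ : K ≃+* K) (hσ : σ a = a)
    (hinv : ∀ x, σ (σ x) = x) (e : ℤ) (he : e * e = 1) (x : L) :
    h.lift σ hσ hinv e he (h.lift σ hσ hinv e he x) = x :=
  (h.lift σ hσ hinv e he).symm_apply_apply x

/-- The nontrivial automorphism of `L` over `K`. -/
noncomputable def conj (h : IsSqrtExt K L a s) : L ≃ₐ[K] L :=
  AlgEquiv.ofRingEquiv (f := h.lift (RingEquiv.refl K) rfl (fun _ => rfl) (-1) rfl)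
    (fun u => h.lift_algebraMap _ _ _ _ _ u)

theorem conj_self (h : IsSqrtExt K L a s) : h.conj s = -s := by
  have := h.lift_self (RingEquiv.refl K) rfl (fun _ => rfl) (-1) rfl
  simpa using! this

theorem conj_conj (h : IsSqrtExt K L a s) (x : L) : h.conj (h.conj x) = x :=
  h.lift_lift (RingEquiv.refl K) rfl (fun _ => rfl) (-1) rfl x

theorem ne_zero (h : IsSqrtExt K L a s) : s ≠ 0 := by
  simpa using h.notMem 0

theorem exists_of_conj_eq [CharZero K] (h : IsSqrtExt K L a s) {x : L} (hx : h.conj x = x) :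
    ∃ u : K, algebraMap K L u = x := by
  have : CharZero L := charZero_of_injective_algebraMap (algebraMap K L).injective
  obtain ⟨u, v, rfl⟩ := h.gen x
  refine ⟨u, ?_⟩
  rw [map_add, map_mul, h.conj_self, AlgEquiv.commutes, AlgEquiv.commutes] at hx
  have h2 : (2 : L) * (algebraMap K L v * s) = 0 := by linear_combination -hx
  have := (mul_eq_zero.1 h2).resolve_left two_ne_zero
  rw [this, add_zero]

theorem exists_of_conj_eq_neg [CharZero K] (h : IsSqrtExt K L a s) {x : L} (hx : h.conj x = -x) :
    ∃ u : K, x = algebraMap K L u * s := by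
  have : CharZero L := charZero_of_injective_algebraMap (algebraMap K L).injective
  obtain ⟨u, v, rfl⟩ := h.gen x
  refine ⟨v, ?_⟩
  rw [map_add, map_mul, h.conj_self, AlgEquiv.commutes, AlgEquiv.commutes] at hx
  have h2 : (2 : L) * (algebraMap K L u) = 0 := by linear_combination hx
  have := (mul_eq_zero.1 h2).resolve_left two_ne_zero
  rw [this, zero_add]

theorem eq_one_or_conj (h : IsSqrtExt K L a s) (g : L ≃ₐ[K] L) : g = 1 ∨ g = h.conj := by
  have h1 : g s = s ∨ g s = - s := by
    apply sq_eq_sq_iff_eq_or_eq_neg.1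
    rw [← map_pow, h.sq, AlgEquiv.commutes]
  rcases h1 with h1 | h1
  · left
    ext x
    obtain ⟨u, v, rfl⟩ := h.gen x
    simp [h1]
  · right
    ext x
    obtain ⟨u, v, rfl⟩ := h.gen x
    simp [h1, h.conj_self]

theorem finrank_eq_two (h : IsSqrtExt K L a s) : Module.finrank K L = 2 := by
  have hli : LinearIndependent K ![(1 : L), s] := by
    rw [LinearIndependent.pair_iff]
    intro u v huv
    have := h.ext_coord (u := u) (v := v) (u' := 0) (v' := 0)
      (by simpa [Algebra.smul_def] using huv)
    exact this
  have hsp : ⊤ ≤ Submodule.span K (Set.range ![(1 : L), s]) := by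
    intro x _
    obtain ⟨u, v, rfl⟩ := h.gen x
    rw [Matrix.range_cons, Matrix.range_cons, Matrix.range_empty, Set.union_empty]
    refine Submodule.mem_span_pair.2 ⟨u, v, by simp [Algebra.smul_def]⟩
  simpa using Module.finrank_eq_card_basis (Module.Basis.mk hli hsp)

theorem isGalois [CharZero K] (h : IsSqrtExt K L a s) : IsGalois K L := by
  have : Algebra.IsQuadraticExtension K L :=
    { finrank_eq_two' := h.finrank_eq_two }
  have : FiniteDimensional K L := Module.finite_of_finrank_eq_succ h.finrank_eq_two
  infer_instance

theorem algebraMap_norm [CharZero K] (h : IsSqrtExt K L a s) (x : L) :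
    algebraMap K L (Algebra.norm K x) = x * h.conj x := by
  classical
  have := h.isGalois
  have : CharZero L := charZero_of_injective_algebraMap (algebraMap K L).injective
  have : FiniteDimensional K L := Module.finite_of_finrank_eq_succ h.finrank_eq_two
  rw [Algebra.norm_eq_prod_automorphisms]
  have hne : (1 : L ≃ₐ[K] L) ≠ h.conj := by
    intro hc
    have h1 := h.conj_self
    rw [← hc, AlgEquiv.one_apply, self_eq_neg] at h1
    exact h.ne_zero h1
  have huniv : (Finset.univ : Finset (L ≃ₐ[K] L)) = {1, h.conj} := by
    ext g
    simpa using h.eq_one_or_conj g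
  rw [huniv, Finset.prod_pair hne, AlgEquiv.one_apply]

theorem norm_mk [CharZero K] (h : IsSqrtExt K L a s) (u v : K) :
    Algebra.norm K (algebraMap K L u + algebraMap K L v * s) = u ^ 2 - a * v ^ 2 := by
  apply (algebraMap K L).injective
  rw [h.algebraMap_norm, map_add, map_mul, h.conj_self, AlgEquiv.commutes, AlgEquiv.commutes,
    map_sub, map_pow, map_mul, map_pow, ← h.sq]
  ring

/-- A square of `L` lying in `K` is a square in `K`, up to a factor `a`. -/
theorem isSquare_or [CharZero K] (h : IsSqrtExt K L a s) {b : K} (hb : IsSquare (algebraMap K L b)) :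
    IsSquare b ∨ IsSquare (a * b) := by
  have : CharZero L := charZero_of_injective_algebraMap (algebraMap K L).injective
  obtain ⟨x, hx⟩ := hb
  obtain ⟨u, v, rfl⟩ := h.gen x
  have h1 : algebraMap K L b + algebraMap K L 0 * s =
      algebraMap K L (u ^ 2 + v ^ 2 * a) + algebraMap K L (2 * u * v) * s := by
    simp only [map_add, map_mul, map_pow, ← h.sq, map_zero, map_ofNat, hx]
    ring
  obtain ⟨h2, h3⟩ := h.ext_coord h1
  rcases mul_eq_zero.1 h3.symm with h4 | h4
  · have hu : u = 0 := by simpa using h4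
    right
    exact ⟨a * v, by rw [h2, hu]; ring⟩
  · left
    exact ⟨u, by rw [h2, h4]; ring⟩

end IsSqrtExt

section AbstractHerbrand

theorem index_range_powMonoidHom_two {A : Type*} [CommGroup A] [Module.Finite ℤ (Additive A)]
    (ε : A) (hε : ε ^ 2 = 1) (htors : ∀ a : A, IsOfFinOrder a → a = 1 ∨ a = ε)
    (hns : ∀ a : A, a ^ 2 ≠ ε) :
    (powMonoidHom 2 : A →* A).range.index = 2 ^ (Module.finrank ℤ (Additive A) + 1) := by
  classical
  let T := Submodule.torsion ℤ (Additive A)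
  let b := Module.finBasis ℤ (Additive A ⧸ T)
  let φ : Additive A →+ (Fin (Module.finrank ℤ (Additive A ⧸ T)) → ZMod 2) :=
    ((Int.castAddHom (ZMod 2)).compLeft _).comp
      ((b.equivFun.toLinearMap.comp T.mkQ).toAddMonoidHom)
  have hφs : Function.Surjective φ := by
    intro y
    obtain ⟨x, hx⟩ := T.mkQ_surjective (b.equivFun.symm fun j => (y j).val)
    refine ⟨x, ?_⟩
    ext j
    simp only [φ, AddMonoidHom.comp_apply, LinearMap.toAddMonoidHom_coe, LinearMap.comp_apply, hx]
    change (((b.equivFun (b.equivFun.symm fun j => ((y j).val : ℤ))) j : ℤ) : ZMod 2) = y j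
    rw [LinearEquiv.apply_symm_apply]
    simp
  let ψ : A →* Multiplicative (Fin (Module.finrank ℤ (Additive A ⧸ T)) → ZMod 2) :=
    AddMonoidHom.toMultiplicativeRight φ
  have hψs : Function.Surjective ψ := hφs
  have hidx : ψ.ker.index = 2 ^ Module.finrank ℤ (Additive A) := by
    rw [Subgroup.index_ker, MonoidHom.range_eq_top.2 hψs, Subgroup.card_top]
    have : Nat.card (Multiplicative (Fin (Module.finrank ℤ (Additive A ⧸ T)) → ZMod 2)) =
      2 ^ Module.finrank ℤ (Additive A ⧸ T) := by
      change Nat.card (Fin (Module.finrank ℤ (Additive A ⧸ T)) → ZMod 2) = _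
      simp
    rw [this, finrank_quotient_eq_of_le_torsion le_rfl]
  have hker : ∀ a : A, a ∈ ψ.ker ↔ ∃ c : A, a = c ^ 2 ∨ a = c ^ 2 * ε := by
    intro a
    constructor
    · intro ha
      have ha' : φ (Additive.ofMul a) = 0 := ha
      have h1 : ∀ j, ∃ m : ℤ, b.equivFun (T.mkQ (Additive.ofMul a)) j = 2 * m := by
        intro j
        have := congrFun ha' j
        have h2 : ((b.equivFun (T.mkQ (Additive.ofMul a)) j : ℤ) : ZMod 2) = 0 := this
        exact (ZMod.intCast_zmod_eq_zero_iff_dvd _ 2).1 h2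
      choose m hm using h1
      obtain ⟨c, hc⟩ := T.mkQ_surjective (b.equivFun.symm m)
      have h3 : T.mkQ (Additive.ofMul a) = T.mkQ ((2 : ℤ) • c) := by
        apply b.equivFun.injective
        ext j
        rw [hm, map_smul, map_smul, hc, LinearEquiv.apply_symm_apply]
        simp
      have h4 : Additive.ofMul a - (2 : ℤ) • c ∈ T := by
        rw [← Submodule.ker_mkQ T, LinearMap.mem_ker, map_sub, h3, sub_self]
      obtain ⟨z, hz⟩ := h4
      have h5 : IsOfFinOrder (a / c.toMul ^ 2) := by
        have h6 : (a / c.toMul ^ 2) ^ (z : ℤ) = 1 := by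
          have : (z : ℤ) • (Additive.ofMul a - (2 : ℤ) • c) = 0 := hz
          have h7 := congrArg Additive.toMul this
          rw [toMul_zsmul, toMul_sub, toMul_zsmul, toMul_zero, toMul_ofMul] at h7
          exact_mod_cast h7
        rw [isOfFinOrder_iff_zpow_eq_one]
        exact ⟨z, nonZeroDivisors.coe_ne_zero z, h6⟩
      refine ⟨c.toMul, ?_⟩
      rcases htors _ h5 with h | h
      · left
        rwa [div_eq_one] at h
      · right
        rw [← h]
        simp
    · have hsq : ∀ c : A, ψ (c ^ 2) = 1 := by
        intro c
        rw [map_pow]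
        change (2 : ℕ) • (φ (Additive.ofMul c)) = 0
        ext j
        simp only [Pi.smul_apply, Pi.zero_apply, nsmul_eq_mul]
        have : ((2 : ℕ) : ZMod 2) = 0 := by decide
        rw [this, zero_mul]
      have hε' : ψ ε = 1 := by
        have h1 : Additive.ofMul ε ∈ T := by
          refine ⟨⟨2, by simp⟩, ?_⟩
          change (2 : ℤ) • Additive.ofMul ε = 0
          rw [← ofMul_zpow]
          exact congrArg Additive.ofMul (by exact_mod_cast hε)
        have h2 : T.mkQ (Additive.ofMul ε) = 0 := by
          rw [← LinearMap.mem_ker, Submodule.ker_mkQ]; exact h1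
        change φ (Additive.ofMul ε) = 0
        simp only [φ, AddMonoidHom.comp_apply, LinearMap.toAddMonoidHom_coe, LinearMap.comp_apply,
          h2, map_zero]
      rintro ⟨c, rfl | rfl⟩
      · exact hsq c
      · rw [MonoidHom.mem_ker, map_mul, hsq, hε', one_mul]
  have hle : (powMonoidHom 2 : A →* A).range ≤ ψ.ker := by
    rintro _ ⟨c, rfl⟩
    exact (hker _).2 ⟨c, Or.inl rfl⟩
  have hrel : (powMonoidHom 2 : A →* A).range.relIndex ψ.ker = 2 := by
    rw [Subgroup.relIndex_eq_two_iff]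
    refine ⟨ε, (hker _).2 ⟨1, by simp⟩, ?_⟩
    intro a ha
    have h1 : ¬ (a * ε ∈ (powMonoidHom 2 : A →* A).range ∧
        a ∈ (powMonoidHom 2 : A →* A).range) := by
      rintro ⟨⟨c, hc⟩, ⟨d, hd⟩⟩
      rw [powMonoidHom_apply] at hc hd
      apply hns (c / d)
      rw [div_pow, hc, hd]
      simp
    have h2 : a * ε ∈ (powMonoidHom 2 : A →* A).range ∨
        a ∈ (powMonoidHom 2 : A →* A).range := by
      obtain ⟨c, rfl | rfl⟩ := (hker a).1 ha
      · exact Or.inr ⟨c, rfl⟩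
      · left
        rw [mul_assoc, ← pow_two, hε, mul_one]
        exact ⟨c, rfl⟩
    unfold Xor
    tauto
  rw [← Subgroup.relIndex_mul_index hle, hrel, hidx, pow_succ, mul_comm]

theorem finrank_ker_add_finrank {M E : Type*} [CommGroup M] [CommGroup E]
    [Module.Finite ℤ (Additive M)] [Module.Finite ℤ (Additive E)] (ν : M →* E)
    (hν : ∀ e : E, e ^ 2 ∈ ν.range) :
    Module.finrank ℤ (Additive ν.ker) + Module.finrank ℤ (Additive E) =
      Module.finrank ℤ (Additive M) := by
  let f : Additive M →ₗ[ℤ] Additive E := (MonoidHom.toAdditive ν).toIntLinearMap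
  have h1 := Submodule.finrank_quotient_add_finrank (LinearMap.ker f)
  have h2 := Submodule.finrank_quotient_add_finrank (LinearMap.range f)
  have h3 : Module.finrank ℤ (Additive E ⧸ LinearMap.range f) = 0 := by
    rw [Module.finrank_eq_zero_iff_isTorsion]
    intro x
    induction x using Submodule.Quotient.induction_on with
    | H x =>
      refine ⟨⟨2, by simp⟩, ?_⟩
      change (2 : ℤ) • (Submodule.Quotient.mk x : Additive E ⧸ LinearMap.range f) = 0
      rw [← Submodule.Quotient.mk_smul, Submodule.Quotient.mk_eq_zero]
      obtain ⟨m, hm⟩ := hν x.toMul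
      refine ⟨Additive.ofMul m, Additive.toMul.injective ?_⟩
      rw [toMul_zsmul]
      exact_mod_cast hm
  have h4 := LinearEquiv.finrank_eq f.quotKerEquivRange
  have h5 : Module.finrank ℤ (LinearMap.ker f) = Module.finrank ℤ (Additive ν.ker) := by
    refine LinearEquiv.finrank_eq (AddEquiv.toIntLinearEquiv ?_)
    exact
      { toFun := fun x => Additive.ofMul ⟨x.1.toMul, x.2⟩
        invFun := fun x => ⟨Additive.ofMul x.toMul.1, x.toMul.2⟩
        left_inv := fun x => rfl
        right_inv := fun x => rfl
        map_add' := fun x y => rfl }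
  omega

theorem relIndex_range_div_ker {M E : Type*} [CommGroup M] [CommGroup E]
    [Module.Finite ℤ (Additive M)] [Module.Finite ℤ (Additive E)]
    (i : E →* M) (hi : Function.Injective i) (ν : M →* E) (τ : M →* M)
    (hν : ∀ u, i (ν u) = u * τ u) (hτi : ∀ e, τ (i e) = i e)
    (hfix : ∀ u, τ u = u → ∃ e, i e = u) (ε : E) (hε : ε ^ 2 = 1) (hε1 : ν (i ε) = 1)
    (htors : ∀ u : M, IsOfFinOrder u → u = 1 ∨ u = i ε) (hns : ∀ u : M, u ^ 2 ≠ i ε)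
    (hrank : Module.finrank ℤ (Additive M) = 2 * Module.finrank ℤ (Additive E) + 1) :
    (MonoidHom.id M / τ).range.relIndex ν.ker = 2 * ν.range.index ∧ ν.range.index ≠ 0 := by
  have hνi : ∀ e, ν (i e) = e ^ 2 := fun e => hi (by rw [hν, hτi, map_pow, pow_two])
  have hττ : ∀ u, τ (τ u) = u := by
    intro u
    have h1 := hτi (ν u)
    rw [hν, map_mul, mul_comm] at h1
    exact mul_right_cancel h1
  have hker : ∀ u, u ∈ ν.ker ↔ τ u = u⁻¹ := by
    intro u
    rw [MonoidHom.mem_ker, ← hi.eq_iff, hν, map_one, mul_eq_one_iff_eq_inv']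
  have hδ : ∀ u, (MonoidHom.id M / τ) u = u / τ u := fun u => rfl
  let sqE : Subgroup E := (powMonoidHom 2 : E →* E).range
  let sqN : Subgroup M := ((powMonoidHom 2 : ν.ker →* ν.ker).range).map ν.ker.subtype
  have hsqE : sqE ≤ ν.range := by
    rintro _ ⟨e, rfl⟩
    exact ⟨i e, hνi e⟩
  have hsqN : sqN ≤ (MonoidHom.id M / τ).range := by
    rintro _ ⟨_, ⟨⟨n, hn⟩, rfl⟩, rfl⟩
    refine ⟨n, ?_⟩
    rw [hδ, (hker n).1 hn]
    simp [pow_two]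
  have hD : (MonoidHom.id M / τ).range ≤ ν.ker := by
    rintro _ ⟨n, rfl⟩
    rw [hker, hδ, map_div, hττ, inv_div]
  have hcomap1 : sqE.comap ν = i.range ⊔ ν.ker := by
    apply le_antisymm
    · rintro u ⟨e, he⟩
      rw [powMonoidHom_apply] at he
      have : u = i e * (u / i e) := by simp
      rw [this]
      refine Subgroup.mul_mem_sup ⟨e, rfl⟩ ?_
      rw [MonoidHom.mem_ker, map_div, hνi, he, div_self']
    · refine sup_le ?_ ?_
      · rintro _ ⟨e, rfl⟩
        exact ⟨e, (hνi e).symm⟩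
      · intro u hu
        exact ⟨1, by rw [MonoidHom.mem_ker.1 hu]; simp⟩
  have hcomap2 : sqN.comap (MonoidHom.id M / τ) = i.range ⊔ ν.ker := by
    apply le_antisymm
    · intro u hu
      rw [Subgroup.mem_comap, hδ] at hu
      obtain ⟨_, ⟨⟨n, hn⟩, rfl⟩, hu⟩ := hu
      change n ^ 2 = u / τ u at hu
      have h1 : τ (u / n) = u / n := by
        rw [map_div, (hker n).1 hn, div_inv_eq_mul, eq_div_iff_mul_eq', ]
        rw [eq_div_iff_mul_eq'] at hu
        conv_rhs => rw [← hu, pow_two]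
        ac_rfl
      obtain ⟨e, he⟩ := hfix _ h1
      have : u = i e * n := by rw [he]; simp
      rw [this]
      exact Subgroup.mul_mem_sup ⟨e, rfl⟩ hn
    · refine sup_le ?_ ?_
      · rintro _ ⟨e, rfl⟩
        rw [Subgroup.mem_comap, hδ, hτi, div_self']
        exact one_mem _
      · intro u hu
        rw [Subgroup.mem_comap, hδ, (hker u).1 hu]
        exact ⟨⟨u, hu⟩ ^ 2, ⟨⟨u, hu⟩, rfl⟩, by simp [pow_two]⟩
  have hiε : ∀ e, e = 1 ∨ e = ε ↔ i e = 1 ∨ i e = i ε := by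
    intro e
    rw [hi.eq_iff, ← map_one i, hi.eq_iff]
  have hE : sqE.index = 2 ^ (Module.finrank ℤ (Additive E) + 1) := by
    refine index_range_powMonoidHom_two ε hε ?_ ?_
    · intro e he
      rw [hiε]
      exact htors _ (i.isOfFinOrder he)
    · intro e he
      exact hns (i e) (by rw [← map_pow, he])
  have : Module.Finite ℤ (Additive ν.ker) := by
    have : Module.Finite ℤ (LinearMap.ker (MonoidHom.toAdditive ν).toIntLinearMap) := inferInstance
    refine Module.Finite.equiv (AddEquiv.toIntLinearEquiv (?_ :
      LinearMap.ker (MonoidHom.toAdditive ν).toIntLinearMap ≃+ Additive ν.ker))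
    exact
      { toFun := fun x => Additive.ofMul ⟨x.1.toMul, x.2⟩
        invFun := fun x => ⟨Additive.ofMul x.toMul.1, x.toMul.2⟩
        left_inv := fun x => rfl
        right_inv := fun x => rfl
        map_add' := fun x y => rfl }
  have hr := finrank_ker_add_finrank ν fun e => hsqE ⟨e, rfl⟩
  have hN : sqN.relIndex ν.ker = 2 ^ (Module.finrank ℤ (Additive E) + 2) := by
    have h1 : sqN.relIndex ν.ker = (powMonoidHom 2 : ν.ker →* ν.ker).range.index := by
      rw [Subgroup.relIndex, Subgroup.subgroupOf,
        Subgroup.comap_map_eq_self_of_injective ν.ker.subtype_injective]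
    rw [h1, index_range_powMonoidHom_two (⟨i ε, hε1⟩ : ν.ker) ?_ ?_ ?_]
    · congr 1
      omega
    · ext
      simp [← map_pow, hε]
    · intro u hu
      rcases htors u (ν.ker.subtype.isOfFinOrder hu) with h | h
      · left; ext; exact h
      · right; ext; exact h
    · intro u hu
      exact hns u (congrArg Subtype.val hu)
  have h1 := Subgroup.relIndex_mul_index hsqE
  have h2 := Subgroup.relIndex_mul_relIndex _ _ _ hsqN hD
  rw [← Subgroup.index_comap, hcomap1, hE] at h1
  rw [← Subgroup.index_comap, hcomap2, hN] at h2
  have hpos : (i.range ⊔ ν.ker).index ≠ 0 := by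
    intro h
    rw [h, zero_mul] at h1
    exact (pow_ne_zero _ two_ne_zero) h1.symm
  refine ⟨?_, ?_⟩
  · apply Nat.eq_of_mul_eq_mul_left (Nat.pos_of_ne_zero hpos)
    rw [h2, mul_left_comm, h1]
    ring
  · intro h
    rw [h, mul_zero] at h1
    exact (pow_ne_zero _ two_ne_zero) h1.symm

end AbstractHerbrand

namespace IsSqrtExt

variable {K L : Type*} [Field K] [Field L] [NumberField K] [NumberField L] [Algebra K L]
  {a : K} {s : L}

/-- The conjugation on the ring of integers. -/
noncomputable def tau (h : IsSqrtExt K L a s) : 𝓞 L ≃ₐ[𝓞 K] 𝓞 L :=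
  RingOfIntegers.mapAlgEquiv h.conj

theorem coe_tau (h : IsSqrtExt K L a s) (x : 𝓞 L) : (h.tau x : L) = h.conj x := rfl

theorem tau_tau (h : IsSqrtExt K L a s) (x : 𝓞 L) : h.tau (h.tau x) = x := by
  ext
  rw [coe_tau, coe_tau, conj_conj]

theorem algebraMap_ringOfIntegersNorm (h : IsSqrtExt K L a s) (x : 𝓞 L) :
    algebraMap (𝓞 K) (𝓞 L) (RingOfIntegers.norm K x) = x * h.tau x := by
  have := h.isGalois
  ext
  rw [RingOfIntegers.coe_algebraMap_norm, h.algebraMap_norm]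
  rfl

/-- The conjugation on units. -/
noncomputable def tauUnits (h : IsSqrtExt K L a s) : (𝓞 L)ˣ →* (𝓞 L)ˣ :=
  Units.map (h.tau : 𝓞 L →* 𝓞 L)

theorem coe_tauUnits (h : IsSqrtExt K L a s) (u : (𝓞 L)ˣ) : (h.tauUnits u : 𝓞 L) = h.tau u := rfl

variable (K L) in
/-- The inclusion of unit groups. -/
noncomputable def inclUnits : (𝓞 K)ˣ →* (𝓞 L)ˣ :=
  Units.map (algebraMap (𝓞 K) (𝓞 L) : 𝓞 K →* 𝓞 L)

theorem coe_inclUnits (u : (𝓞 K)ˣ) : (inclUnits K L u : 𝓞 L) = algebraMap (𝓞 K) (𝓞 L) u := rfl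

variable (K L) in
/-- The norm on unit groups. -/
noncomputable def normUnits : (𝓞 L)ˣ →* (𝓞 K)ˣ :=
  Units.map (RingOfIntegers.norm K : 𝓞 L →* 𝓞 K)

theorem inclUnits_normUnits (h : IsSqrtExt K L a s) (u : (𝓞 L)ˣ) :
    inclUnits K L (normUnits K L u) = u * h.tauUnits u :=
  Units.ext (h.algebraMap_ringOfIntegersNorm u)

theorem inclUnits_injective : Function.Injective (inclUnits K L) := by
  intro u v huv
  apply Units.ext
  apply RingOfIntegers.ext
  apply (algebraMap K L).injective
  exact congrArg (fun w : (𝓞 L)ˣ => ((w : 𝓞 L) : L)) huv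

theorem exists_algebraMap_eq_of_tau_eq (h : IsSqrtExt K L a s) {x : 𝓞 L} (hx : h.tau x = x) :
    ∃ y : 𝓞 K, algebraMap (𝓞 K) (𝓞 L) y = x := by
  obtain ⟨y, hy⟩ := h.exists_of_conj_eq (congrArg (fun z : 𝓞 L => (z : L)) hx)
  have hs_int : IsIntegral ℤ y := by
    rw [← isIntegral_algebraMap_iff (algebraMap K L).injective, hy]
    exact x.2
  exact ⟨⟨y, hs_int⟩, RingOfIntegers.ext hy⟩

theorem exists_inclUnits_eq_of_tauUnits_eq (h : IsSqrtExt K L a s) {u : (𝓞 L)ˣ}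
    (hu : h.tauUnits u = u) : ∃ v : (𝓞 K)ˣ, inclUnits K L v = u := by
  obtain ⟨y, hy⟩ := h.exists_algebraMap_eq_of_tau_eq (congrArg Units.val hu)
  obtain ⟨z, hz⟩ := h.exists_algebraMap_eq_of_tau_eq (x := (u⁻¹ : (𝓞 L)ˣ))
    (congrArg Units.val ((map_inv h.tauUnits u).trans (congrArg _ hu)))
  have hinj : Function.Injective (algebraMap (𝓞 K) (𝓞 L)) := RingOfIntegers.algebraMap.injective K L
  refine ⟨⟨y, z, hinj ?_, hinj ?_⟩, Units.ext hy⟩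
  · rw [map_mul, hy, hz, map_one, Units.mul_inv]
  · rw [map_mul, hy, hz, map_one, Units.inv_mul]

theorem exists_real_embedding (L : Type*) [Field L] [NumberField L] [IsTotallyReal L] :
    Nonempty (L →+* ℝ) := by
  obtain ⟨w⟩ : Nonempty (InfinitePlace L) := inferInstance
  exact ⟨InfinitePlace.embedding_of_isReal (IsTotallyReal.isReal w)⟩

theorem units_eq_one_or_eq_neg_one [IsTotallyReal L] {u : (𝓞 L)ˣ} (hu : IsOfFinOrder u) :
    u = 1 ∨ u = -1 := by
  obtain ⟨φ⟩ := exists_real_embedding L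
  obtain ⟨n, hn, hu⟩ := isOfFinOrder_iff_pow_eq_one.1 hu
  have h1 : (φ (u : 𝓞 L)) ^ n = 1 := by
    rw [← map_pow]
    have : ((u : 𝓞 L) : L) ^ n = 1 := by
      have := congrArg (fun w : (𝓞 L)ˣ => ((w : 𝓞 L) : L)) hu
      simpa using this
    rw [this, map_one]
  have h2 : |φ (u : 𝓞 L)| = 1 := by
    have : |φ (u : 𝓞 L)| ^ n = 1 := by rw [← abs_pow, h1, abs_one]
    exact (pow_eq_one_iff_of_nonneg (abs_nonneg _) hn.ne').1 this
  rcases eq_or_eq_neg_of_abs_eq h2 with h3 | h3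
  · left
    apply Units.ext
    apply RingOfIntegers.ext
    exact φ.injective (by simpa using h3)
  · right
    apply Units.ext
    apply RingOfIntegers.ext
    exact φ.injective (by simpa using h3)

theorem units_sq_ne_neg_one [IsTotallyReal L] (u : (𝓞 L)ˣ) : u ^ 2 ≠ -1 := by
  obtain ⟨φ⟩ := exists_real_embedding L
  intro hu
  have h1 := congrArg (fun w : (𝓞 L)ˣ => φ ((w : 𝓞 L) : L)) hu
  simp only [Units.val_pow_eq_pow_val, map_pow, Units.val_neg, Units.val_one, map_neg, map_one]
    at h1
  nlinarith [sq_nonneg (φ (u : 𝓞 L))]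

theorem finrank_units [IsTotallyReal K] :
    Module.finrank ℤ (Additive (𝓞 K)ˣ) + 1 = Module.finrank ℚ K := by
  rw [NumberField.Units.finrank_eq, NumberField.Units.rank, ← InfinitePlace.card_add_two_mul_card_eq_rank,
    InfinitePlace.card_eq_nrRealPlaces_add_nrComplexPlaces,
    IsTotallyReal.nrComplexPlaces_eq_zero]
  have : 0 < Module.finrank ℚ K := Module.finrank_pos
  rw [← InfinitePlace.card_add_two_mul_card_eq_rank,
    IsTotallyReal.nrComplexPlaces_eq_zero] at this
  omega

theorem relIndex_units [IsTotallyReal K] [IsTotallyReal L] (h : IsSqrtExt K L a s) :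
    (MonoidHom.id _ / h.tauUnits).range.relIndex (normUnits K L).ker =
      2 * (normUnits K L).range.index ∧ (normUnits K L).range.index ≠ 0 := by
  have h1 : inclUnits K L (-1) = -1 := by
    apply Units.ext
    rw [coe_inclUnits]
    simp
  refine relIndex_range_div_ker (inclUnits K L) inclUnits_injective (normUnits K L) h.tauUnits
    h.inclUnits_normUnits ?_ (fun u => h.exists_inclUnits_eq_of_tauUnits_eq) (-1) (by simp) ?_
    ?_ ?_ ?_
  · intro u
    apply Units.ext
    rw [coe_tauUnits, coe_inclUnits, AlgEquiv.commutes]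
  · apply inclUnits_injective (L := L)
    rw [h.inclUnits_normUnits, h1, map_one]
    apply Units.ext
    rw [Units.val_mul, coe_tauUnits]
    simp
  · intro u hu
    rw [h1]
    exact units_eq_one_or_eq_neg_one hu
  · intro u
    rw [h1]
    exact units_sq_ne_neg_one u
  · have hK := finrank_units (K := K)
    have hL := finrank_units (K := L)
    have := Module.finrank_mul_finrank ℚ K L
    rw [h.finrank_eq_two] at this
    omega

end IsSqrtExt

namespace IsSqrtExt

variable {K L : Type*} [Field K] [Field L] [NumberField K] [NumberField L] [Algebra K L]
  {a : K} {s : L}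

theorem finrank_ringOfIntegers (h : IsSqrtExt K L a s) : Module.finrank (𝓞 K) (𝓞 L) = 2 := by
  rw [← h.finrank_eq_two]
  exact (IsFractionRing.finrank_eq (𝓞 K) K (𝓞 L) L).symm

theorem mem_map_tau (h : IsSqrtExt K L a s) {I : Ideal (𝓞 L)} {x : 𝓞 L} :
    x ∈ I.map h.tau ↔ h.tau x ∈ I := by
  rw [Ideal.mem_map_of_equiv]
  constructor
  · rintro ⟨y, hy, rfl⟩
    rwa [h.tau_tau]
  · intro hx
    exact ⟨_, hx, h.tau_tau x⟩

theorem map_tau_map_tau (h : IsSqrtExt K L a s) (I : Ideal (𝓞 L)) :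
    (I.map h.tau).map h.tau = I := by
  ext x
  rw [h.mem_map_tau, h.mem_map_tau, h.tau_tau]

theorem map_tau_mul (h : IsSqrtExt K L a s) (I J : Ideal (𝓞 L)) :
    (I * J).map h.tau = I.map h.tau * J.map h.tau :=
  Ideal.map_mul h.tau I J

theorem map_tau_span_singleton (h : IsSqrtExt K L a s) (x : 𝓞 L) :
    (Ideal.span {x}).map h.tau = Ideal.span {h.tau x} := by
  rw [Ideal.map_span, Set.image_singleton]

theorem map_tau_eq_bot_iff (h : IsSqrtExt K L a s) {I : Ideal (𝓞 L)} :
    I.map h.tau = ⊥ ↔ I = ⊥ :=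
  Ideal.map_eq_bot_iff_of_injective h.tau.injective

theorem map_algebraMap_eq_bot_iff {J : Ideal (𝓞 K)} :
    J.map (algebraMap (𝓞 K) (𝓞 L)) = ⊥ ↔ J = ⊥ :=
  Ideal.map_eq_bot_iff_of_injective (RingOfIntegers.algebraMap.injective K L)

theorem eq_top_of_relNorm_eq_one {C : Ideal (𝓞 L)} (hC : Ideal.relNorm (𝓞 K) C = 1) : C = ⊤ := by
  have := Ideal.relNorm_le_comap (𝓞 K) C
  rw [hC, Ideal.one_eq_top, top_le_iff, Ideal.comap_eq_top_iff] at this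
  exact this

/-- If a product of two primes over `p` with the same norm divides `p`, it is equal to `p`. -/
theorem mul_eq_of_mul_dvd (h : IsSqrtExt K L a s) {P Q : Ideal (𝓞 L)} (hP : P.IsPrime)
    (hP0 : P ≠ ⊥) (hQ : Ideal.relNorm (𝓞 K) Q = Ideal.relNorm (𝓞 K) P)
    (hdvd : P * Q ∣ (P.under (𝓞 K)).map (algebraMap (𝓞 K) (𝓞 L))) :
    P * Q = (P.under (𝓞 K)).map (algebraMap (𝓞 K) (𝓞 L)) ∧
      Ideal.relNorm (𝓞 K) P = P.under (𝓞 K) := by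
  set p := P.under (𝓞 K) with hp
  have hpp : p.IsPrime := inferInstance
  have hp0 : p ≠ 0 := Ideal.under_ne_bot _ hP0
  obtain ⟨m, hm⟩ := Ideal.exists_relNorm_eq_pow_of_isPrime P p
  have hm0 : m ≠ 0 := by
    rintro rfl
    rw [pow_zero] at hm
    exact hP.ne_top (eq_top_of_relNorm_eq_one hm)
  obtain ⟨C, hC⟩ := hdvd
  have h1 := Ideal.relNorm_algebraMap (𝓞 L) p
  rw [h.finrank_ringOfIntegers, hC, map_mul, map_mul, hQ, hm] at h1
  obtain ⟨l, rfl⟩ := Nat.exists_eq_succ_of_ne_zero hm0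
  have h2 : p ^ 2 * ((p ^ l) * (p ^ l) * Ideal.relNorm (𝓞 K) C) = p ^ 2 * 1 := by
    rw [mul_one]
    conv_rhs => rw [← h1]
    rw [Nat.succ_eq_add_one]
    ring
  have h3 := mul_left_cancel₀ (pow_ne_zero 2 hp0) h2
  have h4 : IsUnit (p ^ l * p ^ l * Ideal.relNorm (𝓞 K) C) := h3 ▸ isUnit_one
  rw [IsUnit.mul_iff, IsUnit.mul_iff] at h4
  have h5 := eq_top_of_relNorm_eq_one (K := K) (L := L) (C := C)
    ((Ideal.isUnit_iff.1 h4.2).trans Ideal.one_eq_top.symm)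
  refine ⟨by rw [hC, h5, Ideal.mul_top], ?_⟩
  rw [hm]
  have : l = 0 := by
    by_contra hl
    rw [isUnit_pow_iff hl] at h4
    exact hpp.ne_top (Ideal.isUnit_iff.1 h4.1.1)
  rw [this, Nat.succ_eq_add_one, zero_add, pow_one]

/-- The Galois group permutes the primes over a prime transitively. -/
theorem eq_or_eq_map_tau_of_under_le (h : IsSqrtExt K L a s) {P Q : Ideal (𝓞 L)} (hP : P.IsPrime)
    (hP0 : P ≠ ⊥) (hQ : Q.IsPrime) (hle : P.under (𝓞 K) ≤ Q.under (𝓞 K)) :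
    Q = P ∨ Q = P.map h.tau := by
  have hPm := hP.isMaximal hP0
  have key : (P : Set (𝓞 L)) ⊆ Q ∪ Q.map h.tau := by
    intro x hx
    have h1 : x * h.tau x ∈ Q := by
      rw [← h.algebraMap_ringOfIntegersNorm]
      apply hle
      rw [Ideal.under, Ideal.mem_comap, h.algebraMap_ringOfIntegersNorm]
      exact Ideal.mul_mem_right _ _ hx
    rcases hQ.mem_or_mem h1 with h2 | h2
    · exact Or.inl h2
    · exact Or.inr (h.mem_map_tau.2 h2)
  rcases Ideal.subset_union.1 key with h1 | h1
  · left
    exact (hPm.eq_of_le hQ.ne_top h1).symm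
  · right
    have : (Q.map h.tau).IsPrime := Ideal.map_isPrime_of_equiv h.tau
    rw [hPm.eq_of_le this.ne_top h1, h.map_tau_map_tau]

theorem map_under_le {P : Ideal (𝓞 L)} :
    (P.under (𝓞 K)).map (algebraMap (𝓞 K) (𝓞 L)) ≤ P :=
  Ideal.map_comap_le

theorem map_tau_under (h : IsSqrtExt K L a s) (P : Ideal (𝓞 L)) :
    (P.map h.tau).under (𝓞 K) = P.under (𝓞 K) := by
  ext x
  rw [Ideal.under, Ideal.under, Ideal.mem_comap, Ideal.mem_comap, h.mem_map_tau, h.tau.commutes]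

theorem mul_map_tau_of_ne (h : IsSqrtExt K L a s) {P : Ideal (𝓞 L)} (hP : P.IsPrime)
    (hP0 : P ≠ ⊥) (hne : P.map h.tau ≠ P) :
    P * P.map h.tau = (P.under (𝓞 K)).map (algebraMap (𝓞 K) (𝓞 L)) := by
  have hPm := hP.isMaximal hP0
  have hQ : (P.map h.tau).IsPrime := Ideal.map_isPrime_of_equiv h.tau
  have hQm := hQ.isMaximal (h.map_tau_eq_bot_iff.not.2 hP0)
  refine (h.mul_eq_of_mul_dvd hP hP0 (Ideal.relNorm_map_algEquiv h.tau P) ?_).1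
  apply (Ideal.isCoprime_of_isMaximal hne.symm).mul_dvd
  · exact Ideal.dvd_iff_le.2 map_under_le
  · rw [← h.map_tau_under]
    exact Ideal.dvd_iff_le.2 map_under_le

theorem sq_eq_of_map_tau_eq (h : IsSqrtExt K L a s) {P : Ideal (𝓞 L)} (hP : P.IsPrime)
    (hP0 : P ≠ ⊥) (heq : P.map h.tau = P)
    (hne : P ≠ (P.under (𝓞 K)).map (algebraMap (𝓞 K) (𝓞 L))) :
    P * P = (P.under (𝓞 K)).map (algebraMap (𝓞 K) (𝓞 L)) ∧
      Ideal.relNorm (𝓞 K) P = P.under (𝓞 K) := by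
  refine h.mul_eq_of_mul_dvd hP hP0 rfl ?_
  obtain ⟨C, hC⟩ := Ideal.dvd_iff_le.2 (map_under_le (K := K) (P := P))
  rw [hC]
  apply mul_dvd_mul_left
  have hC1 : C ≠ ⊤ := by
    rintro rfl
    exact hne (by rw [hC, Ideal.mul_top])
  obtain ⟨Q, hQ, hCQ⟩ := Ideal.exists_le_maximal C hC1
  have hle : P.under (𝓞 K) ≤ Q.under (𝓞 K) := by
    rw [Ideal.under, Ideal.under, ← Ideal.map_le_iff_le_comap]
    change Ideal.map (algebraMap (𝓞 K) (𝓞 L)) (P.under (𝓞 K)) ≤ Q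
    rw [hC]
    exact Ideal.mul_le_right.trans hCQ
  rw [Ideal.dvd_iff_le]
  rcases h.eq_or_eq_map_tau_of_under_le hP hP0 hQ.isPrime hle with h1 | h1
  · exact h1 ▸ hCQ
  · rw [heq] at h1
    exact h1 ▸ hCQ

/-- If `P` is an ambiguous prime which is not extended from `K`, then conjugation acts trivially on
the residue field. -/
theorem sub_tau_mem (h : IsSqrtExt K L a s) {P : Ideal (𝓞 L)} (hP : P.IsPrime)
    (hP0 : P ≠ ⊥) (heq : P.map h.tau = P)
    (hne : P ≠ (P.under (𝓞 K)).map (algebraMap (𝓞 K) (𝓞 L))) (x : 𝓞 L) :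
    (∃ y : 𝓞 K, x - algebraMap (𝓞 K) (𝓞 L) y ∈ P) ∧ x - h.tau x ∈ P := by
  have hN := (h.sq_eq_of_map_tau_eq hP hP0 heq hne).2
  have hcard := Ideal.absNorm_relNorm (𝓞 K) (𝓞 L) P
  rw [hN, Ideal.absNorm_apply, Ideal.absNorm_apply, Submodule.cardQuot_apply,
    Submodule.cardQuot_apply] at hcard
  let f : 𝓞 K ⧸ P.under (𝓞 K) →+* 𝓞 L ⧸ P :=
    Ideal.quotientMap P (algebraMap (𝓞 K) (𝓞 L)) le_rfl
  have hf : Function.Injective f := Ideal.quotientMap_injective' le_rfl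
  have : Finite (𝓞 L ⧸ P) := Ideal.finiteQuotientOfFreeOfNeBot P hP0
  have hfb : Function.Bijective f :=
    (Nat.bijective_iff_injective_and_card f).2 ⟨hf, hcard⟩
  obtain ⟨y', hy'⟩ := hfb.2 (Ideal.Quotient.mk P x)
  obtain ⟨y, rfl⟩ := Ideal.Quotient.mk_surjective y'
  have h1 : x - algebraMap (𝓞 K) (𝓞 L) y ∈ P := by
    rw [← Ideal.Quotient.eq, ← hy']
    rfl
  refine ⟨⟨y, h1⟩, ?_⟩
  have h2 : h.tau (x - algebraMap (𝓞 K) (𝓞 L) y) ∈ P := by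
    rwa [← h.mem_map_tau, heq]
  rw [map_sub, AlgEquiv.commutes] at h2
  have := P.sub_mem h1 h2
  rwa [sub_sub_sub_cancel_right] at this

/-- The ideal `A * τ A` is extended from `K`. -/
theorem exists_map_eq_mul_map_tau (h : IsSqrtExt K L a s) (A : Ideal (𝓞 L)) :
    ∃ J : Ideal (𝓞 K), J.map (algebraMap (𝓞 K) (𝓞 L)) = A * A.map h.tau := by
  induction A using UniqueFactorizationMonoid.induction_on_prime with
  | h₁ => exact ⟨⊥, by simp⟩
  | h₂ I hI =>
    rw [Ideal.isUnit_iff] at hI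
    subst hI
    refine ⟨⊤, ?_⟩
    rw [Ideal.map_top, Ideal.map_top, Ideal.mul_top]
  | h₃ A P hA hP ih =>
    obtain ⟨J, hJ⟩ := ih
    have hPp := Ideal.isPrime_of_prime hP
    have : ∃ J' : Ideal (𝓞 K), J'.map (algebraMap (𝓞 K) (𝓞 L)) = P * P.map h.tau := by
      by_cases h1 : P.map h.tau = P
      · by_cases h2 : P = (P.under (𝓞 K)).map (algebraMap (𝓞 K) (𝓞 L))
        · refine ⟨P.under (𝓞 K) * P.under (𝓞 K), ?_⟩
          rw [Ideal.map_mul, h1, ← h2]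
        · exact ⟨_, by rw [h1, (h.sq_eq_of_map_tau_eq hPp hP.ne_zero h1 h2).1]⟩
      · exact ⟨_, (h.mul_map_tau_of_ne hPp hP.ne_zero h1).symm⟩
    obtain ⟨J', hJ'⟩ := this
    refine ⟨J' * J, ?_⟩
    rw [Ideal.map_mul, hJ, hJ', h.map_tau_mul]
    ac_rfl

/-- Ambiguous ideals are, up to ideals extended from `K`, in a family `R` which is stable under
multiplication by ramified primes. -/
theorem exists_eq_map_mul_of_map_tau_eq (h : IsSqrtExt K L a s) {ι : Type*}
    (R : ι → Ideal (𝓞 L)) (hR0 : ∃ i, R i = ⊤)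
    (hR : ∀ P : Ideal (𝓞 L), P.IsPrime → P ≠ ⊥ → P.map h.tau = P → (∀ x, x - h.tau x ∈ P) →
      ∀ i, ∃ j, ∃ J : Ideal (𝓞 K), P * R i = J.map (algebraMap (𝓞 K) (𝓞 L)) * R j)
    (A : Ideal (𝓞 L)) (hA : A ≠ ⊥) (hτ : A.map h.tau = A) :
    ∃ i, ∃ J : Ideal (𝓞 K), A = J.map (algebraMap (𝓞 K) (𝓞 L)) * R i := by
  induction hn : Ideal.absNorm A using Nat.strong_induction_on generalizing A with
  | _ n ih =>
  by_cases hAt : A = ⊤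
  · obtain ⟨i, hi⟩ := hR0
    exact ⟨i, ⊤, by rw [hAt, hi, Ideal.map_top, Ideal.mul_top]⟩
  obtain ⟨P, hPm, hAP⟩ := Ideal.exists_le_maximal A hAt
  have hPp := hPm.isPrime
  have hP0 : P ≠ ⊥ := by
    rintro rfl
    exact hA (le_bot_iff.1 hAP)
  have hsmall : ∀ C B : Ideal (𝓞 L), A = C * B → C ≤ P → B ≠ ⊥ ∧ Ideal.absNorm B < n := by
    intro C B hCB hCP
    have hB0 : B ≠ ⊥ := by
      rintro rfl
      exact hA (by rw [hCB, Ideal.mul_bot])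
    have hC0 : C ≠ ⊥ := by
      rintro rfl
      exact hA (by rw [hCB, Ideal.bot_mul])
    refine ⟨hB0, ?_⟩
    rw [← hn, hCB, map_mul]
    have hB1 : Ideal.absNorm B ≠ 0 := Ideal.absNorm_eq_zero_iff.not.2 hB0
    have hC1 : Ideal.absNorm C ≠ 0 := Ideal.absNorm_eq_zero_iff.not.2 hC0
    have hC2 : Ideal.absNorm C ≠ 1 := by
      rw [Ne, Ideal.absNorm_eq_one_iff]
      rintro rfl
      exact hPp.ne_top (top_le_iff.1 hCP)
    have : 2 ≤ Ideal.absNorm C := by omega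
    nlinarith [Nat.pos_of_ne_zero hB1]
  by_cases h1 : P.map h.tau = P
  · obtain ⟨B, hB⟩ := Ideal.dvd_iff_le.2 hAP
    obtain ⟨hB0, hBn⟩ := hsmall P B hB le_rfl
    have hτB : B.map h.tau = B := by
      rw [hB, h.map_tau_mul, h1] at hτ
      exact mul_left_cancel₀ hP0 hτ
    obtain ⟨i, J, hi⟩ := ih _ hBn B hB0 hτB rfl
    by_cases h2 : P = (P.under (𝓞 K)).map (algebraMap (𝓞 K) (𝓞 L))
    · refine ⟨i, P.under (𝓞 K) * J, ?_⟩
      rw [Ideal.map_mul, mul_assoc, ← hi, ← h2, hB]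
    · obtain ⟨j, J', hj⟩ := hR P hPp hP0 h1 (fun x => (h.sub_tau_mem hPp hP0 h1 h2 x).2) i
      refine ⟨j, J * J', ?_⟩
      rw [hB, hi, Ideal.map_mul, mul_assoc, ← hj]
      ac_rfl
  · have hQ : (P.map h.tau).IsPrime := Ideal.map_isPrime_of_equiv h.tau
    have hQm := hQ.isMaximal (h.map_tau_eq_bot_iff.not.2 hP0)
    have hdvd : P * P.map h.tau ∣ A := by
      apply (Ideal.isCoprime_of_isMaximal (Ne.symm h1)).mul_dvd
      · exact Ideal.dvd_iff_le.2 hAP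
      · rw [Ideal.dvd_iff_le, ← hτ]
        exact Ideal.map_mono hAP
    obtain ⟨B, hB⟩ := hdvd
    obtain ⟨hB0, hBn⟩ := hsmall _ B hB Ideal.mul_le_left
    have hC0 : P * P.map h.tau ≠ 0 := mul_ne_zero hP0 (h.map_tau_eq_bot_iff.not.2 hP0)
    have hτB : B.map h.tau = B := by
      rw [hB, h.map_tau_mul, h.map_tau_mul, h.map_tau_map_tau, mul_comm (P.map h.tau)] at hτ
      exact mul_left_cancel₀ hC0 hτ
    obtain ⟨i, J, hi⟩ := ih _ hBn B hB0 hτB rfl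
    refine ⟨i, P.under (𝓞 K) * J, ?_⟩
    rw [Ideal.map_mul, mul_assoc, ← hi, ← h.mul_map_tau_of_ne hPp hP0 h1, hB]

end IsSqrtExt

section ClassGroupLemmas

variable {R : Type*} [CommRing R] [IsDedekindDomain R]

theorem exists_span_singleton_eq_pow_card (I : Ideal R) [Finite (ClassGroup R)] (hI : I ≠ ⊥) :
    ∃ c : R, c ≠ 0 ∧ Ideal.span {c} = I ^ Nat.card (ClassGroup R) := by
  have hI' : I ∈ nonZeroDivisors (Ideal R) := mem_nonZeroDivisors_of_ne_zero hI
  have h1 := pow_card_eq_one' (x := ClassGroup.mk0 ⟨I, hI'⟩)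
  rw [← map_pow] at h1
  have h2 : (I ^ Nat.card (ClassGroup R)).IsPrincipal :=
    (ClassGroup.mk0_eq_one_iff (pow_mem hI' (Nat.card (ClassGroup R)))).1 h1
  obtain ⟨c, hc⟩ := h2
  refine ⟨c, ?_, hc.symm⟩
  rintro rfl
  apply pow_ne_zero (Nat.card (ClassGroup R)) hI
  rw [hc]
  simp

theorem exists_span_singleton_eq_of_mul {I : Ideal R} {x y : R} (hy : y ≠ 0)
    (h : I * Ideal.span {y} = Ideal.span {x}) : ∃ z, Ideal.span {z} = I := by
  have h1 : x ∈ Ideal.span {y} := by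
    have : x ∈ I * Ideal.span {y} := h ▸ Ideal.mem_span_singleton_self x
    exact (Ideal.mul_le_right : I * Ideal.span {y} ≤ Ideal.span {y}) this
  obtain ⟨z, rfl⟩ := Ideal.mem_span_singleton.1 h1
  refine ⟨z, ?_⟩
  have hy' : Ideal.span {y} ≠ 0 := by simpa using hy
  apply mul_right_cancel₀ hy'
  rw [h, mul_comm, Ideal.span_singleton_mul_span_singleton]

/-- The class number is odd as soon as an ideal with principal square has a principal odd power. -/
theorem odd_card_classGroup [Finite (ClassGroup R)] (m : ℕ) (hm : Odd m)
    (h : ∀ (I : Ideal R) (b : R), I ≠ ⊥ → I ^ 2 = Ideal.span {b} → ∃ c, I ^ m = Ideal.span {c}) :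
    Odd (Nat.card (ClassGroup R)) := by
  rw [← Nat.not_even_iff_odd]
  intro heven
  have : Fact (Nat.Prime 2) := ⟨Nat.prime_two⟩
  obtain ⟨c, hc⟩ := exists_prime_orderOf_dvd_card' (G := ClassGroup R) 2 heven.two_dvd
  obtain ⟨⟨I, hI'⟩, rfl⟩ := ClassGroup.mk0_surjective c
  have hI : I ≠ ⊥ := nonZeroDivisors.ne_zero hI'
  have h1 := pow_orderOf_eq_one (ClassGroup.mk0 ⟨I, hI'⟩)
  rw [hc, ← map_pow] at h1
  obtain ⟨b, hb⟩ := (ClassGroup.mk0_eq_one_iff (pow_mem hI' 2)).1 h1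
  obtain ⟨c, hc'⟩ := h I b hI hb
  have h2 := (ClassGroup.mk0_eq_one_iff (pow_mem hI' m)).2 ⟨c, hc'⟩
  have h3 : orderOf (ClassGroup.mk0 ⟨I, hI'⟩) ∣ m := by
    apply orderOf_dvd_of_pow_eq_one
    rw [← map_pow]
    exact h2
  rw [hc] at h3
  exact (Nat.not_even_iff_odd.2 hm) (even_iff_two_dvd.2 h3)

end ClassGroupLemmas

namespace IsSqrtExt

variable {K L : Type*} [Field K] [Field L] [NumberField K] [NumberField L] [Algebra K L]
  {a : K} {s : L}

theorem exists_tau_ne (h : IsSqrtExt K L a s) : ∃ x : 𝓞 L, h.tau x ≠ x := by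
  by_contra! hc
  obtain ⟨x, y, hy, hxy⟩ := IsFractionRing.div_surjective (𝓞 L) s
  have h1 : h.conj s = s := by
    have hx : h.conj (algebraMap (𝓞 L) L x) = algebraMap (𝓞 L) L x :=
      congrArg (fun z : 𝓞 L => (z : L)) (hc x)
    have hy : h.conj (algebraMap (𝓞 L) L y) = algebraMap (𝓞 L) L y :=
      congrArg (fun z : 𝓞 L => (z : L)) (hc y)
    have := map_div₀ h.conj (algebraMap (𝓞 L) L x) (algebraMap (𝓞 L) L y)
    rwa [hx, hy, hxy] at this
  rw [h.conj_self, neg_eq_self] at h1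
  exact h.ne_zero h1

/-- Hilbert 90, in integral form. -/
theorem exists_mul_tau_eq (h : IsSqrtExt K L a s) {b c : 𝓞 L} (hc : h.tau c = c)
    (hbc : b * h.tau b = c ^ 2) : ∃ γ : 𝓞 L, γ ≠ 0 ∧ b * h.tau γ = c * γ := by
  by_cases hb : c + b = 0
  · obtain ⟨x, hx⟩ := h.exists_tau_ne
    refine ⟨x - h.tau x, sub_ne_zero.2 hx.symm, ?_⟩
    rw [map_sub, h.tau_tau]
    linear_combination (h.tau x - x) * hb
  · refine ⟨c + b, hb, ?_⟩
    rw [map_add, hc]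
    linear_combination hbc

theorem exists_span_eq_pow {J : Ideal (𝓞 K)}
    (hJ : J.map (algebraMap (𝓞 K) (𝓞 L)) ≠ ⊥) :
    ∃ c : 𝓞 K, c ≠ 0 ∧ Ideal.span {algebraMap (𝓞 K) (𝓞 L) c} =
      J.map (algebraMap (𝓞 K) (𝓞 L)) ^ Nat.card (ClassGroup (𝓞 K)) := by
  obtain ⟨c, hc0, hc⟩ := exists_span_singleton_eq_pow_card J (map_algebraMap_eq_bot_iff.not.1 hJ)
  refine ⟨c, hc0, ?_⟩
  rw [← Ideal.map_pow, ← hc, Ideal.map_span, Set.image_singleton]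

/-- Two units of relative norm `1` belonging to the same ambiguous ideal differ by an element of
the form `w / τ w`. -/
theorem div_mem_range (h : IsSqrtExt K L a s) (hK : Odd (Nat.card (ClassGroup (𝓞 K))))
    {u₁ u₂ : (𝓞 L)ˣ} (hu₁ : u₁ ∈ (normUnits K L).ker) (hu₂ : u₂ ∈ (normUnits K L).ker)
    {β₁ β₂ : 𝓞 L} (hβ₁ : β₁ ≠ 0) (hβ₂ : β₂ ≠ 0)
    (h₁ : β₁ = u₁ * h.tau β₁) (h₂ : β₂ = u₂ * h.tau β₂) {R : Ideal (𝓞 L)} {J₁ J₂ : Ideal (𝓞 K)}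
    (hJ₁ : Ideal.span {β₁} = J₁.map (algebraMap (𝓞 K) (𝓞 L)) * R)
    (hJ₂ : Ideal.span {β₂} = J₂.map (algebraMap (𝓞 K) (𝓞 L)) * R) :
    u₁ / u₂ ∈ (MonoidHom.id _ / h.tauUnits).range := by
  set n := Nat.card (ClassGroup (𝓞 K)) with hn
  have hb₁ : Ideal.span {β₁} ≠ ⊥ := by simpa using hβ₁
  have hb₂ : Ideal.span {β₂} ≠ ⊥ := by simpa using hβ₂
  obtain ⟨c₁, hc₁0, hc₁⟩ := exists_span_eq_pow (L := L) (J := J₁) (by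
    intro hbot; exact hb₁ (by rw [hJ₁, hbot, Ideal.bot_mul]))
  obtain ⟨c₂, hc₂0, hc₂⟩ := exists_span_eq_pow (L := L) (J := J₂) (by
    intro hbot; exact hb₂ (by rw [hJ₂, hbot, Ideal.bot_mul]))
  rw [← hn] at hc₁ hc₂
  have hinj := RingOfIntegers.algebraMap.injective K L
  have key : Ideal.span {β₂ ^ n * algebraMap (𝓞 K) (𝓞 L) c₁} =
      Ideal.span {β₁ ^ n * algebraMap (𝓞 K) (𝓞 L) c₂} := by
    rw [← Ideal.span_singleton_mul_span_singleton, ← Ideal.span_singleton_mul_span_singleton,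
      ← Ideal.span_singleton_pow, ← Ideal.span_singleton_pow, hc₁, hc₂, hJ₁, hJ₂, mul_pow, mul_pow]
    ring
  obtain ⟨w, hw⟩ := Ideal.span_singleton_eq_span_singleton.1 key
  have hτ := congrArg h.tau hw
  simp only [map_mul, map_pow, AlgEquiv.commutes] at hτ
  have hτβ₂ : h.tau β₂ ≠ 0 := by simpa using hβ₂
  have hc₁0' : algebraMap (𝓞 K) (𝓞 L) c₁ ≠ 0 := by
    rw [Ne, ← map_zero (algebraMap (𝓞 K) (𝓞 L)), hinj.eq_iff]; exact hc₁0
  have hpow : u₂ ^ n * w = u₁ ^ n * h.tauUnits w := by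
    apply Units.ext
    simp only [Units.val_mul, Units.val_pow_eq_pow_val, coe_tauUnits]
    have h3 : (h.tau β₂) ^ n * algebraMap (𝓞 K) (𝓞 L) c₁ ≠ 0 :=
      mul_ne_zero (pow_ne_zero _ hτβ₂) hc₁0'
    apply mul_left_cancel₀ h3
    have e₁ : β₁ ^ n = (u₁ : 𝓞 L) ^ n * h.tau β₁ ^ n := by rw [← mul_pow, ← h₁]
    have e₂ : β₂ ^ n = (u₂ : 𝓞 L) ^ n * h.tau β₂ ^ n := by rw [← mul_pow, ← h₂]
    rw [e₁, e₂] at hw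
    linear_combination hw - (u₁ : 𝓞 L) ^ n * hτ
  have hsq : ∀ u ∈ (normUnits K L).ker, u ^ 2 ∈ (MonoidHom.id _ / h.tauUnits).range := by
    intro u hu
    refine ⟨u, ?_⟩
    have h4 := h.inclUnits_normUnits u
    rw [MonoidHom.mem_ker.1 hu, map_one] at h4
    change u / h.tauUnits u = u ^ 2
    rw [div_eq_iff_eq_mul, pow_two, mul_assoc, ← h4, mul_one]
  have hn' : (u₁ / u₂) ^ n ∈ (MonoidHom.id _ / h.tauUnits).range := by
    refine ⟨w, ?_⟩
    change w / h.tauUnits w = _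
    rw [div_pow, div_eq_div_iff_mul_eq_mul, ← hpow, mul_comm]
  have hs := hsq _ (Subgroup.div_mem _ hu₁ hu₂)
  obtain ⟨m, hm⟩ := hK
  have : u₁ / u₂ = (u₁ / u₂) ^ n / ((u₁ / u₂) ^ 2) ^ m := by
    rw [← pow_mul, hm, pow_succ]
    simp
  rw [this]
  exact Subgroup.div_mem _ hn' (Subgroup.pow_mem _ hs _)

/-- The main criterion: if there are few ambiguous ideals compared to the local restrictions on
norms of units, then every unit which is allowed to be a norm is one, and oddness of the class
number is inherited. -/
theorem odd_classNumber [IsTotallyReal K] [IsTotallyReal L] (h : IsSqrtExt K L a s)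
    (hK : Odd (Nat.card (ClassGroup (𝓞 K)))) {ι : Type*} [Finite ι]
    (R : ι → Ideal (𝓞 L)) (hR0 : ∃ i, R i = ⊤)
    (hR : ∀ P : Ideal (𝓞 L), P.IsPrime → P ≠ ⊥ → P.map h.tau = P → (∀ x, x - h.tau x ∈ P) →
      ∀ i, ∃ j, ∃ J : Ideal (𝓞 K), P * R i = J.map (algebraMap (𝓞 K) (𝓞 L)) * R j)
    (U : Subgroup (𝓞 K)ˣ)
    (hU : ∀ (v : (𝓞 K)ˣ) (α : L), algebraMap K L (v : 𝓞 K) = α * h.conj α → v ∈ U)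
    (hcard : Nat.card ι ≤ 2 * U.index) :
    (∀ v ∈ U, ∃ e : (𝓞 L)ˣ, normUnits K L e = v) ∧ Odd (Nat.card (ClassGroup (𝓞 L))) := by
  set N := (normUnits K L).ker with hN
  set D := (MonoidHom.id _ / h.tauUnits).range with hD
  obtain ⟨hrel, hidx⟩ := h.relIndex_units
  have hνU : (normUnits K L).range ≤ U := by
    rintro _ ⟨e, rfl⟩
    refine hU _ (e : 𝓞 L) ?_
    have := congrArg (fun w : (𝓞 L)ˣ => ((w : 𝓞 L) : L)) (h.inclUnits_normUnits e)
    exact this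
  have hβ : ∀ u : N, ∃ i, ∃ β : 𝓞 L, ∃ J : Ideal (𝓞 K), β ≠ 0 ∧ β = (u : (𝓞 L)ˣ) * h.tau β ∧
      Ideal.span {β} = J.map (algebraMap (𝓞 K) (𝓞 L)) * R i := by
    intro u
    have h4 := congrArg Units.val (h.inclUnits_normUnits u)
    rw [MonoidHom.mem_ker.1 u.2, map_one, Units.val_one, Units.val_mul, coe_tauUnits] at h4
    obtain ⟨β, hβ0, hβ⟩ := h.exists_mul_tau_eq (b := ((u : (𝓞 L)ˣ) : 𝓞 L)) (c := 1) (map_one _)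
      (by rw [← h4, one_pow])
    rw [one_mul] at hβ
    have hamb : (Ideal.span {β}).map h.tau = Ideal.span {β} := by
      rw [h.map_tau_span_singleton, Ideal.span_singleton_eq_span_singleton]
      exact ⟨u, by rw [mul_comm, hβ]⟩
    obtain ⟨i, J, hi⟩ := h.exists_eq_map_mul_of_map_tau_eq R hR0 hR (Ideal.span {β})
      (by simpa using hβ0) hamb
    exact ⟨i, β, J, hβ0, hβ.symm, hi⟩
  choose idx β J hβ0 hβu hβJ using hβ
  let f : N ⧸ D.subgroupOf N → ι := fun c => idx c.out
  have hf : Function.Injective f := by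
    intro c₁ c₂ hc
    rw [← QuotientGroup.out_eq' c₁, ← QuotientGroup.out_eq' c₂, eq_comm, QuotientGroup.eq,
      Subgroup.mem_subgroupOf]
    have h1 := hβJ c₁.out
    have h2 := hβJ c₂.out
    have hc' : idx c₁.out = idx c₂.out := hc
    rw [hc'] at h1
    have := h.div_mem_range hK c₁.out.2 c₂.out.2 (hβ0 _) (hβ0 _) (hβu _) (hβu _) h1 h2
    rw [div_eq_inv_mul] at this
    exact this
  have hq : Nat.card (N ⧸ D.subgroupOf N) = 2 * (normUnits K L).range.index := hrel
  have hle1 := Nat.card_le_card_of_injective f hf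
  have hmul := Subgroup.relIndex_mul_index hνU
  have hrel0 : (normUnits K L).range.relIndex U ≠ 0 := by
    intro h0
    rw [h0, zero_mul] at hmul
    exact hidx hmul.symm
  have hU0 : U.index ≠ 0 := by
    intro h0
    rw [h0, mul_zero] at hmul
    exact hidx hmul.symm
  have hle2 : (normUnits K L).range.index ≤ U.index := by omega
  have hrel1 : (normUnits K L).range.relIndex U = 1 := by
    by_contra hne
    have h2 : 2 ≤ (normUnits K L).range.relIndex U := by omega
    have : 2 * U.index ≤ (normUnits K L).range.index := by
      rw [← hmul]; exact Nat.mul_le_mul_right _ h2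
    omega
  have hUν : U ≤ (normUnits K L).range := Subgroup.relIndex_eq_one.1 hrel1
  have hidxU : (normUnits K L).range.index = U.index := by rw [← hmul, hrel1, one_mul]
  have hfb : Function.Bijective f :=
    (Nat.bijective_iff_injective_and_card f).2 ⟨hf, by omega⟩
  have hRi : ∀ i, ∃ β : 𝓞 L, ∃ J : Ideal (𝓞 K), β ≠ 0 ∧
      Ideal.span {β} = J.map (algebraMap (𝓞 K) (𝓞 L)) * R i := by
    intro i
    obtain ⟨c, rfl⟩ := hfb.2 i
    exact ⟨_, _, hβ0 _, hβJ c.out⟩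
  refine ⟨fun v hv => hUν hv, ?_⟩
  set n := Nat.card (ClassGroup (𝓞 K)) with hn
  have hinj := RingOfIntegers.algebraMap.injective K L
  refine odd_card_classGroup (n * n) (hK.mul hK) ?_
  intro A b hA hAb
  have hτA : A.map h.tau ≠ ⊥ := h.map_tau_eq_bot_iff.not.2 hA
  obtain ⟨J₀, hJ₀⟩ := h.exists_map_eq_mul_map_tau A
  obtain ⟨a₀, ha₀, hspan⟩ := exists_span_eq_pow (L := L) (J := J₀)
    (by rw [hJ₀]; exact mul_ne_zero hA hτA)
  rw [← hn, hJ₀, mul_pow] at hspan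
  set a₁ := algebraMap (𝓞 K) (𝓞 L) a₀ with ha₁
  have ha₁τ : h.tau a₁ = a₁ := AlgEquiv.commutes _ _
  have ha₁0 : a₁ ≠ 0 := by
    rw [Ne, ha₁, ← map_zero (algebraMap (𝓞 K) (𝓞 L)), hinj.eq_iff]; exact ha₀
  have hb' : Ideal.span {b ^ n} = A ^ n * A ^ n := by
    rw [← Ideal.span_singleton_pow, ← hAb, ← pow_mul, two_mul, pow_add]
  have hnorm : Ideal.span {a₁ ^ 2} = Ideal.span {b ^ n * h.tau (b ^ n)} := by
    rw [← Ideal.span_singleton_mul_span_singleton, ← h.map_tau_span_singleton, hb',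
      h.map_tau_mul, ← Ideal.span_singleton_pow, hspan, Ideal.map_pow]
    ring
  obtain ⟨w, hw⟩ := Ideal.span_singleton_eq_span_singleton.1 hnorm
  have hwτ : h.tauUnits w = w := by
    apply Units.ext
    apply mul_left_cancel₀ (pow_ne_zero 2 ha₁0)
    have := congrArg h.tau hw
    rw [map_mul, map_pow, map_mul, h.tau_tau, ha₁τ] at this
    rw [coe_tauUnits, this, hw, mul_comm]
  obtain ⟨v, hv⟩ := h.exists_inclUnits_eq_of_tauUnits_eq hwτ
  have hvU : v ∈ U := by
    refine hU v (((b ^ n : 𝓞 L) : L) / (a₁ : L)) ?_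
    have h1 : algebraMap K L (v : 𝓞 K) = ((w : 𝓞 L) : L) :=
      congrArg (fun w : (𝓞 L)ˣ => ((w : 𝓞 L) : L)) hv
    have h2 := congrArg (fun w : 𝓞 L => (w : L)) hw
    have h3 : h.conj (a₁ : L) = a₁ := congrArg (fun w : 𝓞 L => (w : L)) ha₁τ
    have h4 : (a₁ : L) ≠ 0 := RingOfIntegers.coe_ne_zero_iff.2 ha₁0
    rw [h1, map_div₀, h3, div_mul_div_comm, eq_div_iff (mul_ne_zero h4 h4)]
    simp only [map_mul, map_pow] at h2 ⊢
    have h5 : algebraMap (𝓞 L) L (h.tau b) = h.conj (algebraMap (𝓞 L) L b) := rfl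
    rw [h5] at h2
    linear_combination h2
  obtain ⟨e, he⟩ := hUν hvU
  have hwe : (w : 𝓞 L) = e * h.tau e := by
    rw [← hv, ← he, h.inclUnits_normUnits]
    rfl
  have hee : h.tau (((e⁻¹ : (𝓞 L)ˣ) : 𝓞 L)) * h.tau e = 1 := by
    rw [← map_mul, Units.inv_mul, map_one]
  obtain ⟨γ, hγ0, hγ⟩ := h.exists_mul_tau_eq (b := b ^ n * ((e⁻¹ : (𝓞 L)ˣ) : 𝓞 L)) (c := a₁) ha₁τ
    (by
      rw [map_mul]
      have h5 : ((e⁻¹ : (𝓞 L)ˣ) : 𝓞 L) * e = 1 := Units.inv_mul e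
      rw [hwe] at hw
      linear_combination (-((e⁻¹ : (𝓞 L)ˣ) : 𝓞 L) * h.tau ((e⁻¹ : (𝓞 L)ˣ) : 𝓞 L)) * hw +
        a₁ ^ 2 * (((e⁻¹ : (𝓞 L)ˣ) : 𝓞 L) * e) * hee + a₁ ^ 2 * h5)
  have hτγ : h.tau γ ≠ 0 := by simpa using hγ0
  have hAγ : A ^ n * Ideal.span {h.tau γ} = (A.map h.tau) ^ n * Ideal.span {γ} := by
    apply mul_left_cancel₀ (pow_ne_zero n hA)
    rw [← mul_assoc, ← mul_assoc, ← hspan, ← hb', Ideal.span_singleton_mul_span_singleton,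
      Ideal.span_singleton_mul_span_singleton, ← hγ, Ideal.span_singleton_eq_span_singleton]
    exact ⟨e⁻¹, by ring⟩
  obtain ⟨i, J', hi⟩ := h.exists_eq_map_mul_of_map_tau_eq R hR0 hR
    (A ^ n * Ideal.span {h.tau γ}) (mul_ne_zero (pow_ne_zero n hA) (by simpa using hγ0)) (by
      rw [h.map_tau_mul, h.map_tau_span_singleton, h.tau_tau, Ideal.map_pow, hAγ])
  obtain ⟨β', J'', hβ'0, hβ'⟩ := hRi i
  obtain ⟨c', hc'0, hc'⟩ := exists_span_eq_pow (L := L) (J := J') (by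
    intro hbot
    rw [hbot, Ideal.bot_mul] at hi
    exact mul_ne_zero (pow_ne_zero n hA)
      (show Ideal.span {h.tau γ} ≠ 0 by simpa using hγ0) hi)
  obtain ⟨c'', hc''0, hc''⟩ := exists_span_eq_pow (L := L) (J := J'') (by
    intro hbot
    rw [hbot, Ideal.bot_mul] at hβ'
    exact hβ'0 (by simpa using hβ'))
  rw [← hn] at hc' hc''
  have hc''0' : algebraMap (𝓞 K) (𝓞 L) c'' ≠ 0 := by
    rw [Ne, ← map_zero (algebraMap (𝓞 K) (𝓞 L)), hinj.eq_iff]; exact hc''0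
  have hfin : A ^ (n * n) * Ideal.span {h.tau γ ^ n * algebraMap (𝓞 K) (𝓞 L) c''} =
      Ideal.span {algebraMap (𝓞 K) (𝓞 L) c' * β' ^ n} := by
    rw [← Ideal.span_singleton_mul_span_singleton, ← Ideal.span_singleton_mul_span_singleton,
      ← Ideal.span_singleton_pow, ← Ideal.span_singleton_pow, hc', hc'', hβ', pow_mul, ← mul_assoc,
      ← mul_pow, hi]
    simp only [mul_pow]
    ring
  obtain ⟨z, hz⟩ := exists_span_singleton_eq_of_mul
    (mul_ne_zero (pow_ne_zero n hτγ) hc''0') hfin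
  exact ⟨z, hz.symm⟩

end IsSqrtExt

section Generic

variable {L : Type*} [Field L] [NumberField L]

theorem exists_ringOfIntegers_eq_of_sq {s : L} {m : ℕ} (hs : s ^ 2 = m) :
    ∃ x : 𝓞 L, (x : L) = s ∧ x ^ 2 = m := by
  have hs_int : IsIntegral ℤ s := by
    apply IsIntegral.of_pow (n := 2) two_pos
    rw [hs]
    simpa using isIntegral_algebraMap (R := ℤ) (A := L) (x := (m : ℤ))
  refine ⟨⟨s, hs_int⟩, rfl, RingOfIntegers.ext ?_⟩
  exact hs.trans (map_natCast (algebraMap (𝓞 L) L) m).symm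

theorem exists_half_of_sq {s : L} {m : ℕ} (hs : s ^ 2 = m) (hm : m % 4 = 1) :
    ∃ x : 𝓞 L, 2 * (x : L) = 1 + s := by
  obtain ⟨t, rfl⟩ : ∃ t, m = 4 * t + 1 := ⟨m / 4, by omega⟩
  have hs_int : IsIntegral ℤ ((1 + s) / 2) := by
    refine ⟨Polynomial.X ^ 2 - Polynomial.X - Polynomial.C (t : ℤ), ?_, ?_⟩
    · monicity!
    · simp only [Polynomial.eval₂_sub, Polynomial.eval₂_pow, Polynomial.eval₂_X,
        Polynomial.eval₂_C]
      push_cast at hs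
      simp only [algebraMap_int_eq, eq_intCast, Int.cast_natCast]
      linear_combination hs / 4
  exact ⟨⟨_, hs_int⟩, mul_div_cancel₀ _ two_ne_zero⟩

theorem absNorm_span_sq {x : 𝓞 L} {m : ℕ} (hx : x ^ 2 = m) :
    Ideal.absNorm (Ideal.span {x}) ^ 2 = m ^ Module.finrank ℚ L := by
  rw [← map_pow, Ideal.span_singleton_pow, hx, Ideal.absNorm_span_natCast, RingOfIntegers.rank]

theorem natCast_mem_iff {P : Ideal (𝓞 L)} (hP : P ≠ ⊤) {l : ℕ} (hl : l.Prime)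
    (hlP : (l : 𝓞 L) ∈ P) (m : ℤ) : (m : 𝓞 L) ∈ P ↔ (l : ℤ) ∣ m := by
  constructor
  · intro hm
    by_contra hnd
    have hco : IsCoprime (l : ℤ) m :=
      (Nat.prime_iff_prime_int.1 hl).coprime_iff_not_dvd.2 hnd
    obtain ⟨u, v, huv⟩ := hco
    apply hP
    rw [Ideal.eq_top_iff_one]
    have : (1 : 𝓞 L) = (u : 𝓞 L) * (l : 𝓞 L) + (v : 𝓞 L) * (m : 𝓞 L) := by
      have := congrArg (Int.cast : ℤ → 𝓞 L) huv
      push_cast at this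
      exact this.symm
    rw [this]
    exact P.add_mem (P.mul_mem_left _ hlP) (P.mul_mem_left _ hm)
  · rintro ⟨c, rfl⟩
    push_cast
    exact P.mul_mem_right _ hlP

theorem injective_fin_prod {P : Ideal (𝓞 L)} (hP : P ≠ ⊤) {l : ℕ} (hl : l.Prime)
    (hlP : (l : 𝓞 L) ∈ P) {e : 𝓞 L} {m : ℕ} (he : e ^ 2 = m) (hJ : J(m | l) = -1) :
    Function.Injective (fun i : Fin l × Fin l =>
      Ideal.Quotient.mk P ((i.1 : ℕ) + (i.2 : ℕ) * e)) := by
  have := Fact.mk hl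
  rintro ⟨i, j⟩ ⟨i', j'⟩ hij
  simp only at hij
  rw [Ideal.Quotient.eq] at hij
  have h1 : (((i : ℤ) - i') ^ 2 - m * ((j : ℤ) - j') ^ 2 : ℤ) ∈
      (Ideal.comap (Int.castRingHom (𝓞 L)) P) := by
    rw [Ideal.mem_comap]
    have := P.mul_mem_right ((i : 𝓞 L) - (i' : ℕ) - ((j : ℕ) - (j' : ℕ)) * e) hij
    convert this using 1
    simp only [eq_intCast]
    push_cast
    linear_combination ((j : 𝓞 L) - (j' : ℕ)) ^ 2 * he
  rw [Ideal.mem_comap, eq_intCast, natCast_mem_iff hP hl hlP] at h1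
  obtain ⟨h2, h3⟩ := jacobiSym.prime_dvd_of_eq_neg_one hJ h1
  have hi := Int.emod_emod_of_dvd
  ext
  · have := i.2; have := i'.2
    have := Int.eq_zero_of_abs_lt_dvd h2 (by rw [abs_lt]; constructor <;> omega)
    simp; omega
  · have := j.2; have := j'.2
    have := Int.eq_zero_of_abs_lt_dvd h3 (by rw [abs_lt]; constructor <;> omega)
    simp; omega

theorem finite_quotient {P : Ideal (𝓞 L)} (hP0 : P ≠ ⊥) : Finite (𝓞 L ⧸ P) :=
  Ideal.finiteQuotientOfFreeOfNeBot P hP0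

theorem sq_le_absNorm {P : Ideal (𝓞 L)} (hP : P ≠ ⊤) (hP0 : P ≠ ⊥) {l : ℕ} (hl : l.Prime)
    (hlP : (l : 𝓞 L) ∈ P) {e : 𝓞 L} {m : ℕ} (he : e ^ 2 = m) (hJ : J(m | l) = -1) :
    l ^ 2 ≤ Ideal.absNorm P := by
  have := finite_quotient hP0
  have := Nat.card_le_card_of_injective _ (injective_fin_prod hP hl hlP he hJ)
  rw [Nat.card_prod, Nat.card_fin] at this
  rw [Ideal.absNorm_apply, Submodule.cardQuot_apply, sq]
  exact this

theorem exists_sub_mem {P : Ideal (𝓞 L)} (hP : P ≠ ⊤) (hP0 : P ≠ ⊥) {l : ℕ} (hl : l.Prime)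
    (hlP : (l : 𝓞 L) ∈ P) {e : 𝓞 L} {m : ℕ} (he : e ^ 2 = m) (hJ : J(m | l) = -1)
    (hN : Ideal.absNorm P = l ^ 2) (x : 𝓞 L) : ∃ i j : ℕ, x - (i + j * e) ∈ P := by
  have := finite_quotient hP0
  have hb := (injective_fin_prod hP hl hlP he hJ).bijective_of_nat_card_le (by
    rw [Nat.card_prod, Nat.card_fin, ← sq, ← hN, Ideal.absNorm_apply, Submodule.cardQuot_apply])
  obtain ⟨⟨i, j⟩, hij⟩ := hb.2 (Ideal.Quotient.mk P x)
  exact ⟨i, j, Ideal.Quotient.eq.1 hij.symm⟩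

end Generic

namespace IsSqrtExt

variable {K L : Type*} [Field K] [Field L] [NumberField K] [NumberField L] [Algebra K L]
  {m : ℕ} {s : L}

theorem isTotallyReal [IsTotallyReal K] (h : IsSqrtExt K L (m : K) s) : IsTotallyReal L := by
  rw [NumberField.isTotallyReal_iff]
  intro w
  rw [← InfinitePlace.mk_embedding w, InfinitePlace.isReal_mk_iff]
  have hr := fun x => DFunLike.congr_fun
    (IsTotallyReal.complexEmbedding_isReal (w.embedding.comp (algebraMap K L))) x
  simp only [ComplexEmbedding.conjugate_coe_eq, RingHom.comp_apply] at hr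
  have hs : starRingEnd ℂ (w.embedding s) = w.embedding s := by
    have h1 := congrArg w.embedding h.sq
    rw [map_pow, map_natCast, map_natCast] at h1
    have h2 := congrArg Complex.re h1
    have h3 := congrArg Complex.im h1
    rw [pow_two] at h2 h3
    simp only [Complex.mul_re, Complex.mul_im, Complex.natCast_re, Complex.natCast_im] at h2 h3
    rw [Complex.conj_eq_iff_im]
    have h4 : (0 : ℝ) ≤ m := Nat.cast_nonneg m
    by_contra h5
    have h6 : (w.embedding s).re = 0 := by
      apply mul_right_cancel₀ h5
      linarith
    rw [h6] at h2
    have := mul_self_pos.2 h5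
    linarith
  ext x
  obtain ⟨u, v, rfl⟩ := h.gen x
  rw [ComplexEmbedding.conjugate_coe_eq]
  simp only [map_add, map_mul, hr, hs]

theorem finrank_rat (h : IsSqrtExt K L (m : K) s) :
    Module.finrank ℚ L = Module.finrank ℚ K * 2 := by
  rw [← h.finrank_eq_two, Module.finrank_mul_finrank]

theorem mem_of_sub_tau_mem (h : IsSqrtExt K L (m : K) s) {x : 𝓞 L} (hx : (x : L) = s)
    (hm : m = 2 ∨ m % 4 = 1) {P : Ideal (𝓞 L)} (hP : P.IsPrime)
    (hτ : ∀ y, y - h.tau y ∈ P) : x ∈ P := by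
  have hτx : h.tau x = -x := by
    ext
    rw [coe_tau, hx, h.conj_self, ← hx]
    exact (map_neg (algebraMap (𝓞 L) L) x).symm
  have hx2 : x ^ 2 = m := by
    ext
    have := h.sq
    simp only [map_natCast] at this
    simpa [hx] using this
  rcases hm with rfl | hm
  · have h1 := hτ x
    rw [hτx, show x - -x = 2 * x by ring] at h1
    rcases hP.mem_or_mem h1 with h2 | h2
    · apply hP.mem_of_pow_mem 2
      rw [hx2]
      exact_mod_cast h2
    · exact h2
  · have hs : s ^ 2 = (m : L) := by rw [h.sq, map_natCast]
    obtain ⟨y, hy⟩ := exists_half_of_sq hs hm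
    have h1 := hτ y
    convert h1
    ext
    have h2 : 2 * h.conj y = 1 - s := by
      have := congrArg h.conj hy
      rw [map_mul, map_add, map_one, h.conj_self, map_ofNat] at this
      linear_combination this
    have h3 : (2 : L) ≠ 0 := two_ne_zero
    apply mul_left_cancel₀ h3
    rw [show ((y - h.tau y : 𝓞 L) : L) = y - h.conj y from map_sub (algebraMap (𝓞 L) L) _ _,
      mul_sub, hy, h2, hx]
    ring

/-- If only the prime `(s)` ramifies, units are norms and the class number stays odd. -/
theorem odd_classNumber_of_span [IsTotallyReal K] [IsTotallyReal L] (h : IsSqrtExt K L (m : K) s)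
    (hK : Odd (Nat.card (ClassGroup (𝓞 K)))) {x : 𝓞 L} (hx : (x : L) = s)
    (hm : m = 2 ∨ m % 4 = 1)
    (hspan : ∀ P : Ideal (𝓞 L), P.IsPrime → P ≠ ⊥ → x ∈ P → P = Ideal.span {x}) :
    (∀ v : (𝓞 K)ˣ, ∃ e, normUnits K L e = v) ∧ Odd (Nat.card (ClassGroup (𝓞 L))) := by
  have hx2 : x * x = algebraMap (𝓞 K) (𝓞 L) m := by
    ext
    have := h.sq
    simp only [map_natCast] at this
    simpa [hx, pow_two] using this
  have := h.odd_classNumber hK (ι := Bool) (fun b => if b then ⊤ else Ideal.span {x})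
    ⟨true, by simp⟩ ?_ ⊤ (fun _ _ _ => Subgroup.mem_top _) (by simp)
  · exact ⟨fun v => this.1 v (Subgroup.mem_top _), this.2⟩
  · intro P hP hP0 _ hτ i
    have hPx := hspan P hP hP0 (h.mem_of_sub_tau_mem hx hm hP hτ)
    cases i with
    | true => exact ⟨false, ⊤, by simp [hPx, Ideal.map_top]⟩
    | false =>
      refine ⟨true, Ideal.span {(m : 𝓞 K)}, ?_⟩
      simp only [hPx, Bool.false_eq_true, if_false, if_true, Ideal.mul_top]
      rw [Ideal.span_singleton_mul_span_singleton, hx2, Ideal.map_span, Set.image_singleton]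

end IsSqrtExt

section Descent

theorem descent_eq_zero {q k : ℕ} (hq : q.Prime) (hk : ¬ q ∣ k) {m : ℤ} (hJ : J(m | q) = -1)
    {A B C : ℤ} (h : A ^ 2 - m * C ^ 2 = q * k * B ^ 2) : C = 0 := by
  have := Fact.mk hq
  have hq' := Nat.prime_iff_prime_int.1 hq
  by_contra hC
  induction hn : C.natAbs using Nat.strong_induction_on generalizing A B C with
  | _ n ih =>
    have h1 : (q : ℤ) ∣ A ^ 2 - m * C ^ 2 := ⟨k * B ^ 2, by rw [h]; ring⟩
    obtain ⟨⟨A', rfl⟩, ⟨C', rfl⟩⟩ := jacobiSym.prime_dvd_of_eq_neg_one hJ h1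
    have hq0 : (q : ℤ) ≠ 0 := hq'.ne_zero
    have h2 : (q : ℤ) ∣ k * B ^ 2 := by
      refine ⟨A' ^ 2 - m * C' ^ 2, mul_left_cancel₀ hq0 ?_⟩
      linear_combination -h
    rcases hq'.dvd_or_dvd h2 with h3 | h3
    · exact hk (Int.natCast_dvd_natCast.1 h3)
    · obtain ⟨B', rfl⟩ := hq'.dvd_of_dvd_pow h3
      have hC' : C' ≠ 0 := by rintro rfl; simp at hC
      refine ih C'.natAbs ?_ (A := A') (B := B') (C := C') ?_ hC' rfl
      · rw [← hn, Int.natAbs_mul, Int.natAbs_natCast]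
        have := Int.natAbs_pos.2 hC'
        have := hq.two_le
        nlinarith
      · apply mul_left_cancel₀ (pow_ne_zero 2 hq0)
        linear_combination h

theorem exists_common_denom (u v : ℚ) : ∃ A B C : ℤ, C ≠ 0 ∧ u * C = A ∧ v * C = B := by
  refine ⟨u.num * v.den, v.num * u.den, u.den * v.den, ?_, ?_, ?_⟩
  · exact_mod_cast mul_ne_zero u.den_nz v.den_nz
  · push_cast
    nth_rw 1 [← Rat.num_div_den u]
    have : (u.den : ℚ) ≠ 0 := by exact_mod_cast u.den_nz
    field_simp
  · push_cast
    nth_rw 1 [← Rat.num_div_den v]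
    have : (v.den : ℚ) ≠ 0 := by exact_mod_cast v.den_nz
    field_simp

theorem exists_int_of_mul_sq {p q : ℕ} (hp : p.Prime) (hq : q.Prime) (hpq : p ≠ q) {t : ℚ} {n : ℤ}
    (h : p * q * t ^ 2 = n) : ∃ T : ℤ, t = T := by
  have hs_int : IsIntegral ℤ ((p * q : ℚ) * t) := by
    apply IsIntegral.of_pow (n := 2) two_pos
    have : ((p * q : ℚ) * t) ^ 2 = ((p * q * n : ℤ) : ℚ) := by
      push_cast
      rw [← h]; ring
    rw [this]
    exact isIntegral_algebraMap (R := ℤ) (A := ℚ)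
  obtain ⟨M, hM⟩ := IsIntegrallyClosed.isIntegral_iff.1 hs_int
  have hM' : (M : ℚ) = p * q * t := hM
  have h2 : M ^ 2 = p * q * n := by
    have : ((M ^ 2 : ℤ) : ℚ) = ((p * q * n : ℤ) : ℚ) := by
      push_cast
      rw [hM', ← h]; ring
    exact_mod_cast this
  have hpM : (p : ℤ) ∣ M := (Nat.prime_iff_prime_int.1 hp).dvd_of_dvd_pow
    (n := 2) ⟨q * n, by rw [h2]; ring⟩
  have hqM : (q : ℤ) ∣ M := (Nat.prime_iff_prime_int.1 hq).dvd_of_dvd_pow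
    (n := 2) ⟨p * n, by rw [h2]; ring⟩
  have hco : IsCoprime (p : ℤ) q := Nat.isCoprime_iff_coprime.2 ((Nat.coprime_primes hp hq).2 hpq)
  obtain ⟨T, rfl⟩ := hco.mul_dvd hpM hqM
  refine ⟨T, ?_⟩
  have hp0 : (p : ℚ) ≠ 0 := by exact_mod_cast hp.ne_zero
  have hq0 : (q : ℚ) ≠ 0 := by exact_mod_cast hq.ne_zero
  apply mul_left_cancel₀ (mul_ne_zero hp0 hq0)
  rw [← hM']
  push_cast
  ring

end Descent

section Quadratic

variable {F : Type*} [Field F] [NumberField F] {p q : ℕ} {d : F}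

theorem norm_ne_of_jacobiSym (hF : IsSqrtExt ℚ F ((p * q : ℕ) : ℚ) d) (hp : p.Prime) (hq : q.Prime)
    (hpq : p ≠ q) {m : ℤ} (hJ : J(m | q) = -1) (f : F) : Algebra.norm ℚ f ≠ m := by
  intro hf
  obtain ⟨u, v, rfl⟩ := hF.gen f
  rw [hF.norm_mk] at hf
  obtain ⟨A, B, C, hC, hA, hB⟩ := exists_common_denom u v
  refine hC (descent_eq_zero hq (k := p) (fun h => hpq ?_) hJ (A := A) (B := B) (C := C) ?_)
  · exact ((Nat.prime_dvd_prime_iff_eq hq hp).1 h).symm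
  · have : ((A ^ 2 - m * C ^ 2 : ℤ) : ℚ) = ((q * p * B ^ 2 : ℤ) : ℚ) := by
      push_cast
      rw [← hA, ← hB, ← hf]
      push_cast
      ring
    exact_mod_cast this

theorem exists_two_mul_eq (hF : IsSqrtExt ℚ F ((p * q : ℕ) : ℚ) d) (hp : p.Prime) (hq : q.Prime)
    (hpq : p ≠ q) {u : 𝓞 F} (hu : Algebra.norm ℚ (u : F) = -1) :
    ∃ S T : ℤ, 2 * (u : F) = S + T * d ∧ S ^ 2 - p * q * T ^ 2 = -4 := by
  obtain ⟨x, y, hxy⟩ := hF.gen (u : F)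
  have hconj : hF.conj (u : F) = algebraMap ℚ F x - algebraMap ℚ F y * d := by
    rw [hxy, map_add, map_mul, AlgEquiv.commutes, AlgEquiv.commutes, hF.conj_self]
    ring
  have hs_int : IsIntegral ℤ (2 * x) := by
    rw [← isIntegral_algebraMap_iff (algebraMap ℚ F).injective]
    have : algebraMap ℚ F (2 * x) = (u : F) + hF.conj (u : F) := by
      rw [hconj, hxy, map_mul, map_ofNat]
      ring
    rw [this]
    exact u.2.add (u.2.map (hF.conj.toAlgHom.restrictScalars ℤ))
  obtain ⟨S, hS⟩ := IsIntegrallyClosed.isIntegral_iff.1 hs_int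
  have hS' : (S : ℚ) = 2 * x := hS
  rw [hxy, hF.norm_mk] at hu
  obtain ⟨T, hT⟩ := exists_int_of_mul_sq hp hq hpq (t := 2 * y) (n := S ^ 2 + 4) (by
    push_cast at hu ⊢
    rw [hS']
    linear_combination -4 * hu)
  refine ⟨S, T, ?_, ?_⟩
  · have h1 : (S : F) = algebraMap ℚ F (2 * x) := by rw [← hS', map_intCast]
    have h2 : (T : F) = algebraMap ℚ F (2 * y) := by rw [hT, map_intCast]
    rw [h1, h2, hxy, map_mul, map_mul, map_ofNat]
    ring
  · have : ((S ^ 2 - p * q * T ^ 2 : ℤ) : ℚ) = ((-4 : ℤ) : ℚ) := by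
      push_cast at hu ⊢
      rw [hS', ← hT]
      linear_combination 4 * hu
    exact_mod_cast this

theorem exists_ternary_form (hF : IsSqrtExt ℚ F ((p * q : ℕ) : ℚ) d) (hp : p.Prime) {r H : ℕ}
    (hr : r ≠ 0) (hH : Odd H) {f : F} (hf : Algebra.norm ℚ f = p * r ^ H) :
    ∃ x y z : ℤ, p * x ^ 2 - q * y ^ 2 = r * z ^ 2 ∧ z ≠ 0 := by
  obtain ⟨u, v, rfl⟩ := hF.gen f
  rw [hF.norm_mk] at hf
  obtain ⟨A, B, C, hC, hA, hB⟩ := exists_common_denom u v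
  obtain ⟨t, rfl⟩ := hH
  have h1 : A ^ 2 - p * q * B ^ 2 = p * r ^ (2 * t + 1) * C ^ 2 := by
    have : ((A ^ 2 - p * q * B ^ 2 : ℤ) : ℚ) = ((p * r ^ (2 * t + 1) * C ^ 2 : ℤ) : ℚ) := by
      push_cast at hf ⊢
      rw [← hA, ← hB, ← hf]
      ring
    exact_mod_cast this
  have hp' := Nat.prime_iff_prime_int.1 hp
  obtain ⟨A', rfl⟩ := hp'.dvd_of_dvd_pow (a := A) (n := 2)
    ⟨q * B ^ 2 + r ^ (2 * t + 1) * C ^ 2, by linear_combination h1⟩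
  refine ⟨A', B, r ^ t * C, ?_, mul_ne_zero (pow_ne_zero _ (by exact_mod_cast hr)) hC⟩
  apply mul_left_cancel₀ hp'.ne_zero
  linear_combination h1

theorem norm_eq_or_eq_neg (x : 𝓞 F) :
    Algebra.norm ℚ (x : F) = Ideal.absNorm (Ideal.span {x}) ∨
      Algebra.norm ℚ (x : F) = -(Ideal.absNorm (Ideal.span {x}) : ℚ) := by
  rw [Ideal.absNorm_span_singleton, ← Algebra.coe_norm_int]
  rcases Int.natAbs_eq (Algebra.norm ℤ x) with h | h
  · left
    nth_rw 1 [h]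
    simp
  · right
    nth_rw 1 [h]
    simp

theorem norm_units_eq_or (u : (𝓞 F)ˣ) :
    Algebra.norm ℚ ((u : 𝓞 F) : F) = 1 ∨ Algebra.norm ℚ ((u : 𝓞 F) : F) = -1 := by
  have := norm_eq_or_eq_neg (u : 𝓞 F)
  rw [Ideal.span_singleton_eq_top.2 u.isUnit, Ideal.absNorm_top] at this
  simpa using this

end Quadratic

section Ideals

variable {L : Type*} [Field L] [NumberField L]

theorem eq_of_le_of_absNorm_le {I J : Ideal (𝓞 L)} (hle : I ≤ J) (hI : I ≠ ⊥)
    (hN : Ideal.absNorm I ≤ Ideal.absNorm J) : I = J := by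
  obtain ⟨C, rfl⟩ := Ideal.dvd_iff_le.2 hle
  rw [map_mul] at hN
  have hJ : Ideal.absNorm J ≠ 0 := by
    rw [Ne, Ideal.absNorm_eq_zero_iff]
    rintro rfl
    simp at hI
  have hC : Ideal.absNorm C ≠ 0 := by
    rw [Ne, Ideal.absNorm_eq_zero_iff]
    rintro rfl
    simp at hI
  have h1 : Ideal.absNorm C = 1 := by
    have : Ideal.absNorm C ≤ 1 := by
      by_contra! h
      have := Nat.mul_lt_mul_of_pos_left h (Nat.pos_of_ne_zero hJ)
      omega
    omega
  rw [Ideal.absNorm_eq_one_iff.1 h1, Ideal.mul_top]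

end Ideals

theorem odd_card_classGroup_rat : Odd (Nat.card (ClassGroup (𝓞 ℚ))) := by
  have := Rat.classNumber_eq
  rw [NumberField.classNumber, ← Nat.card_eq_fintype_card] at this
  rw [this]
  exact odd_one

namespace IsSqrtExt

section Base

variable {K : Type*} [Field K] [NumberField K] {p : ℕ} {a : K}

theorem odd_classNumber_quadratic (h : IsSqrtExt ℚ K (p : ℚ) a) (hp : p.Prime)
    (hp4 : p = 2 ∨ p % 4 = 1) :
    (∃ e : (𝓞 K)ˣ, Algebra.norm ℚ ((e : 𝓞 K) : K) = -1) ∧ Odd (Nat.card (ClassGroup (𝓞 K))) := by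
  have := h.isTotallyReal
  obtain ⟨x, hx, hx2⟩ := exists_ringOfIntegers_eq_of_sq (s := a) (m := p)
    (by rw [h.sq, map_natCast])
  have hN : Ideal.absNorm (Ideal.span {x}) = p := by
    have := absNorm_span_sq hx2
    rw [h.finrank_eq_two] at this
    exact Nat.pow_left_injective two_ne_zero this
  have hprime : (Ideal.span {x}).IsPrime :=
    Ideal.isPrime_of_irreducible_absNorm (by rw [hN]; exact hp)
  have hx0 : Ideal.span {x} ≠ ⊥ := by
    intro h0
    rw [h0, Ideal.absNorm_bot] at hN
    exact hp.ne_zero hN.symm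
  have hmax := hprime.isMaximal hx0
  have := h.odd_classNumber_of_span odd_card_classGroup_rat hx hp4 (fun P hP hP0 hxP =>
    (hmax.eq_of_le hP.ne_top ((Ideal.span_singleton_le_iff_mem _).2 hxP)).symm)
  refine ⟨?_, this.2⟩
  obtain ⟨e, he⟩ := this.1 (-1)
  refine ⟨e, ?_⟩
  have := congrArg (fun w : (𝓞 ℚ)ˣ => ((w : 𝓞 ℚ) : ℚ)) he
  simp only [Units.val_neg, Units.val_one, map_neg, map_one] at this
  exact this

end Base

section Step

variable {K k : Type*} [Field K] [NumberField K] [Field k] [NumberField k] [Algebra K k]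
  {p q : ℕ} {a : K} {b : k}

theorem odd_classNumber_biquadratic (h : IsSqrtExt ℚ K (p : ℚ) a) (hk : IsSqrtExt K k (q : K) b)
    (hp : p.Prime) (hq : q.Prime) (hp4 : p = 2 ∨ p % 4 = 1) (hq4 : q % 4 = 1)
    (hJ : J(p | q) = -1) :
    (∃ w : (𝓞 k)ˣ, Algebra.norm ℚ (Algebra.norm K ((w : 𝓞 k) : k)) = -1) ∧
      Odd (Nat.card (ClassGroup (𝓞 k))) := by
  have := h.isTotallyReal
  have := hk.isTotallyReal
  obtain ⟨⟨e, he⟩, hodd⟩ := h.odd_classNumber_quadratic hp hp4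
  obtain ⟨x, hx, hx2⟩ := exists_ringOfIntegers_eq_of_sq (s := b) (m := q)
    (by rw [hk.sq, map_natCast])
  obtain ⟨y, hy, hy2⟩ := exists_ringOfIntegers_eq_of_sq (s := algebraMap K k a) (m := p)
    (by rw [← map_pow, h.sq, map_natCast, map_natCast])
  have hN : Ideal.absNorm (Ideal.span {x}) = q ^ 2 := by
    have := absNorm_span_sq hx2
    rw [hk.finrank_rat, h.finrank_eq_two, pow_mul] at this
    exact Nat.pow_left_injective two_ne_zero this
  have hx0 : Ideal.span {x} ≠ ⊥ := by
    intro h0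
    rw [h0, Ideal.absNorm_bot] at hN
    exact pow_ne_zero 2 hq.ne_zero hN.symm
  have := hk.odd_classNumber_of_span hodd hx (Or.inr hq4) (fun P hP hP0 hxP => by
    refine (eq_of_le_of_absNorm_le ((Ideal.span_singleton_le_iff_mem _).2 hxP) hx0 ?_).symm
    rw [hN]
    refine sq_le_absNorm hP.ne_top hP0 hq ?_ hy2 hJ
    rw [← hx2, pow_two]
    exact P.mul_mem_left _ hxP)
  refine ⟨?_, this.2⟩
  obtain ⟨w, hw⟩ := this.1 e
  refine ⟨w, ?_⟩
  rw [← he]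
  exact congrArg (fun w : (𝓞 K)ˣ => Algebra.norm ℚ ((w : 𝓞 K) : K)) hw

end Step

end IsSqrtExt

theorem Subgroup.eq_top_of_index_eq_four {A : Type*} [CommGroup A] {S R : Subgroup A}
    (hS : S.index = 4) (hSR : S ≤ R) {x y : A} (hx : x ∈ R) (hy : y ∈ R) (hxS : x ∉ S)
    (hyS : y ∉ S) (hxy : x * y ∉ S) : R = ⊤ := by
  have h1 := Subgroup.relIndex_mul_index hSR
  rw [hS] at h1
  have h2 : S.relIndex R ≤ 4 := Nat.le_of_dvd (by norm_num) ⟨_, h1.symm⟩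
  have h3 : S.relIndex R ≠ 1 := fun h => hxS (Subgroup.relIndex_eq_one.1 h hx)
  have h4 : S.relIndex R ≠ 2 := by
    intro h
    have := Subgroup.mul_mem_iff_of_index_two (H := S.subgroupOf R) h (a := ⟨x, hx⟩) (b := ⟨y, hy⟩)
    simp only [Subgroup.mem_subgroupOf, Subgroup.coe_mul] at this
    tauto
  rw [← Subgroup.index_eq_one]
  interval_cases h : S.relIndex R <;> omega

theorem Subgroup.mem_or_mul_mem_of_relIndex_eq_two {A : Type*} [CommGroup A] {D N : Subgroup A}
    (h : D.relIndex N = 2) {x v : A} (hx : x ∈ N) (hv : v ∈ N) (hxD : x ∉ D) :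
    v ∈ D ∨ x * v ∈ D := by
  have := Subgroup.mul_mem_iff_of_index_two (H := D.subgroupOf N) h (a := ⟨x, hx⟩) (b := ⟨v, hv⟩)
  simp only [Subgroup.mem_subgroupOf, Subgroup.coe_mul] at this
  tauto

/-- The fields `K = ℚ(√p)`, `F = ℚ(√(pq))` and `k = ℚ(√p, √q)`. -/
structure QuadraticTower (K F k : Type*) [Field K] [Field F] [Field k] [NumberField K]
    [NumberField F] [NumberField k] [Algebra K k] [Algebra F k] (p q : ℕ) (a : K) (d : F) (b : k) :
    Prop where
  hp : p.Prime
  hq : q.Prime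
  hpq : p ≠ q
  hp4 : p = 2 ∨ p % 4 = 1
  hq4 : q % 4 = 1
  hJ : J(p | q) = -1
  hK : IsSqrtExt ℚ K (p : ℚ) a
  hF : IsSqrtExt ℚ F ((p * q : ℕ) : ℚ) d
  hk : IsSqrtExt K k (q : K) b
  hkF : IsSqrtExt F k (p : F) (algebraMap K k a)
  hd : algebraMap F k d = algebraMap K k a * b

namespace QuadraticTower

open IsSqrtExt

variable {K F k : Type*} [Field K] [Field F] [Field k] [NumberField K]
    [NumberField F] [NumberField k] [Algebra K k] [Algebra F k] {p q : ℕ} {a : K} {d : F} {b : k}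

theorem conj_algebraMap (t : QuadraticTower K F k p q a d b) (y : K) :
    t.hkF.conj (algebraMap K k y) = algebraMap K k (t.hK.conj y) := by
  obtain ⟨u, v, rfl⟩ := t.hK.gen y
  simp only [map_add, map_mul, AlgEquiv.commutes, t.hK.conj_self, t.hkF.conj_self, map_neg]
  simp only [eq_ratCast, map_ratCast]

theorem norm_units_sq (u : (𝓞 F)ˣ) :
    Algebra.norm ℚ (((u ^ 2 : (𝓞 F)ˣ) : 𝓞 F) : F) = 1 := by
  rw [Units.val_pow_eq_pow_val]
  simp only [map_pow]
  rcases norm_units_eq_or u with h | h <;> rw [h] <;> norm_num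

theorem normUnits_surjective (t : QuadraticTower K F k p q a d b) (u : (𝓞 F)ˣ) :
    ∃ w, normUnits F k w = u := by
  have := t.hF.isTotallyReal
  obtain ⟨⟨e, he⟩, -⟩ := t.hK.odd_classNumber_quadratic t.hp t.hp4
  obtain ⟨⟨w, hw⟩, -⟩ := t.hK.odd_classNumber_biquadratic t.hk t.hp t.hq t.hp4 t.hq4 t.hJ
  have hN1 : Algebra.norm ℚ (((normUnits F k w : (𝓞 F)ˣ) : 𝓞 F) : F) = -1 := by
    change Algebra.norm ℚ (Algebra.norm F ((w : 𝓞 k) : k)) = -1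
    rw [Algebra.norm_norm] at hw ⊢
    exact hw
  have hN2 : normUnits F k (inclUnits K k e) = -1 := by
    apply inclUnits_injective (L := k)
    rw [t.hkF.inclUnits_normUnits]
    apply Units.ext
    apply RingOfIntegers.ext
    have h1 := t.hK.algebraMap_norm ((e : 𝓞 K) : K)
    rw [he] at h1
    have h2 := congrArg (algebraMap K k) h1
    rw [map_mul, ← t.conj_algebraMap] at h2
    refine Eq.trans ?_ (h2.symm.trans ?_)
    · exact map_mul (algebraMap (𝓞 k) k) _ _
    · simp [coe_inclUnits]
  have hsq : ∀ v : (𝓞 F)ˣ, v ∈ (powMonoidHom 2 : (𝓞 F)ˣ →* (𝓞 F)ˣ).range →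
      Algebra.norm ℚ ((v : 𝓞 F) : F) = 1 := by
    rintro _ ⟨v, rfl⟩
    exact norm_units_sq v
  have htop : (normUnits F k).range = ⊤ := by
    refine Subgroup.eq_top_of_index_eq_four (S := (powMonoidHom 2 : (𝓞 F)ˣ →* (𝓞 F)ˣ).range)
      (x := -1) (y := normUnits F k w) ?_ ?_ ⟨_, hN2⟩ ⟨_, rfl⟩ ?_ ?_ ?_
    · rw [index_range_powMonoidHom_two (-1) (by simp) (fun a ha => units_eq_one_or_eq_neg_one ha)
        (fun a => units_sq_ne_neg_one a), finrank_units, t.hF.finrank_eq_two]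
      norm_num
    · rintro _ ⟨v, rfl⟩
      refine ⟨inclUnits F k v, ?_⟩
      apply inclUnits_injective (L := k)
      rw [t.hkF.inclUnits_normUnits]
      have : t.hkF.tauUnits (inclUnits F k v) = inclUnits F k v := by
        apply Units.ext
        rw [coe_tauUnits, coe_inclUnits, AlgEquiv.commutes]
      rw [this, powMonoidHom_apply, map_pow, pow_two]
    · rintro ⟨v, hv⟩
      exact units_sq_ne_neg_one v hv
    · intro h
      have := hsq _ h
      rw [hN1] at this
      norm_num at this
    · intro h
      have := hsq _ h
      rw [neg_one_mul, Units.val_neg] at this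
      have h3 : (((-(normUnits F k w : (𝓞 F)ˣ) : 𝓞 F)) : F) =
        algebraMap ℚ F (-1) * ((normUnits F k w : (𝓞 F)ˣ) : 𝓞 F) := by
        rw [map_neg, map_one, neg_one_mul]
        exact map_neg (algebraMap (𝓞 F) F) _
      rw [h3, map_mul, Algebra.norm_algebraMap, hN1, t.hF.finrank_eq_two] at this
      norm_num at this
  have := htop ▸ Subgroup.mem_top u
  exact this

theorem jacobiSym_neg (t : QuadraticTower K F k p q a d b) (m : ℤ) : J(-m | q) = J(m | q) := by
  rw [← neg_one_mul, jacobiSym.mul_left, jacobiSym_neg_one_of_mod_four t.hq4, one_mul]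

theorem neg_one_notMem (t : QuadraticTower K F k p q a d b) (γ : (𝓞 k)ˣ) :
    t.hkF.tauUnits γ ≠ -γ := by
  intro hγ
  have h1 : t.hkF.conj ((γ : 𝓞 k) : k) = -((γ : 𝓞 k) : k) := by
    have := congrArg (fun w : (𝓞 k)ˣ => ((w : 𝓞 k) : k)) hγ
    refine this.trans ?_
    rw [Units.val_neg]
    exact map_neg (algebraMap (𝓞 k) k) _
  obtain ⟨f, hf⟩ := t.hkF.exists_of_conj_eq_neg h1
  have h2 := norm_units_eq_or (normUnits F k γ)
  have h3 : Algebra.norm ℚ (((normUnits F k γ : (𝓞 F)ˣ) : 𝓞 F) : F) =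
      (p * Algebra.norm ℚ f) ^ 2 := by
    change Algebra.norm ℚ (Algebra.norm F ((γ : 𝓞 k) : k)) = _
    have h4 := t.hkF.norm_mk 0 f
    rw [map_zero, zero_add, ← hf] at h4
    rw [h4]
    have : (0 ^ 2 - (p : F) * f ^ 2) = algebraMap ℚ F (-p) * f ^ 2 := by
      simp
    rw [this, map_mul, map_pow, Algebra.norm_algebraMap, t.hF.finrank_eq_two]
    ring
  have h5 : (p * Algebra.norm ℚ f) ^ 2 = 1 := by
    rcases h2 with h2 | h2
    · rw [← h3, h2]
    · rw [h3] at h2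
      nlinarith [sq_nonneg (p * Algebra.norm ℚ f)]
  have h6 : Algebra.norm ℚ (algebraMap ℚ F p * f) = p * (p * Algebra.norm ℚ f) := by
    rw [map_mul, Algebra.norm_algebraMap, t.hF.finrank_eq_two]
    ring
  rcases mul_self_eq_one_iff.1 ((pow_two _).symm.trans h5) with h7 | h7
  · rw [h7, mul_one] at h6
    exact norm_ne_of_jacobiSym t.hF t.hp t.hq t.hpq (m := p) t.hJ _ (by rw [h6]; simp)
  · rw [h7] at h6
    exact norm_ne_of_jacobiSym t.hF t.hp t.hq t.hpq (m := -p) (by rw [t.jacobiSym_neg, t.hJ]) _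
      (by rw [h6]; simp)

theorem exists_div_tauUnits (t : QuadraticTower K F k p q a d b) {v : (𝓞 k)ˣ}
    (hv : v * t.hkF.tauUnits v = 1) :
    ∃ γ : (𝓞 k)ˣ, v * t.hkF.tauUnits γ = γ ∨ -v * t.hkF.tauUnits γ = γ := by
  have := t.hF.isTotallyReal
  have := t.hkF.isTotallyReal
  have h1 := (t.hkF.relIndex_units).1
  have htop : (normUnits F k).range = ⊤ := by
    rw [MonoidHom.range_eq_top]
    exact t.normUnits_surjective
  rw [htop, Subgroup.index_top, mul_one] at h1
  have hker : ∀ x : (𝓞 k)ˣ, x ∈ (normUnits F k).ker ↔ x * t.hkF.tauUnits x = 1 := by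
    intro x
    rw [MonoidHom.mem_ker, ← t.hkF.inclUnits_normUnits, ← (inclUnits_injective (K := F) (L := k)).eq_iff,
      map_one]
  have hmem : ∀ x : (𝓞 k)ˣ, x ∈ (MonoidHom.id _ / t.hkF.tauUnits).range ↔
      ∃ γ, x * t.hkF.tauUnits γ = γ := by
    intro x
    refine exists_congr fun γ => ?_
    rw [MonoidHom.div_apply, MonoidHom.id_apply, div_eq_iff_eq_mul, eq_comm]
  have hneg : (-1 : (𝓞 k)ˣ) ∈ (normUnits F k).ker := by
    rw [hker]
    apply Units.ext
    rw [Units.val_mul, coe_tauUnits]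
    simp
  have hn : (-1 : (𝓞 k)ˣ) ∉ (MonoidHom.id _ / t.hkF.tauUnits).range := by
    rw [hmem]
    rintro ⟨γ, hγ⟩
    apply t.neg_one_notMem γ
    rw [neg_one_mul] at hγ
    rw [← neg_eq_iff_eq_neg, hγ]
  rcases Subgroup.mem_or_mul_mem_of_relIndex_eq_two h1 hneg ((hker v).2 hv) hn with h | h
  · obtain ⟨γ, hγ⟩ := (hmem _).1 h
    exact ⟨γ, Or.inl hγ⟩
  · obtain ⟨γ, hγ⟩ := (hmem _).1 h
    exact ⟨γ, Or.inr (by rwa [neg_one_mul] at hγ)⟩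

end QuadraticTower

theorem jacobiSym_pow_odd {r q H : ℕ} (hJ : J(r | q) = -1) (hH : Odd H) :
    J(((r ^ H : ℕ) : ℤ) | q) = -1 := by
  rw [Nat.cast_pow, jacobiSym.pow_left, hJ, hH.neg_one_pow]

theorem IsSqrtExt.absNorm_map {K L : Type*} [Field K] [Field L] [NumberField K] [NumberField L]
    [Algebra K L] {a : K} {s : L} (h : IsSqrtExt K L a s) (I : Ideal (𝓞 K)) :
    Ideal.absNorm (I.map (algebraMap (𝓞 K) (𝓞 L))) = Ideal.absNorm I ^ 2 := by
  rw [← Ideal.absNorm_relNorm (𝓞 K) (𝓞 L), Ideal.relNorm_algebraMap, h.finrank_ringOfIntegers,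
    map_pow]

theorem IsSqrtExt.absNorm_span_algebraMap {K L : Type*} [Field K] [Field L] [NumberField K]
    [NumberField L] [Algebra K L] {a : K} {s : L} (h : IsSqrtExt K L a s) (x : 𝓞 K) :
    Ideal.absNorm (Ideal.span {algebraMap (𝓞 K) (𝓞 L) x}) = Ideal.absNorm (Ideal.span {x}) ^ 2 := by
  rw [← h.absNorm_map, Ideal.map_span, Set.image_singleton]

namespace QuadraticTower

open IsSqrtExt

variable {K F k : Type*} [Field K] [Field F] [Field k] [NumberField K]
    [NumberField F] [NumberField k] [Algebra K k] [Algebra F k] {p q : ℕ} {a : K} {d : F} {b : k}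

theorem finrank_k (t : QuadraticTower K F k p q a d b) : Module.finrank ℚ k = 4 := by
  rw [t.hk.finrank_rat, t.hK.finrank_eq_two]

theorem odd_classNumber (t : QuadraticTower K F k p q a d b) :
    Odd (Nat.card (ClassGroup (𝓞 k))) :=
  (t.hK.odd_classNumber_biquadratic t.hk t.hp t.hq t.hp4 t.hq4 t.hJ).2

theorem exists_norm_eq_neg_one (t : QuadraticTower K F k p q a d b) :
    ∃ w : (𝓞 k)ˣ, Algebra.norm ℚ (((normUnits F k w : (𝓞 F)ˣ) : 𝓞 F) : F) = -1 := by
  obtain ⟨⟨w, hw⟩, -⟩ := t.hK.odd_classNumber_biquadratic t.hk t.hp t.hq t.hp4 t.hq4 t.hJ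
  refine ⟨w, ?_⟩
  change Algebra.norm ℚ (Algebra.norm F ((w : 𝓞 k) : k)) = -1
  rw [Algebra.norm_norm] at hw ⊢
  exact hw

theorem exists_tau_eq_neg (t : QuadraticTower K F k p q a d b) {r : ℕ} (hr : r.Prime)
    (hJr : J(r | q) = -1) {I : Ideal (𝓞 k)} (hσ : I.map t.hkF.tau = I)
    (hN : Ideal.absNorm I = r ^ 2) :
    ∃ ρ : 𝓞 k, ρ ≠ 0 ∧ Ideal.span {ρ} = I ^ Nat.card (ClassGroup (𝓞 k)) ∧
      t.hkF.tau ρ = -ρ := by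
  have hI : I ≠ ⊥ := by
    rintro rfl
    rw [Ideal.absNorm_bot] at hN
    exact pow_ne_zero 2 hr.ne_zero hN.symm
  obtain ⟨ρ, hρ0, hρ⟩ := exists_span_singleton_eq_pow_card I hI
  set H := Nat.card (ClassGroup (𝓞 k)) with hH
  have hodd : Odd H := t.odd_classNumber
  have h1 : Ideal.span {t.hkF.tau ρ} = Ideal.span {ρ} := by
    rw [← t.hkF.map_tau_span_singleton, hρ]
    have := Ideal.map_pow (t.hkF.tau : 𝓞 k →+* 𝓞 k) I H
    rw [show I.map (t.hkF.tau : 𝓞 k →+* 𝓞 k) = I from hσ] at this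
    exact this
  obtain ⟨v, hv⟩ := (Ideal.span_singleton_eq_span_singleton.1 h1).symm
  have hv1 : v * t.hkF.tauUnits v = 1 := by
    apply Units.ext
    apply mul_left_cancel₀ hρ0
    have := congrArg t.hkF.tau hv
    rw [t.hkF.tau_tau, map_mul, ← hv] at this
    rw [Units.val_mul, coe_tauUnits, ← mul_assoc, this, Units.val_one, mul_one]
  obtain ⟨γ, hγ | hγ⟩ := t.exists_div_tauUnits hv1
  · exfalso
    have hfix : t.hkF.tau (ρ * γ) = ρ * γ := by
      rw [map_mul, ← hv, mul_assoc]
      congr 1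
      exact congrArg Units.val hγ
    obtain ⟨f, hf⟩ := t.hkF.exists_algebraMap_eq_of_tau_eq hfix
    have h2 := t.hkF.absNorm_span_algebraMap f
    rw [hf, Ideal.span_singleton_mul_right_unit γ.isUnit, hρ, map_pow, hN, ← pow_mul, mul_comm,
      pow_mul] at h2
    have h3 := Nat.pow_left_injective two_ne_zero h2
    have hJ := jacobiSym_pow_odd hJr hodd
    rcases norm_eq_or_eq_neg f with h4 | h4
    · exact norm_ne_of_jacobiSym t.hF t.hp t.hq t.hpq hJ (f : F) (by rw [h4, ← h3]; simp)
    · exact norm_ne_of_jacobiSym t.hF t.hp t.hq t.hpq (m := -((r ^ H : ℕ) : ℤ))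
        (by rw [t.jacobiSym_neg, hJ]) (f : F) (by rw [h4, ← h3]; simp)
  · refine ⟨ρ * γ, mul_ne_zero hρ0 γ.ne_zero, ?_, ?_⟩
    · rw [Ideal.span_singleton_mul_right_unit γ.isUnit, hρ]
    · rw [map_mul, ← hv, mul_assoc, ← mul_neg]
      congr 1
      have := congrArg Units.val hγ
      rw [Units.val_mul, Units.val_neg, neg_mul] at this
      exact neg_eq_iff_eq_neg.1 this

theorem exists_ternary (t : QuadraticTower K F k p q a d b) {r : ℕ} (hr : r.Prime)
    {I : Ideal (𝓞 k)} (hN : Ideal.absNorm I = r ^ 2) {ρ : 𝓞 k}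
    (hρ : Ideal.span {ρ} = I ^ Nat.card (ClassGroup (𝓞 k))) (hτ : t.hkF.tau ρ = -ρ) :
    ∃ x y z : ℤ, p * x ^ 2 - q * y ^ 2 = r * z ^ 2 ∧ z ≠ 0 := by
  obtain ⟨e, he, he2⟩ := exists_ringOfIntegers_eq_of_sq (s := algebraMap K k a) (m := p)
    (by rw [t.hkF.sq, map_natCast])
  have hτe : t.hkF.tau e = -e := by
    ext
    rw [coe_tau, he, t.hkF.conj_self, ← he]
    exact (map_neg (algebraMap (𝓞 k) k) e).symm
  obtain ⟨f, hf⟩ := t.hkF.exists_algebraMap_eq_of_tau_eq (x := ρ * e)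
    (by rw [map_mul, hτ, hτe, neg_mul_neg])
  have hNe : Ideal.absNorm (Ideal.span {e}) = p ^ 2 := by
    have := absNorm_span_sq he2
    rw [t.finrank_k, show 4 = 2 * 2 from rfl, pow_mul] at this
    exact Nat.pow_left_injective two_ne_zero this
  have h2 := t.hkF.absNorm_span_algebraMap f
  rw [hf, ← Ideal.span_singleton_mul_span_singleton, map_mul, hρ, hNe, map_pow, hN, ← pow_mul,
    mul_comm 2, pow_mul, ← mul_pow] at h2
  have h3 := Nat.pow_left_injective two_ne_zero h2
  obtain ⟨w, hw⟩ := t.exists_norm_eq_neg_one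
  rcases norm_eq_or_eq_neg f with h4 | h4
  · refine exists_ternary_form t.hF t.hp hr.ne_zero t.odd_classNumber (f := (f : F)) ?_
    rw [h4, ← h3]
    push_cast
    ring
  · refine exists_ternary_form t.hF t.hp hr.ne_zero t.odd_classNumber
      (f := (f : F) * ((normUnits F k w : (𝓞 F)ˣ) : 𝓞 F)) ?_
    rw [map_mul, h4, hw, ← h3]
    push_cast
    ring

end QuadraticTower

theorem intCast_pow_half {R : Type*} [CommRing R] {r : ℕ} (hr : r.Prime) [CharP R r] (N : ℤ) :
    (N : R) ^ (r / 2) = (J(N | r) : ℤ) := by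
  have := Fact.mk hr
  rw [← jacobiSym.legendreSym.to_jacobiSym]
  have := congrArg (ZMod.castHom (dvd_refl r) R) (legendreSym.eq_pow r N)
  rw [map_pow, map_intCast, map_intCast] at this
  exact this.symm

/-- The two primes of `k` above `r`, both stable under the conjugation of `k` over `F`. -/
structure PrimePair {K F k : Type*} [Field K] [Field F] [Field k] [NumberField K]
    [NumberField F] [NumberField k] [Algebra K k] [Algebra F k] {p q : ℕ} {a : K} {d : F} {b : k}
    (t : QuadraticTower K F k p q a d b) (r : ℕ) (P P' : Ideal (𝓞 k)) (n : ℤ) : Prop where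
  prime : P.IsPrime
  prime' : P'.IsPrime
  ne : P ≠ P'
  mem : (r : 𝓞 k) ∈ P
  mem' : (r : 𝓞 k) ∈ P'
  dvd : (r : ℤ) ∣ n ^ 2 - p * q
  sub_mem : ∀ δ : 𝓞 k, (δ : k) = algebraMap F k d → δ - n ∈ P
  absNorm : Ideal.absNorm P = r ^ 2
  absNorm' : Ideal.absNorm P' = r ^ 2
  map : P.map t.hkF.tau = P
  map' : P'.map t.hkF.tau = P'

namespace QuadraticTower

open IsSqrtExt

variable {K F k : Type*} [Field K] [Field F] [Field k] [NumberField K]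
    [NumberField F] [NumberField k] [Algebra K k] [Algebra F k] {p q : ℕ} {a : K} {d : F} {b : k}

theorem exists_primePair (t : QuadraticTower K F k p q a d b) {r : ℕ} (hr : r.Prime)
    (hr4 : r % 4 = 1) (hJp : J(p | r) = -1) (hJq : J(q | r) = -1) :
    ∃ P P' n, PrimePair t r P P' n := by
  have := Fact.mk hr
  obtain ⟨e, he, he2⟩ := exists_ringOfIntegers_eq_of_sq (s := algebraMap K k a) (m := p)
    (by rw [t.hkF.sq, map_natCast])
  obtain ⟨δ, hδ, hδ2⟩ := exists_ringOfIntegers_eq_of_sq (s := algebraMap F k d) (m := p * q)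
    (by rw [← map_pow, t.hF.sq, map_natCast, map_natCast])
  have hJ : J(((p * q : ℕ) : ℤ) | r) = 1 := by
    rw [Nat.cast_mul, jacobiSym.mul_left, hJp, hJq]; norm_num
  have hτ1 : t.hk.tau δ = -δ := by
    ext
    rw [coe_tau, hδ, t.hd, map_mul, AlgEquiv.commutes, t.hk.conj_self, mul_neg, ← t.hd, ← hδ]
    exact (map_neg (algebraMap (𝓞 k) k) δ).symm
  have hτ2 : t.hkF.tau δ = δ := by
    ext
    rw [coe_tau, hδ, AlgEquiv.commutes]
  have hspan : Ideal.absNorm (Ideal.span {(r : 𝓞 k)}) = r ^ 4 := by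
    rw [Ideal.absNorm_span_natCast, RingOfIntegers.rank, t.finrank_k]
  have hs0 : Ideal.span {(r : 𝓞 k)} ≠ ⊥ := by
    intro h
    rw [h, Ideal.absNorm_bot] at hspan
    exact pow_ne_zero 4 hr.ne_zero hspan.symm
  obtain ⟨n₀, hn₀⟩ := ZMod.isSquare_of_jacobiSym_eq_one hJ
  obtain ⟨n₁, rfl⟩ := ZMod.intCast_surjective n₀
  have hn₁ : (r : ℤ) ∣ n₁ ^ 2 - p * q := by
    rw [← ZMod.intCast_zmod_eq_zero_iff_dvd]
    push_cast at hn₀ ⊢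
    rw [hn₀]; ring
  have hmemdvd : ∀ (I : Ideal (𝓞 k)), (r : 𝓞 k) ∈ I → ∀ m : ℤ, (r : ℤ) ∣ m → (m : 𝓞 k) ∈ I := by
    rintro I hI _ ⟨c, rfl⟩
    push_cast
    exact I.mul_mem_right _ hI
  obtain ⟨P, hPmax, hPle⟩ := Ideal.exists_le_maximal (Ideal.span {(r : 𝓞 k)}) (by
    intro h
    rw [h, Ideal.absNorm_top] at hspan
    exact (Nat.one_lt_pow (by norm_num) hr.one_lt).ne hspan)
  have hPr : (r : 𝓞 k) ∈ P := hPle (Ideal.mem_span_singleton_self _)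
  obtain ⟨n, hn, hδn⟩ : ∃ n : ℤ, (r : ℤ) ∣ n ^ 2 - p * q ∧ δ - n ∈ P := by
    have h1 : (δ - n₁) * (δ + n₁) ∈ P := by
      have := hmemdvd P hPr _ (dvd_neg.2 hn₁)
      convert this using 1
      push_cast at hδ2 ⊢
      linear_combination hδ2
    rcases hPmax.isPrime.mem_or_mem h1 with h | h
    · exact ⟨n₁, hn₁, h⟩
    · refine ⟨-n₁, by rwa [neg_sq], ?_⟩
      push_cast
      rwa [sub_neg_eq_add]
  have hndvd : ¬ (r : ℤ) ∣ 2 * n := by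
    intro h
    have hr' := Nat.prime_iff_prime_int.1 hr
    rcases hr'.dvd_or_dvd h with h | h
    · have := Int.le_of_dvd (by norm_num) h
      have := hr.two_le
      omega
    · have h2 : (r : ℤ) ∣ ((p * q : ℕ) : ℤ) := by
        have := (dvd_pow h two_ne_zero).sub hn
        push_cast
        rwa [sub_sub_cancel] at this
      have h3 : J(((p * q : ℕ) : ℤ) | r) = 0 := by
        rw [← jacobiSym.legendreSym.to_jacobiSym, legendreSym.eq_zero_iff]
        exact (ZMod.intCast_zmod_eq_zero_iff_dvd _ _).2 h2
      rw [hJ] at h3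
      exact one_ne_zero h3
  set P' := P.map t.hk.tau with hP'
  have hP'prime : P'.IsPrime := Ideal.map_isPrime_of_equiv t.hk.tau
  have hP'r : (r : 𝓞 k) ∈ P' := by
    rw [hP', t.hk.mem_map_tau, map_natCast]
    exact hPr
  have hδn' : -δ - n ∈ P' := by
    rw [hP', t.hk.mem_map_tau, map_sub, map_neg, hτ1, neg_neg, map_intCast]
    exact hδn
  have hnot : ∀ I : Ideal (𝓞 k), I.IsPrime → (r : 𝓞 k) ∈ I → δ - n ∈ I → -δ - n ∈ I → False := by
    intro I hI hr' h1 h2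
    apply hndvd
    rw [← natCast_mem_iff hI.ne_top hr hr']
    have := I.neg_mem (I.add_mem h1 h2)
    convert this using 1
    push_cast
    ring
  have hne : P ≠ P' := fun h => hnot P hPmax.isPrime hPr hδn (h ▸ hδn')
  have h0 : ∀ I : Ideal (𝓞 k), (r : 𝓞 k) ∈ I → I ≠ ⊥ := by
    rintro I hI rfl
    exact hs0 (by simpa using hI)
  have hP'max := hP'prime.isMaximal (h0 P' hP'r)
  have hN := sq_le_absNorm hPmax.ne_top (h0 P hPr) hr hPr he2 hJp
  have hN' := sq_le_absNorm hP'max.ne_top (h0 P' hP'r) hr hP'r he2 hJp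
  have hle : Ideal.span {(r : 𝓞 k)} ≤ P * P' := by
    rw [Ideal.mul_eq_inf_of_isCoprime (Ideal.isCoprime_of_isMaximal hne),
      Ideal.span_singleton_le_iff_mem]
    exact ⟨hPr, hP'r⟩
  have hprod : Ideal.span {(r : 𝓞 k)} = P * P' := by
    apply eq_of_le_of_absNorm_le hle hs0
    rw [hspan, map_mul, show r ^ 4 = r ^ 2 * r ^ 2 by ring]
    exact Nat.mul_le_mul hN hN'
  have hNN : Ideal.absNorm P * Ideal.absNorm P' = r ^ 2 * r ^ 2 := by
    rw [← map_mul, ← hprod, hspan]; ring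
  have hr0 : 0 < r ^ 2 := pow_pos hr.pos 2
  have hcases : ∀ Q : Ideal (𝓞 k), Q.IsPrime → (r : 𝓞 k) ∈ Q → Q = P ∨ Q = P' := by
    intro Q hQ hQr
    have : P * P' ≤ Q := by
      rw [← hprod, Ideal.span_singleton_le_iff_mem]
      exact hQr
    rcases hQ.mul_le.1 this with h | h
    · exact Or.inl (hPmax.eq_of_le hQ.ne_top h).symm
    · exact Or.inr (hP'max.eq_of_le hQ.ne_top h).symm
  refine ⟨P, P', n, hPmax.isPrime, hP'prime, hne, hPr, hP'r, hn, ?_, ?_, ?_, ?_, ?_⟩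
  · intro δ' h
    rw [RingOfIntegers.ext (h.trans hδ.symm)]
    exact hδn
  · nlinarith
  · nlinarith
  · have hQ : (P.map t.hkF.tau).IsPrime := Ideal.map_isPrime_of_equiv t.hkF.tau
    have hQr : (r : 𝓞 k) ∈ P.map t.hkF.tau := by
      rw [t.hkF.mem_map_tau, map_natCast]
      exact hPr
    refine (hcases _ hQ hQr).resolve_right fun h => hnot _ hQ hQr ?_ (h ▸ hδn')
    rw [t.hkF.mem_map_tau, map_sub, hτ2, map_intCast]
    exact hδn
  · have hQ : (P'.map t.hkF.tau).IsPrime := Ideal.map_isPrime_of_equiv t.hkF.tau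
    have hQr : (r : 𝓞 k) ∈ P'.map t.hkF.tau := by
      rw [t.hkF.mem_map_tau, map_natCast]
      exact hP'r
    refine (hcases _ hQ hQr).resolve_left fun h => hnot _ hQ hQr (h ▸ hδn) ?_
    rw [t.hkF.mem_map_tau, map_sub, map_neg, hτ2, map_intCast]
    exact hδn'

end QuadraticTower

namespace PrimePair

open IsSqrtExt

variable {K F k : Type*} [Field K] [Field F] [Field k] [NumberField K]
    [NumberField F] [NumberField k] [Algebra K k] [Algebra F k] {p q : ℕ} {a : K} {d : F} {b : k}
    {t : QuadraticTower K F k p q a d b} {r : ℕ} {P P' : Ideal (𝓞 k)} {n : ℤ}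

theorem ne_bot (h : PrimePair t r P P' n) (hr : r.Prime) : P ≠ ⊥ := by
  intro h0
  have := h.absNorm
  rw [h0, Ideal.absNorm_bot] at this
  exact pow_ne_zero 2 hr.ne_zero this.symm

theorem ne_bot' (h : PrimePair t r P P' n) (hr : r.Prime) : P' ≠ ⊥ := by
  intro h0
  have := h.absNorm'
  rw [h0, Ideal.absNorm_bot] at this
  exact pow_ne_zero 2 hr.ne_zero this.symm

theorem charP (h : PrimePair t r P P' n) (hr : r.Prime) : CharP (𝓞 k ⧸ P) r := by
  have := h.prime
  rw [CharP.charP_iff_prime_eq_zero hr, ← map_natCast (Ideal.Quotient.mk P)]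
  exact Ideal.Quotient.eq_zero_iff_mem.2 h.mem

theorem mk_tau (h : PrimePair t r P P' n) (hr : r.Prime) (hr4 : r % 4 = 1)
    (hJp : J(p | r) = -1) (y : 𝓞 k) :
    Ideal.Quotient.mk P (t.hkF.tau y) = Ideal.Quotient.mk P y ^ r := by
  have := h.charP hr
  have := Fact.mk hr
  obtain ⟨e, he, he2⟩ := exists_ringOfIntegers_eq_of_sq (s := algebraMap K k a) (m := p)
    (by rw [t.hkF.sq, map_natCast])
  have hτe : t.hkF.tau e = -e := by
    ext
    rw [coe_tau, he, t.hkF.conj_self, ← he]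
    exact (map_neg (algebraMap (𝓞 k) k) e).symm
  obtain ⟨i, j, hij⟩ := exists_sub_mem h.prime.ne_top (h.ne_bot hr) hr h.mem he2 hJp h.absNorm y
  have h1 : t.hkF.tau y - (i + j * -e) ∈ P := by
    rw [← h.map, t.hkF.mem_map_tau]
    simpa [t.hkF.tau_tau, hτe] using hij
  rw [Ideal.Quotient.eq.2 hij, Ideal.Quotient.eq.2 h1]
  simp only [map_add, map_mul, map_natCast, map_neg]
  rw [add_pow_char, mul_pow]
  have hf : ∀ i : ℕ, (i : 𝓞 k ⧸ P) ^ r = i := fun i => map_natCast (frobenius (𝓞 k ⧸ P) r) i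
  have he3 : Ideal.Quotient.mk P e ^ r = -Ideal.Quotient.mk P e := by
    have h2 : r = 2 * (r / 2) + 1 := by omega
    have h3 := intCast_pow_half (R := 𝓞 k ⧸ P) hr p
    rw [hJp] at h3
    rw [h2, pow_succ, pow_mul, ← map_pow, he2, map_natCast]
    push_cast at h3
    rw [h3, neg_one_mul]
  rw [hf, hf, he3]

/-- The quadratic character modulo `P`, as given by the criterion of Euler. -/
noncomputable def chi (_ : PrimePair t r P P' n) : 𝓞 k →* 𝓞 k ⧸ P where
  toFun y := Ideal.Quotient.mk P (y * t.hkF.tau y) ^ (r / 2)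
  map_one' := by simp
  map_mul' x y := by
    rw [← mul_pow, ← map_mul, map_mul t.hkF.tau]
    congr 2
    ring

theorem chi_apply (h : PrimePair t r P P' n) (y : 𝓞 k) :
    h.chi y = Ideal.Quotient.mk P (y * t.hkF.tau y) ^ (r / 2) := rfl

theorem chi_eq_pow (h : PrimePair t r P P' n) (hr : r.Prime) (hr4 : r % 4 = 1)
    (hJp : J(p | r) = -1) (y : 𝓞 k) :
    h.chi y = Ideal.Quotient.mk P y ^ ((r + 1) * (r / 2)) := by
  rw [h.chi_apply, map_mul, h.mk_tau hr hr4 hJp, ← pow_succ', pow_mul]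

theorem chi_sq (h : PrimePair t r P P' n) (hr : r.Prime) (hr4 : r % 4 = 1)
    (hJp : J(p | r) = -1) {y : 𝓞 k} (hy : y ∉ P) : h.chi (y ^ 2) = 1 := by
  have hmax := h.prime.isMaximal (h.ne_bot hr)
  have hfin := finite_quotient (h.ne_bot hr)
  let _ := Ideal.Quotient.field P
  let _ := Fintype.ofFinite (𝓞 k ⧸ P)
  have hcard : Fintype.card (𝓞 k ⧸ P) = r ^ 2 := by
    rw [← h.absNorm, Ideal.absNorm_apply, Submodule.cardQuot_apply, Nat.card_eq_fintype_card]
  have h0 : Ideal.Quotient.mk P y ≠ 0 := fun h => hy (Ideal.Quotient.eq_zero_iff_mem.1 h)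
  have := FiniteField.pow_card_sub_one_eq_one _ h0
  rw [h.chi_eq_pow hr hr4 hJp, map_pow, ← pow_mul, ← this, hcard]
  congr 1
  obtain ⟨m, hm⟩ : ∃ m, r = 2 * m + 1 := ⟨r / 2, by omega⟩
  have : r / 2 = m := by omega
  rw [this, hm]
  have h5 : (2 * m + 1) ^ 2 = 2 * ((2 * m + 1 + 1) * m) + 1 := by ring
  omega

theorem chi_congr (h : PrimePair t r P P' n) (hr : r.Prime) (hr4 : r % 4 = 1)
    (hJp : J(p | r) = -1) {x y : 𝓞 k} (hxy : x - y ∈ P) : h.chi x = h.chi y := by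
  rw [h.chi_eq_pow hr hr4 hJp, h.chi_eq_pow hr hr4 hJp, Ideal.Quotient.eq.2 hxy]

theorem neg_one_ne_one (h : PrimePair t r P P' n) (hr : r.Prime) (hr4 : r % 4 = 1) :
    (-1 : 𝓞 k ⧸ P) ≠ 1 := by
  have := h.charP hr
  have := h.prime
  intro h1
  have h2 : ((2 : ℕ) : 𝓞 k ⧸ P) = 0 := by
    push_cast
    rw [← one_add_one_eq_two]
    nth_rw 1 [← h1]
    ring
  rw [CharP.cast_eq_zero_iff (𝓞 k ⧸ P) r] at h2
  have := Nat.le_of_dvd (by norm_num) h2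
  have := hr.two_le
  omega

theorem chi_of_tau_eq_neg (h : PrimePair t r P P' n) (hr : r.Prime) (hr4 : r % 4 = 1)
    (hJp : J(p | r) = -1) {ρ : 𝓞 k} (hρ : ρ ∉ P) (hτ : t.hkF.tau ρ = -ρ) : h.chi ρ = -1 := by
  have hmax := h.prime.isMaximal (h.ne_bot hr)
  let _ := Ideal.Quotient.field P
  have h0 : Ideal.Quotient.mk P ρ ≠ 0 := fun h => hρ (Ideal.Quotient.eq_zero_iff_mem.1 h)
  have h1 := h.mk_tau hr hr4 hJp ρ
  rw [hτ, map_neg] at h1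
  have h2 : Ideal.Quotient.mk P ρ ^ (r - 1) = -1 := by
    apply mul_right_cancel₀ h0
    rw [← pow_succ, Nat.sub_add_cancel hr.pos, ← h1, neg_one_mul]
  rw [h.chi_apply, hτ, mul_neg, map_neg, map_mul, ← pow_two]
  have h3 : Even (r / 2) := ⟨r / 4, by omega⟩
  rw [h3.neg_pow, ← pow_mul, ← h2]
  congr 1
  omega

variable (p q r) in
/-- The product of the three quartic symbols. -/
noncomputable def quartProd : ℤ :=
  quartSym (p * q) r * quartSym (q * r) p * quartSym (r * p) q

theorem mk_pow_of_norm_eq_neg_one (h : PrimePair t r P P' n) (hr : r.Prime) (hr4 : r % 4 = 1)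
    (hqr : q ≠ r) (hrp : r ≠ p)
    (hJp : J(p | r) = -1) (hJq : J(q | r) = -1) {x y z : ℤ}
    (hxyz : p * x ^ 2 - q * y ^ 2 = r * z ^ 2) (hz : z ≠ 0) {u : 𝓞 F}
    (hu : Algebra.norm ℚ (u : F) = -1) :
    Ideal.Quotient.mk P (algebraMap (𝓞 F) (𝓞 k) u) ^ (r / 2) = ((-quartProd p q r : ℤ) : 𝓞 k ⧸ P) := by
  have := h.charP hr
  obtain ⟨δ, hδ, hδ2⟩ := exists_ringOfIntegers_eq_of_sq (s := algebraMap F k d) (m := p * q)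
    (by rw [← map_pow, t.hF.sq, map_natCast, map_natCast])
  obtain ⟨S, T, h2u, hST⟩ := exists_two_mul_eq t.hF t.hp t.hq t.hpq hu
  have hrec := reciprocity t.hp t.hq hr t.hpq hqr hrp t.hp4 t.hq4 hr4 t.hJ hJp hJq hST h.dvd hxyz hz
  have h1 : (2 : 𝓞 k) * algebraMap (𝓞 F) (𝓞 k) u = S + T * δ := by
    ext
    have := congrArg (algebraMap F k) h2u
    rw [map_mul, map_add, map_mul, map_ofNat, map_intCast, map_intCast, ← hδ] at this
    refine Eq.trans ?_ (this.trans ?_)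
    · simp only [map_mul, map_ofNat]
      rfl
    · simp only [map_add, map_mul, map_intCast]
  have h2 : Ideal.Quotient.mk P (4 * algebraMap (𝓞 F) (𝓞 k) u) =
      ((2 * (S + T * n) : ℤ) : 𝓞 k ⧸ P) := by
    rw [← map_intCast (Ideal.Quotient.mk P), Ideal.Quotient.eq]
    have := P.mul_mem_left (2 * T : 𝓞 k) (h.sub_mem δ hδ)
    convert this using 1
    push_cast
    linear_combination 2 * h1
  have h3 := intCast_pow_half (R := 𝓞 k ⧸ P) hr (2 * (S + T * n))
  rw [hrec, ← h2, map_mul, mul_pow] at h3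
  have h4 : Ideal.Quotient.mk P (4 : 𝓞 k) ^ (r / 2) = 1 := by
    have := intCast_pow_half (R := 𝓞 k ⧸ P) hr (2 ^ 2)
    rw [jacobiSym.sq_one' (by
      have h5 : IsCoprime (2 : ℤ) r := by
        rw [← Nat.cast_ofNat, Nat.isCoprime_iff_coprime, Nat.coprime_two_left, Nat.odd_iff]
        omega
      exact Int.isCoprime_iff_gcd_eq_one.1 h5)] at this
    rw [map_ofNat]
    push_cast at this
    exact this
  rw [h4, one_mul] at h3
  exact h3

theorem chi_unit (h : PrimePair t r P P' n) (w : (𝓞 k)ˣ) :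
    h.chi w = Ideal.Quotient.mk P (algebraMap (𝓞 F) (𝓞 k) (normUnits F k w)) ^ (r / 2) := by
  rw [h.chi_apply, ← t.hkF.algebraMap_ringOfIntegersNorm]
  rfl

end PrimePair

/-- `P` is the ramified prime of the quadratic extension `L / K` over `𝔭`. -/
structure IsSqrtExt.RamifiedOver {K L : Type*} [Field K] [Field L] [NumberField K] [NumberField L]
    [Algebra K L] {a : K} {s : L} (h : IsSqrtExt K L a s) (𝔭 : Ideal (𝓞 K)) (P : Ideal (𝓞 L)) :
    Prop where
  prime : P.IsPrime
  ne_bot : P ≠ ⊥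
  under : P.under (𝓞 K) = 𝔭
  map : P.map h.tau = P
  ne_map : P ≠ 𝔭.map (algebraMap (𝓞 K) (𝓞 L))

namespace IsSqrtExt.RamifiedOver

variable {K L : Type*} [Field K] [Field L] [NumberField K] [NumberField L] [Algebra K L]
  {a : K} {s : L} {h : IsSqrtExt K L a s} {𝔭 : Ideal (𝓞 K)} {P : Ideal (𝓞 L)}

theorem algebraMap_mem (hP : h.RamifiedOver 𝔭 P) {x : 𝓞 K} :
    algebraMap (𝓞 K) (𝓞 L) x ∈ P ↔ x ∈ 𝔭 := by
  rw [← hP.under]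
  rfl

theorem mul_self (hP : h.RamifiedOver 𝔭 P) : P * P = 𝔭.map (algebraMap (𝓞 K) (𝓞 L)) := by
  rw [← hP.under]
  exact (h.sq_eq_of_map_tau_eq hP.prime hP.ne_bot hP.map (by rw [hP.under]; exact hP.ne_map)).1

theorem exists_sub_mem (hP : h.RamifiedOver 𝔭 P) (x : 𝓞 L) :
    ∃ y : 𝓞 K, x - algebraMap (𝓞 K) (𝓞 L) y ∈ P :=
  (h.sub_tau_mem hP.prime hP.ne_bot hP.map (by rw [hP.under]; exact hP.ne_map) x).1

theorem sub_tau_mem (hP : h.RamifiedOver 𝔭 P) (x : 𝓞 L) : x - h.tau x ∈ P :=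
  (h.sub_tau_mem hP.prime hP.ne_bot hP.map (by rw [hP.under]; exact hP.ne_map) x).2

/-- A norm is a square modulo a ramified prime. -/
theorem exists_sq_sub_mem (hP : h.RamifiedOver 𝔭 P) {x : 𝓞 L} (hx : x ∉ P) :
    ∃ y : 𝓞 K, y ∉ 𝔭 ∧ x * h.tau x - algebraMap (𝓞 K) (𝓞 L) (y ^ 2) ∈ P := by
  obtain ⟨y, hy⟩ := hP.exists_sub_mem x
  refine ⟨y, fun hy' => hx ?_, ?_⟩
  · have := P.add_mem hy (hP.algebraMap_mem.2 hy')
    rwa [sub_add_cancel] at this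
  · have h1 := P.mul_mem_left (x + algebraMap (𝓞 K) (𝓞 L) y) hy
    have h2 := P.mul_mem_left x (hP.sub_tau_mem x)
    convert P.sub_mem h1 h2 using 1
    rw [map_pow]
    ring

/-- A unit which is a norm from `L` is a square modulo a ramified prime. -/
theorem exists_mul_sq_sub_sq_mem (hP : h.RamifiedOver 𝔭 P) {v : (𝓞 K)ˣ} {α : L}
    (hv : algebraMap K L ((v : 𝓞 K) : K) = α * h.conj α) :
    ∃ y z : 𝓞 K, y ∉ 𝔭 ∧ z ∉ 𝔭 ∧ v * z ^ 2 - y ^ 2 ∈ 𝔭 := by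
  have hP' := hP.prime
  have hv' : algebraMap K L ((v : 𝓞 K) : K) = ((algebraMap (𝓞 K) (𝓞 L) v : 𝓞 L) : L) := rfl
  have key : ∀ (v : (𝓞 K)ˣ) (m d : 𝓞 L), algebraMap (𝓞 K) (𝓞 L) v * (m * h.tau m) = d * h.tau d → d ∉ P →
      ∃ y z : 𝓞 K, y ∉ 𝔭 ∧ z ∉ 𝔭 ∧ v * z ^ 2 - y ^ 2 ∈ 𝔭 := by
    intro v m d hmd hd
    have hm : m ∉ P := by
      intro hm
      have h1 : d * h.tau d ∈ P := by
        rw [← hmd]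
        exact P.mul_mem_left _ (P.mul_mem_right _ hm)
      rcases hP'.mem_or_mem h1 with h2 | h2
      · exact hd h2
      · rw [← h.mem_map_tau, hP.map] at h2
        exact hd h2
    obtain ⟨z, hz, hzm⟩ := hP.exists_sq_sub_mem hm
    obtain ⟨y, hy, hyd⟩ := hP.exists_sq_sub_mem hd
    refine ⟨y, z, hy, hz, hP.algebraMap_mem.1 ?_⟩
    convert P.sub_mem hyd (P.mul_mem_left (algebraMap (𝓞 K) (𝓞 L) v) hzm) using 1
    rw [map_sub, map_mul]
    linear_combination hmd
  obtain ⟨m, ⟨d, hd⟩, hmd⟩ := IsDedekindDomain.HeightOneSpectrum.exists_primeCompl_mul_eq_or_mul_eq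
    (K := L) ⟨P, hP', hP.ne_bot⟩ α
  have hd' : d ∉ P := hd
  have hconj : ∀ x : 𝓞 L, h.conj (algebraMap (𝓞 L) L x) = algebraMap (𝓞 L) L (h.tau x) :=
    fun x => (h.coe_tau x).symm
  have hinv : algebraMap (𝓞 K) (𝓞 L) (v⁻¹ : (𝓞 K)ˣ) * algebraMap (𝓞 K) (𝓞 L) v = 1 := by
    rw [← map_mul, Units.inv_mul, map_one]
  rw [hv'] at hv
  change algebraMap (𝓞 L) L _ = _ at hv
  rcases hmd with hmd | hmd
  · have h2 := congrArg h.conj hmd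
    rw [map_mul, hconj, hconj] at h2
    have h3 : algebraMap (𝓞 K) (𝓞 L) v * (d * h.tau d) = m * h.tau m := by
      apply FaithfulSMul.algebraMap_injective (𝓞 L) L
      rw [map_mul, map_mul, map_mul, ← h2, ← hmd, hv]
      ring
    obtain ⟨y, z, hy, hz, hyz⟩ := key v⁻¹ m d (by rw [← h3, ← mul_assoc, hinv, one_mul]) hd'
    refine ⟨z, y, hz, hy, ?_⟩
    convert 𝔭.mul_mem_left (-v : 𝓞 K) hyz using 1
    linear_combination z ^ 2 * v.mul_inv
  · have h2 := congrArg h.conj hmd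
    rw [map_mul, hconj, hconj] at h2
    refine key v m d ?_ hd'
    apply FaithfulSMul.algebraMap_injective (𝓞 L) L
    rw [map_mul, map_mul, map_mul, ← h2, ← hmd, hv]
    ring

end IsSqrtExt.RamifiedOver

namespace PrimePair

open IsSqrtExt

variable {K F k L : Type*} [Field K] [Field F] [Field k] [Field L] [NumberField K]
    [NumberField F] [NumberField k] [NumberField L] [Algebra K k] [Algebra F k] [Algebra k L]
    {p q : ℕ} {a : K} {d : F} {b : k} {c : L}
    {t : QuadraticTower K F k p q a d b} {r : ℕ} {𝔭 𝔭' : Ideal (𝓞 k)} {n : ℤ}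

/-- The two ramified primes of `L / k`. -/
theorem exists_ramifiedOver (h : PrimePair t r 𝔭 𝔭' n) (hr : r.Prime)
    (hJp : J(p | r) = -1) (hL : IsSqrtExt k L (r : k) c) :
    ∃ P P' : Ideal (𝓞 L), hL.RamifiedOver 𝔭 P ∧ hL.RamifiedOver 𝔭' P' ∧ P ≠ P' ∧
      ∀ Q : Ideal (𝓞 L), Q.IsPrime → ∀ x ∈ Q, (x : L) = c → Q = P ∨ Q = P' := by
  obtain ⟨x, hx, hx2⟩ := exists_ringOfIntegers_eq_of_sq (s := c) (m := r)
    (by rw [hL.sq, map_natCast])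
  obtain ⟨e, he, he2⟩ := exists_ringOfIntegers_eq_of_sq
    (s := algebraMap k L (algebraMap K k a)) (m := p)
    (by rw [← map_pow, t.hkF.sq, map_natCast, map_natCast])
  have hx0 : x ≠ 0 := by
    rintro rfl
    rw [zero_pow two_ne_zero, eq_comm, Nat.cast_eq_zero] at hx2
    exact hr.ne_zero hx2
  have key : ∀ 𝔮 : Ideal (𝓞 k), 𝔮.IsPrime → 𝔮 ≠ ⊥ → (r : 𝓞 k) ∈ 𝔮 →
      ∃ Q : Ideal (𝓞 L), Q.IsPrime ∧ Q ≠ ⊥ ∧ Q.under (𝓞 k) = 𝔮 ∧ x ∈ Q ∧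
        r ^ 2 ≤ Ideal.absNorm Q := by
    intro 𝔮 h𝔮 h0 hmem
    have := h𝔮.isMaximal h0
    obtain ⟨Q, hQm, hQ⟩ := Ideal.exists_maximal_ideal_liesOver_of_isIntegral (S := 𝓞 L) 𝔮
    have hrQ : (r : 𝓞 L) ∈ Q := by
      rw [hQ.over] at hmem
      simpa using hmem
    have hxQ : x ∈ Q := hQm.isPrime.mem_of_pow_mem 2 (hx2 ▸ hrQ)
    have hQ0 : Q ≠ ⊥ := by
      rintro rfl
      exact hx0 hxQ
    exact ⟨Q, hQm.isPrime, hQ0, hQ.over.symm, hxQ,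
      sq_le_absNorm hQm.ne_top hQ0 hr hrQ he2 hJp⟩
  obtain ⟨P, hP, hP0, hPu, hxP, hPN⟩ := key 𝔭 h.prime (h.ne_bot hr) h.mem
  obtain ⟨P', hP', hP0', hPu', hxP', hPN'⟩ := key 𝔭' h.prime' (h.ne_bot' hr) h.mem'
  have hPm := hP.isMaximal hP0
  have hPm' := hP'.isMaximal hP0'
  have hne : P ≠ P' := by
    rintro rfl
    exact h.ne (hPu.symm.trans hPu')
  have hle : Ideal.span {x} ≤ P * P' := by
    rw [Ideal.mul_eq_inf_of_isCoprime (Ideal.isCoprime_of_isMaximal hne),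
      Ideal.span_singleton_le_iff_mem]
    exact ⟨hxP, hxP'⟩
  have hN : Ideal.absNorm (Ideal.span {x}) = r ^ 4 := by
    have := absNorm_span_sq hx2
    rw [hL.finrank_rat, t.finrank_k] at this
    apply Nat.pow_left_injective (n := 2) two_ne_zero
    simp only
    rw [this]
    ring
  have hle2 : r ^ 2 * r ^ 2 ≤ Ideal.absNorm P * Ideal.absNorm P' := Nat.mul_le_mul hPN hPN'
  have heq : Ideal.span {x} = P * P' := by
    refine eq_of_le_of_absNorm_le hle ?_ ?_
    · simpa using hx0
    · rw [hN, map_mul]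
      linarith [pow_add r 2 2]
  have hprod : Ideal.absNorm P * Ideal.absNorm P' = r ^ 4 := by rw [← map_mul, ← heq, hN]
  have hcontra : ∀ N : ℕ, r ^ 2 ≤ N → (r ^ 2) ^ 2 * N ≠ r ^ 4 := by
    intro N hN h1
    rw [← pow_mul, Nat.mul_eq_left (pow_ne_zero _ hr.ne_zero)] at h1
    have := Nat.one_lt_pow two_ne_zero hr.one_lt
    omega
  have hmem : ∀ Q : Ideal (𝓞 L), Q.IsPrime → x ∈ Q → Q = P ∨ Q = P' := by
    intro Q hQ hxQ
    have : P * P' ≤ Q := by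
      rw [← heq, Ideal.span_singleton_le_iff_mem]
      exact hxQ
    rcases hQ.mul_le.1 this with h1 | h1
    · exact Or.inl (hPm.eq_of_le hQ.ne_top h1).symm
    · exact Or.inr (hPm'.eq_of_le hQ.ne_top h1).symm
  have hτ : hL.tau x = -x := by
    ext
    rw [coe_tau, hx, hL.conj_self, ← hx]
    exact (map_neg (algebraMap (𝓞 L) L) x).symm
  have hτmem : ∀ Q : Ideal (𝓞 L), x ∈ Q → x ∈ Q.map hL.tau := by
    intro Q hQ
    rw [hL.mem_map_tau, hτ]
    exact Q.neg_mem hQ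
  refine ⟨P, P', ⟨hP, hP0, hPu, ?_, ?_⟩, ⟨hP', hP0', hPu', ?_, ?_⟩, hne, ?_⟩
  · rcases hmem _ (Ideal.map_isPrime_of_equiv hL.tau) (hτmem P hxP) with h1 | h1
    · exact h1
    · have := hL.map_tau_under P
      rw [h1, hPu, hPu'] at this
      exact absurd this.symm h.ne
  · intro h1
    have := congrArg Ideal.absNorm h1
    rw [hL.absNorm_map, h.absNorm] at this
    exact hcontra _ hPN' (this ▸ hprod)
  · rcases hmem _ (Ideal.map_isPrime_of_equiv hL.tau) (hτmem P' hxP') with h1 | h1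
    · have := hL.map_tau_under P'
      rw [h1, hPu, hPu'] at this
      exact absurd this h.ne
    · exact h1
  · intro h1
    have := congrArg Ideal.absNorm h1
    rw [hL.absNorm_map, h.absNorm'] at this
    exact hcontra _ hPN (by rw [mul_comm, ← this, hprod])
  · intro Q hQ y hy hyc
    obtain rfl : y = x := RingOfIntegers.ext (hyc.trans hx.symm)
    exact hmem Q hQ hy

end PrimePair

theorem quartSym_eq_or (m : ℤ) (l : ℕ) : quartSym m l = 1 ∨ quartSym m l = -1 := by
  rw [quartSym]
  split_ifs <;> simp

namespace PrimePair

open IsSqrtExt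

theorem quartProd_eq_or (p q r : ℕ) : quartProd p q r = 1 ∨ quartProd p q r = -1 := by
  rw [quartProd]
  rcases quartSym_eq_or (p * q) r with h1 | h1 <;> rcases quartSym_eq_or (q * r) p with h2 | h2 <;>
    rcases quartSym_eq_or (r * p) q with h3 | h3 <;> simp [h1, h2, h3]

variable {K F k L : Type*} [Field K] [Field F] [Field k] [Field L] [NumberField K]
    [NumberField F] [NumberField k] [NumberField L] [Algebra K k] [Algebra F k] [Algebra k L]
    {p q : ℕ} {a : K} {d : F} {b : k} {c : L}
    {t : QuadraticTower K F k p q a d b} {r : ℕ} {𝔭 𝔭' : Ideal (𝓞 k)} {n : ℤ}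

theorem chi_unit_of_norm_eq_neg_one (h : PrimePair t r 𝔭 𝔭' n) (hr : r.Prime) (hr4 : r % 4 = 1)
    (hqr : q ≠ r) (hrp : r ≠ p) (hJp : J(p | r) = -1) (hJq : J(q | r) = -1)
    (hJr : J(r | q) = -1) {w : (𝓞 k)ˣ}
    (hw : Algebra.norm ℚ (((normUnits F k w : (𝓞 F)ˣ) : 𝓞 F) : F) = -1) :
    h.chi w = ((-quartProd p q r : ℤ) : 𝓞 k ⧸ 𝔭) := by
  obtain ⟨ρ, -, hρ, hτ⟩ := t.exists_tau_eq_neg hr hJr h.map' h.absNorm'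
  obtain ⟨x, y, z, hxyz, hz⟩ := t.exists_ternary hr h.absNorm' hρ hτ
  rw [h.chi_unit, h.mk_pow_of_norm_eq_neg_one hr hr4 hqr hrp hJp hJq hxyz hz hw]

theorem chi_unit_eq_one (h : PrimePair t r 𝔭 𝔭' n) (hr : r.Prime) (hr4 : r % 4 = 1)
    (hqr : q ≠ r) (hrp : r ≠ p) (hJp : J(p | r) = -1) (hJq : J(q | r) = -1)
    (hJr : J(r | q) = -1) (hQ : quartProd p q r = -1) (w : (𝓞 k)ˣ) : h.chi w = 1 := by
  have key : ∀ w : (𝓞 k)ˣ,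
      Algebra.norm ℚ (((normUnits F k w : (𝓞 F)ˣ) : 𝓞 F) : F) = -1 → h.chi w = 1 := by
    intro w hw
    rw [h.chi_unit_of_norm_eq_neg_one hr hr4 hqr hrp hJp hJq hJr hw, hQ]
    simp
  rcases norm_units_eq_or (normUnits F k w) with hw | hw
  · obtain ⟨w₀, hw₀⟩ := t.exists_norm_eq_neg_one
    have h1 : Algebra.norm ℚ (((normUnits F k (w * w₀) : (𝓞 F)ˣ) : 𝓞 F) : F) = -1 := by
      rw [map_mul, Units.val_mul, ← one_mul (-1 : ℚ), ← hw₀, ← hw, ← map_mul]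
      exact congrArg _ (map_mul (algebraMap (𝓞 F) F) _ _)
    have h2 := key _ h1
    rwa [Units.val_mul, map_mul, key _ hw₀, mul_one] at h2
  · exact key w hw

/-- The units of `k` which are squares modulo `𝔭`. -/
noncomputable def squareUnits (h : PrimePair t r 𝔭 𝔭' n) : Subgroup (𝓞 k)ˣ :=
  (Units.map h.chi).ker

theorem mem_squareUnits (h : PrimePair t r 𝔭 𝔭' n) {v : (𝓞 k)ˣ} :
    v ∈ h.squareUnits ↔ h.chi v = 1 := by
  rw [squareUnits, MonoidHom.mem_ker, Units.ext_iff]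
  rfl

theorem two_le_index_squareUnits (h : PrimePair t r 𝔭 𝔭' n) (hr : r.Prime) {v : (𝓞 k)ˣ}
    (hv : h.chi v ≠ 1) : 2 ≤ h.squareUnits.index := by
  have hfin := finite_quotient (h.ne_bot hr)
  have h0 : h.squareUnits.index ≠ 0 := by
    rw [squareUnits, Subgroup.index_ker]
    exact Nat.card_pos.ne'
  have h1 : h.squareUnits.index ≠ 1 := by
    intro h1
    rw [Subgroup.index_eq_one] at h1
    exact hv (h.mem_squareUnits.1 (h1 ▸ Subgroup.mem_top v))
  omega

theorem chi_eq_one_of_mul_conj (h : PrimePair t r 𝔭 𝔭' n) (hr : r.Prime) (hr4 : r % 4 = 1)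
    (hJp : J(p | r) = -1) {hL : IsSqrtExt k L (r : k) c} {P : Ideal (𝓞 L)}
    (hP : hL.RamifiedOver 𝔭 P) {v : (𝓞 k)ˣ} {α : L}
    (hv : algebraMap k L ((v : 𝓞 k) : k) = α * hL.conj α) : h.chi v = 1 := by
  obtain ⟨y, z, hy, hz, hyz⟩ := hP.exists_mul_sq_sub_sq_mem hv
  have := h.chi_congr hr hr4 hJp hyz
  rwa [map_mul, h.chi_sq hr hr4 hJp hy, h.chi_sq hr hr4 hJp hz, mul_one] at this

theorem odd_classNumber (h : PrimePair t r 𝔭 𝔭' n) (hr : r.Prime) (hr4 : r % 4 = 1)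
    (hqr : q ≠ r) (hrp : r ≠ p) (hJp : J(p | r) = -1) (hJq : J(q | r) = -1)
    (hJr : J(r | q) = -1) (hL : IsSqrtExt k L (r : k) c) (hQ : quartProd p q r = 1) :
    Odd (Nat.card (ClassGroup (𝓞 L))) := by
  classical
  have hKr : IsTotallyReal K := t.hK.isTotallyReal
  have hkr : IsTotallyReal k := t.hk.isTotallyReal
  have hLr : IsTotallyReal L := hL.isTotallyReal
  obtain ⟨P, P', hP, hP', hne, hPP'⟩ := h.exists_ramifiedOver hr hJp hL
  obtain ⟨x, hx, hx2⟩ := exists_ringOfIntegers_eq_of_sq (s := c) (m := r)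
    (by rw [hL.sq, map_natCast])
  obtain ⟨w, hw⟩ := t.exists_norm_eq_neg_one
  have hχw : h.chi w ≠ 1 := by
    rw [h.chi_unit_of_norm_eq_neg_one hr hr4 hqr hrp hJp hJq hJr hw, hQ]
    simpa using h.neg_one_ne_one hr hr4
  refine (hL.odd_classNumber t.odd_classNumber (ι := Bool × Bool)
    (fun i => (if i.1 then P else ⊤) * (if i.2 then P' else ⊤)) ⟨(false, false), by simp⟩ ?_
    h.squareUnits ?_ ?_).2
  · intro Q hQ hQ0 _ hτ i
    obtain ⟨i, j⟩ := i
    rcases hPP' Q hQ x (hL.mem_of_sub_tau_mem hx (Or.inr hr4) hQ hτ) hx with rfl | rfl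
    · cases i
      · exact ⟨(true, j), ⊤, by simp [Ideal.map_top]⟩
      · exact ⟨(false, j), 𝔭, by simp [← hP.mul_self, mul_assoc]⟩
    · cases j
      · exact ⟨(i, true), ⊤, by simp [Ideal.map_top, mul_comm]⟩
      · refine ⟨(i, false), 𝔭', ?_⟩
        simp only [← hP'.mul_self, if_true, Bool.false_eq_true, if_false, Ideal.mul_top]
        ring
  · intro v α hv
    rw [h.mem_squareUnits]
    exact h.chi_eq_one_of_mul_conj hr hr4 hJp hP hv
  · have := h.two_le_index_squareUnits hr hχw
    simp
    omega

theorem even_classNumber (h : PrimePair t r 𝔭 𝔭' n) (hr : r.Prime) (hr4 : r % 4 = 1)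
    (hqr : q ≠ r) (hrp : r ≠ p) (hJp : J(p | r) = -1) (hJq : J(q | r) = -1)
    (hJr : J(r | q) = -1) (hL : IsSqrtExt k L (r : k) c) (hQ : quartProd p q r = -1) :
    Even (Nat.card (ClassGroup (𝓞 L))) := by
  by_contra hodd
  rw [Nat.not_even_iff_odd] at hodd
  obtain ⟨P, P', hP, hP', hne, -⟩ := h.exists_ramifiedOver hr hJp hL
  obtain ⟨ρ, hρ0, hρ, hτ⟩ := t.exists_tau_eq_neg hr hJr h.map' h.absNorm'
  obtain ⟨π, hπ0, hπ⟩ := exists_span_singleton_eq_pow_card P' hP'.ne_bot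
  set H := Nat.card (ClassGroup (𝓞 k)) with hH
  set m := Nat.card (ClassGroup (𝓞 L)) with hm
  have hpp := h.prime
  have hPp := hP.prime
  have hρP : ρ ∉ 𝔭 := by
    intro hmem
    rw [← Ideal.span_singleton_le_iff_mem, hρ] at hmem
    have := Ideal.IsPrime.le_of_pow_le hmem
    have h1 := (h.prime'.isMaximal (h.ne_bot' hr)).eq_of_le hpp.ne_top this
    exact h.ne h1.symm
  have hπP : π ∉ P := by
    intro hmem
    rw [← Ideal.span_singleton_le_iff_mem, hπ] at hmem
    have := Ideal.IsPrime.le_of_pow_le hmem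
    have h1 := (hP'.prime.isMaximal hP'.ne_bot).eq_of_le hPp.ne_top this
    exact hne h1.symm
  obtain ⟨y, hy, hyπ⟩ := hP.exists_sq_sub_mem hπP
  set ρ₀ : 𝓞 k := RingOfIntegers.norm k π
  have hρ₀ : algebraMap (𝓞 k) (𝓞 L) ρ₀ = π * hL.tau π := hL.algebraMap_ringOfIntegersNorm π
  have hχ₀ : h.chi ρ₀ = 1 := by
    rw [← hρ₀, ← map_sub, hP.algebraMap_mem] at hyπ
    rw [h.chi_congr hr hr4 hJp hyπ, h.chi_sq hr hr4 hJp hy]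
  have hχ : h.chi ρ = -1 := h.chi_of_tau_eq_neg hr hr4 hJp hρP hτ
  have hspan : Ideal.span {algebraMap (𝓞 k) (𝓞 L) (ρ₀ ^ H)} =
      Ideal.span {algebraMap (𝓞 k) (𝓞 L) (ρ ^ m)} := by
    have h1 : (P' ^ m).map hL.tau = P' ^ m := by
      have := Ideal.map_pow (hL.tau : 𝓞 L →+* 𝓞 L) P' m
      rw [show P'.map (hL.tau : 𝓞 L →+* 𝓞 L) = P' from hP'.map] at this
      exact this
    have h2 : Ideal.span {algebraMap (𝓞 k) (𝓞 L) ρ} = (P' * P') ^ H := by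
      rw [hP'.mul_self, ← Ideal.map_pow, ← hρ, Ideal.map_span, Set.image_singleton]
    rw [map_pow, map_pow, ← Ideal.span_singleton_pow, ← Ideal.span_singleton_pow, h2, hρ₀,
      ← Ideal.span_singleton_mul_span_singleton, ← hL.map_tau_span_singleton, hπ, h1, ← mul_pow,
      ← pow_mul, ← pow_mul, mul_comm m]
  obtain ⟨w, hw⟩ := Ideal.span_singleton_eq_span_singleton.1 hspan
  have hρ₀0 : algebraMap (𝓞 k) (𝓞 L) (ρ₀ ^ H) ≠ 0 := by
    rw [map_pow, hρ₀]
    exact pow_ne_zero _ (mul_ne_zero hπ0 (by simpa using hπ0))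
  have hτw : hL.tauUnits w = w := by
    apply Units.ext
    apply mul_left_cancel₀ hρ₀0
    rw [hw, coe_tauUnits]
    have := congrArg hL.tau hw
    rwa [map_mul, hL.tau.commutes, hL.tau.commutes] at this
  obtain ⟨v, rfl⟩ := hL.exists_inclUnits_eq_of_tauUnits_eq hτw
  rw [coe_inclUnits, ← map_mul] at hw
  have := congrArg h.chi (RingOfIntegers.algebraMap.injective k L hw)
  rw [map_mul, map_pow, map_pow, hχ₀, hχ, one_pow, one_mul, hodd.neg_one_pow,
    h.chi_unit_eq_one hr hr4 hqr hrp hJp hJq hJr hQ] at this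
  exact h.neg_one_ne_one hr hr4 this.symm

end PrimePair

theorem QuadraticTower.even_classNumber_iff {K F k L : Type*} [Field K] [Field F] [Field k]
    [Field L] [NumberField K] [NumberField F] [NumberField k] [NumberField L] [Algebra K k]
    [Algebra F k] [Algebra k L] {p q r : ℕ} {a : K} {d : F} {b : k} {c : L}
    (t : QuadraticTower K F k p q a d b) (hr : r.Prime) (hr4 : r % 4 = 1)
    (hqr : q ≠ r) (hrp : r ≠ p) (hJp : J(p | r) = -1) (hJq : J(q | r) = -1)
    (hJr : J(r | q) = -1) (hL : IsSqrtExt k L (r : k) c) :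
    Even (Nat.card (ClassGroup (𝓞 L))) ↔ PrimePair.quartProd p q r = -1 := by
  obtain ⟨P, P', n, h⟩ := t.exists_primePair hr hr4 hJp hJq
  refine ⟨fun heven => ?_, h.even_classNumber hr hr4 hqr hrp hJp hJq hJr hL⟩
  refine (PrimePair.quartProd_eq_or p q r).resolve_left fun hQ => ?_
  exact Nat.not_odd_iff_even.2 heven (h.odd_classNumber hr hr4 hqr hrp hJp hJq hJr hL hQ)

theorem isSqrtExt_adjoin {A : Type*} [Field A] [Algebra A ℝ] {S : Set ℝ}
    [Algebra A (IntermediateField.adjoin ℚ S)] [IsScalarTower A (IntermediateField.adjoin ℚ S) ℝ]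
    (hS : ∀ x ∈ S, IsAlgebraic ℚ x) {m : ℕ} {s : IntermediateField.adjoin ℚ S}
    (hs : (s : ℝ) ^ 2 = m)
    (hgen : ∀ x ∈ S, ∃ u v : A, x = algebraMap A ℝ u + algebraMap A ℝ v * s)
    (hm : ¬ IsSquare (m : A)) : IsSqrtExt A (IntermediateField.adjoin ℚ S) (m : A) s := by
  have hcoe (u : A) : algebraMap A ℝ u =
      ((algebraMap A (IntermediateField.adjoin ℚ S) u : IntermediateField.adjoin ℚ S) : ℝ) :=
    IsScalarTower.algebraMap_apply A (IntermediateField.adjoin ℚ S) ℝ u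
  have key : ∀ x ∈ Algebra.adjoin ℚ S, ∃ u v : A, x = algebraMap A ℝ u + algebraMap A ℝ v * s := by
    intro x hx
    induction hx using Algebra.adjoin_induction with
    | mem x hx => exact hgen x hx
    | algebraMap t =>
      have : CharZero A := (algebraMap A ℝ).charZero
      exact ⟨(t : A), 0, by simp⟩
    | add x y _ _ hx hy =>
      obtain ⟨u, v, rfl⟩ := hx
      obtain ⟨u', v', rfl⟩ := hy
      refine ⟨u + u', v + v', ?_⟩
      rw [map_add, map_add]
      ring
    | mul x y _ _ hx hy =>
      obtain ⟨u, v, rfl⟩ := hx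
      obtain ⟨u', v', rfl⟩ := hy
      refine ⟨u * u' + v * v' * m, u * v' + v * u', ?_⟩
      simp only [map_add, map_mul, map_natCast]
      linear_combination algebraMap A ℝ v * algebraMap A ℝ v' * hs
  refine ⟨Subtype.ext ?_, fun x => ?_, hm⟩
  · rw [map_natCast]
    push_cast
    exact hs
  · obtain ⟨u, v, huv⟩ := key x (by
      rw [← IntermediateField.adjoin_toSubalgebra_of_isAlgebraic hS]
      exact x.2)
    refine ⟨u, v, Subtype.ext ?_⟩
    push_cast
    rw [huv, hcoe, hcoe]

theorem isIntegral_sqrt_natCast (m : ℕ) : IsIntegral ℚ (√(m : ℝ)) := by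
  refine IsIntegral.of_pow two_pos ?_
  rw [Real.sq_sqrt m.cast_nonneg]
  simpa using isIntegral_algebraMap (R := ℚ) (A := ℝ) (x := (m : ℚ))

theorem numberField_adjoin {S : Set ℝ} (hfin : S.Finite) (hS : ∀ x ∈ S, IsIntegral ℚ x) :
    NumberField (IntermediateField.adjoin ℚ S) := by
  have : Finite S := hfin
  have := IntermediateField.finiteDimensional_adjoin hS
  exact NumberField.mk

theorem not_isSquare_of_squarefree {m : ℕ} (hm : Squarefree m) (h1 : m ≠ 1) :
    ¬ IsSquare (m : ℚ) := by
  rw [Rat.isSquare_natCast_iff]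
  rintro ⟨x, rfl⟩
  have := Nat.isUnit_iff.1 (hm x dvd_rfl)
  exact h1 (by rw [this])

theorem even_classNumber_adjoin_iff {p q r : ℕ} (hp : p.Prime) (hq : q.Prime) (hr : r.Prime)
    (hpq : p ≠ q) (hqr : q ≠ r) (hrp : r ≠ p) (hp4 : p = 2 ∨ p % 4 = 1) (hq4 : q % 4 = 1)
    (hr4 : r % 4 = 1) (hJ : J(p | q) = -1) (hJp : J(p | r) = -1) (hJq : J(q | r) = -1)
    (hJr : J(r | q) = -1) :
    Even (Nat.card (ClassGroup (𝓞 (IntermediateField.adjoin ℚ {√(p : ℝ), √(q : ℝ), √(r : ℝ)})))) ↔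
      PrimePair.quartProd p q r = -1 := by
  have hip := isIntegral_sqrt_natCast p
  have hiq := isIntegral_sqrt_natCast q
  have hir := isIntegral_sqrt_natCast r
  have hsp : √(p : ℝ) ^ 2 = p := Real.sq_sqrt p.cast_nonneg
  have hsq : √(q : ℝ) ^ 2 = q := Real.sq_sqrt q.cast_nonneg
  have hsr : √(r : ℝ) ^ 2 = r := Real.sq_sqrt r.cast_nonneg
  have hpqc := (Nat.coprime_primes hp hq).2 hpq
  have hqrc := (Nat.coprime_primes hq hr).2 hqr
  have hprc := (Nat.coprime_primes hp hr).2 hrp.symm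
  have hSK : ∀ x ∈ ({√(p : ℝ)} : Set ℝ), IsIntegral ℚ x := by simpa using hip
  have hSF : ∀ x ∈ ({√(p : ℝ) * √(q : ℝ)} : Set ℝ), IsIntegral ℚ x := by
    simpa using hip.mul hiq
  have hSk : ∀ x ∈ ({√(p : ℝ), √(q : ℝ)} : Set ℝ), IsIntegral ℚ x := by
    simp [hip, hiq]
  have hSL : ∀ x ∈ ({√(p : ℝ), √(q : ℝ), √(r : ℝ)} : Set ℝ), IsIntegral ℚ x := by
    simp [hip, hiq, hir]
  let K := IntermediateField.adjoin ℚ ({√(p : ℝ)} : Set ℝ)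
  let F := IntermediateField.adjoin ℚ ({√(p : ℝ) * √(q : ℝ)} : Set ℝ)
  let k := IntermediateField.adjoin ℚ ({√(p : ℝ), √(q : ℝ)} : Set ℝ)
  let L := IntermediateField.adjoin ℚ ({√(p : ℝ), √(q : ℝ), √(r : ℝ)} : Set ℝ)
  have : NumberField K := numberField_adjoin (Set.toFinite _) hSK
  have : NumberField F := numberField_adjoin (Set.toFinite _) hSF
  have : NumberField k := numberField_adjoin (Set.toFinite _) hSk
  have : NumberField L := numberField_adjoin (Set.toFinite _) hSL
  have hpk : √(p : ℝ) ∈ k := IntermediateField.subset_adjoin _ _ (by simp)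
  have hqk : √(q : ℝ) ∈ k := IntermediateField.subset_adjoin _ _ (by simp)
  have hrL : √(r : ℝ) ∈ L := IntermediateField.subset_adjoin _ _ (by simp)
  have hpK : √(p : ℝ) ∈ K := IntermediateField.subset_adjoin _ _ (by simp)
  have hdF : √(p : ℝ) * √(q : ℝ) ∈ F := IntermediateField.subset_adjoin _ _ (by simp)
  have hKk : K ≤ k := IntermediateField.adjoin_le_iff.2 (by simpa using hpk)
  have hFk : F ≤ k := IntermediateField.adjoin_le_iff.2 (by simpa using mul_mem hpk hqk)
  have hkL : k ≤ L := IntermediateField.adjoin.mono _ _ _ (by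
    intro x hx
    simp only [Set.mem_insert_iff, Set.mem_singleton_iff] at hx ⊢
    tauto)
  let _ : Algebra K k := (IntermediateField.inclusion hKk).toRingHom.toAlgebra
  let _ : Algebra F k := (IntermediateField.inclusion hFk).toRingHom.toAlgebra
  let _ : Algebra k L := (IntermediateField.inclusion hkL).toRingHom.toAlgebra
  have : IsScalarTower K k ℝ := IsScalarTower.of_algebraMap_eq fun _ => rfl
  have : IsScalarTower F k ℝ := IsScalarTower.of_algebraMap_eq fun _ => rfl
  have : IsScalarTower k L ℝ := IsScalarTower.of_algebraMap_eq fun _ => rfl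
  have hK : IsSqrtExt ℚ K (p : ℚ) ⟨√(p : ℝ), hpK⟩ := by
    refine isSqrtExt_adjoin (fun x hx => (hSK x hx).isAlgebraic) hsp ?_
      (not_isSquare_of_squarefree hp.squarefree hp.ne_one)
    rintro x rfl
    exact ⟨0, 1, by simp⟩
  have hF : IsSqrtExt ℚ F ((p * q : ℕ) : ℚ) ⟨√(p : ℝ) * √(q : ℝ), hdF⟩ := by
    refine isSqrtExt_adjoin (fun x hx => (hSF x hx).isAlgebraic) ?_ ?_
      (not_isSquare_of_squarefree ?_ ?_)
    · push_cast
      rw [mul_pow, hsp, hsq]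
    · rintro x rfl
      exact ⟨0, 1, by simp⟩
    · exact (Nat.squarefree_mul hpqc).2 ⟨hp.squarefree, hq.squarefree⟩
    · exact fun h => hp.ne_one (Nat.eq_one_of_mul_eq_one_right h)
  have hK_not (m : ℕ) (h1 : Squarefree (p * m)) (hm : m ≠ 1) : ¬ IsSquare (m : K) := by
    intro h
    rw [← map_natCast (algebraMap ℚ K)] at h
    rcases hK.isSquare_or h with h2 | h2
    · exact not_isSquare_of_squarefree (h1.of_mul_right) hm h2
    · rw [← Nat.cast_mul] at h2
      exact not_isSquare_of_squarefree h1 (fun h => hp.ne_one (Nat.eq_one_of_mul_eq_one_right h)) h2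
  have hk : IsSqrtExt K k (q : K) ⟨√(q : ℝ), hqk⟩ := by
    refine isSqrtExt_adjoin (fun x hx => (hSk x hx).isAlgebraic) hsq ?_ (hK_not q ?_ hq.ne_one)
    · rintro x (rfl | rfl)
      · exact ⟨⟨√(p : ℝ), hpK⟩, 0, by simp⟩
      · exact ⟨0, 1, by simp⟩
    · exact (Nat.squarefree_mul hpqc).2 ⟨hp.squarefree, hq.squarefree⟩
  have hkF : IsSqrtExt F k (p : F) ⟨√(p : ℝ), hpk⟩ := by
    refine isSqrtExt_adjoin (fun x hx => (hSk x hx).isAlgebraic) hsp ?_ ?_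
    · have hp0 : (p : ℝ) ≠ 0 := by exact_mod_cast hp.ne_zero
      rintro x (rfl | rfl)
      · exact ⟨0, 1, by simp⟩
      · refine ⟨0, ⟨√(p : ℝ) * √(q : ℝ), hdF⟩ * (p : F)⁻¹, ?_⟩
        rw [map_zero, map_mul, map_inv₀, map_natCast]
        change _ = 0 + √(p : ℝ) * √(q : ℝ) * (p : ℝ)⁻¹ * √(p : ℝ)
        field_simp
        rw [hsp]
        ring
    · intro h
      rw [← map_natCast (algebraMap ℚ F)] at h
      rcases hF.isSquare_or h with h2 | h2
      · exact not_isSquare_of_squarefree hp.squarefree hp.ne_one h2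
      · refine not_isSquare_of_squarefree hq.squarefree hq.ne_one ?_
        have hp0 : (p : ℚ) ≠ 0 := by exact_mod_cast hp.ne_zero
        obtain ⟨y, hy⟩ := h2
        refine ⟨y / p, ?_⟩
        push_cast at hy
        field_simp
        linear_combination hy
  have hLk : IsSqrtExt k L (r : k) ⟨√(r : ℝ), hrL⟩ := by
    refine isSqrtExt_adjoin (fun x hx => (hSL x hx).isAlgebraic) hsr ?_ ?_
    · rintro x (rfl | rfl | rfl)
      · exact ⟨⟨√(p : ℝ), hpk⟩, 0, by simp⟩
      · exact ⟨⟨√(q : ℝ), hqk⟩, 0, by simp⟩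
      · exact ⟨0, 1, by simp⟩
    · intro h
      rw [← map_natCast (algebraMap K k)] at h
      rcases hk.isSquare_or h with h2 | h2
      · refine hK_not r ?_ hr.ne_one h2
        exact (Nat.squarefree_mul hprc).2 ⟨hp.squarefree, hr.squarefree⟩
      · rw [← Nat.cast_mul] at h2
        refine hK_not (q * r) ?_ (fun h => hq.ne_one (Nat.eq_one_of_mul_eq_one_right h)) h2
        exact (Nat.squarefree_mul (hpqc.mul_right hprc)).2 ⟨hp.squarefree,
          (Nat.squarefree_mul hqrc).2 ⟨hq.squarefree, hr.squarefree⟩⟩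
  have t : QuadraticTower K F k p q ⟨√(p : ℝ), hpK⟩ ⟨√(p : ℝ) * √(q : ℝ), hdF⟩ ⟨√(q : ℝ), hqk⟩ :=
    ⟨hp, hq, hpq, hp4, hq4, hJ, hK, hF, hk, hkF, rfl⟩
  exact t.even_classNumber_iff hr hr4 hqr hrp hJp hJq hJr hLk

theorem jacobiSym_eq_neg_one_of_legSym {a : ℤ} {l : ℕ} (hl : l.Prime) (hl2 : l ≠ 2)
    (h : legSym a l = -1) : J(a | l) = -1 := by
  have := Fact.mk hl
  rw [legSym, if_neg hl2] at h
  have hns : ¬ ∃ x : ℤ, (l : ℤ) ∣ x ^ 2 - a := by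
    intro hx
    rw [if_pos hx] at h
    norm_num at h
  rw [← jacobiSym.legendreSym.to_jacobiSym, legendreSym.eq_neg_one_iff]
  rintro ⟨y, hy⟩
  obtain ⟨x, rfl⟩ := ZMod.intCast_surjective y
  refine hns ⟨x, ?_⟩
  rw [← ZMod.intCast_zmod_eq_zero_iff_dvd]
  push_cast
  rw [hy]
  ring

theorem even_classNumber_iff_of_odd {p q r : ℕ} (hp : p.Prime) (hq : q.Prime) (hr : r.Prime)
    (hpq : p ≠ q) (hqr : q ≠ r) (hrp : r ≠ p) (hp4 : p = 2 ∨ p % 4 = 1) (hq4 : q % 4 = 1)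
    (hr4 : r % 4 = 1) (h1 : legSym p q = -1) (h2 : legSym q r = -1) (h3 : legSym r p = -1) :
    Even (Nat.card (ClassGroup (𝓞 (IntermediateField.adjoin ℚ {√(p : ℝ), √(q : ℝ), √(r : ℝ)})))) ↔
      PrimePair.quartProd p q r = -1 := by
  have hJq : J(q | r) = -1 := jacobiSym_eq_neg_one_of_legSym hr (by omega) h2
  refine even_classNumber_adjoin_iff hp hq hr hpq hqr hrp hp4 hq4 hr4
    (jacobiSym_eq_neg_one_of_legSym hq (by omega) h1) ?_ hJq ?_
  · rcases hp4 with rfl | hp4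
    · rw [legSym, if_pos rfl] at h3
      have h8 : ¬ ((r : ℤ) % 8 = 1 ∨ (r : ℤ) % 8 = 7) := by
        intro h
        rw [if_pos h] at h3
        norm_num at h3
      rw [Nat.cast_ofNat, jacobiSym_two_eq_ite (by omega), if_neg (by omega)]
    · rw [jacobiSym.quadratic_reciprocity_one_mod_four hp4 (Nat.odd_iff.2 (by omega))]
      exact jacobiSym_eq_neg_one_of_legSym hp (by omega) h3
  · rw [jacobiSym.quadratic_reciprocity_one_mod_four hr4 (Nat.odd_iff.2 (by omega))]
    exact hJq

theorem stmt_11 (p q r : ℕ)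
    (hp : p.Prime) (hq : q.Prime) (hr : r.Prime)
    (hpq : p ≠ q) (hqr : q ≠ r) (hrp : r ≠ p)
    (hp4 : p % 4 ≠ 3) (hq4 : q % 4 ≠ 3) (hr4 : r % 4 ≠ 3)
    (h1 : legSym (p : ℤ) q = -1) (h2 : legSym (q : ℤ) r = -1) (h3 : legSym (r : ℤ) p = -1)
    (L : IntermediateField ℚ ℝ)
    (hL : L = IntermediateField.adjoin ℚ
      {Real.sqrt (p : ℝ), Real.sqrt (q : ℝ), Real.sqrt (r : ℝ)}) :
    (Even (Nat.card (ClassGroup (NumberField.RingOfIntegers L))) ↔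
      quartSym ((p * q : ℕ) : ℤ) r * quartSym ((q * r : ℕ) : ℤ) p *
        quartSym ((r * p : ℕ) : ℤ) q = -1) := by
  have hmod : ∀ l : ℕ, l.Prime → l % 4 ≠ 3 → l = 2 ∨ l % 4 = 1 := by
    intro l hl h4
    rcases hl.eq_two_or_odd with h | h <;> omega
  have hp' := hmod p hp hp4
  have hq' := hmod q hq hq4
  have hr' := hmod r hr hr4
  subst hL
  push_cast
  by_cases hq2 : q = 2
  · have := even_classNumber_iff_of_odd hq hr hp hqr hrp hpq hq' (by omega) (by omega) h2 h3 h1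
    rw [PrimePair.quartProd] at this
    rw [show ({√(p : ℝ), √(q : ℝ), √(r : ℝ)} : Set ℝ) = {√(q : ℝ), √(r : ℝ), √(p : ℝ)} by
      ext x; simp; tauto, this]
    ring_nf
  by_cases hr2 : r = 2
  · have := even_classNumber_iff_of_odd hr hp hq hrp hpq hqr hr' (by omega) (by omega) h3 h1 h2
    rw [PrimePair.quartProd] at this
    rw [show ({√(p : ℝ), √(q : ℝ), √(r : ℝ)} : Set ℝ) = {√(r : ℝ), √(p : ℝ), √(q : ℝ)} by
      ext x; simp; tauto, this]
    ring_nf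
  · have := even_classNumber_iff_of_odd hp hq hr hpq hqr hrp hp' (by omega) (by omega) h1 h2 h3
    rwa [PrimePair.quartProd] at this
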